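/- Let p ≥ q ≥ 1 and n = p + q. An element (λ, s) with λ = (λ₁ ≥ … ≥ λ_n) ∈ ℝⁿ and s = (s₁ ≥ … ≥ s_q ≥ 0) ∈ ℝ^q belongs to A(p,q) if and only if for every integer r with 1 ≤ r ≤ n/2 and every triple (I,J,K) ∈ LR^n_r one has |λ|_I − |λ|_{J^o} ≥ 2|s|_{K∩[q]} − 2|s|_{K^o∩[q]}, where J^o and K^o are taken relative to [n] and [q] is viewed as a subset of [n]. -/

import Mathlib

open Matrix

/-- Eigenvalues of a (Hermitian) complex matrix, listed in decreasing order. -/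
noncomputable def eigVec {k : ℕ} (X : Matrix (Fin k) (Fin k) ℂ) (hX : X.IsHermitian) :
    Fin k → ℝ :=
  fun i => hX.eigenvalues (Tuple.sort hX.eigenvalues i.rev)

/-- The `i`-th (0-based) singular value of a rectangular complex matrix:
the square root of the `i`-th largest eigenvalue of `Y * Yᴴ` (and `0` for `i ≥ a`). -/
noncomputable def sval {a b : ℕ} (Y : Matrix (Fin a) (Fin b) ℂ) (i : ℕ) : ℝ :=
  if h : i < a then
    Real.sqrt (eigVec (Y * Yᴴ) (Matrix.isHermitian_mul_conjTranspose_self Y) ⟨i, h⟩)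
  else 0

/-- The Horn cone `Horn(k)`. -/
def Horn (k : ℕ) : Set ((Fin k → ℝ) × (Fin k → ℝ) × (Fin k → ℝ)) :=
  { v | ∃ (X Y : Matrix (Fin k) (Fin k) ℂ) (hX : X.IsHermitian) (hY : Y.IsHermitian),
      v.1 = eigVec X hX ∧ v.2.1 = eigVec Y hY ∧ v.2.2 = eigVec (X + Y) (hX.add hY) }

/-- The Littlewood–Richardson cone `LR(m,n)`. -/
def LRcone (m n : ℕ) : Set ((Fin (m + n) → ℝ) × (Fin m → ℝ) × (Fin n → ℝ)) :=
  { v | ∃ (M : Matrix (Fin (m + n)) (Fin (m + n)) ℂ) (hM : M.IsHermitian),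
      v.1 = eigVec M hM ∧
      v.2.1 = eigVec (M.submatrix (Fin.castAdd n) (Fin.castAdd n))
        (hM.submatrix (Fin.castAdd n)) ∧
      v.2.2 = eigVec (M.submatrix (Fin.natAdd m) (Fin.natAdd m))
        (hM.submatrix (Fin.natAdd m)) }

/-- Top-left `p × p` block. -/
def blockTL (p q : ℕ) (X : Matrix (Fin (p + q)) (Fin (p + q)) ℂ) : Matrix (Fin p) (Fin p) ℂ :=
  X.submatrix (Fin.castAdd q) (Fin.castAdd q)

/-- Top-right `p × q` block. -/
def blockTR (p q : ℕ) (X : Matrix (Fin (p + q)) (Fin (p + q)) ℂ) : Matrix (Fin p) (Fin q) ℂ :=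
  X.submatrix (Fin.castAdd q) (Fin.natAdd p)

/-- Bottom-left `q × p` block. -/
def blockBL (p q : ℕ) (X : Matrix (Fin (p + q)) (Fin (p + q)) ℂ) : Matrix (Fin q) (Fin p) ℂ :=
  X.submatrix (Fin.natAdd p) (Fin.castAdd q)

/-- Bottom-right `q × q` block. -/
def blockBR (p q : ℕ) (X : Matrix (Fin (p + q)) (Fin (p + q)) ℂ) : Matrix (Fin q) (Fin q) ℂ :=
  X.submatrix (Fin.natAdd p) (Fin.natAdd p)

/-- `λ* = (−λ_k, …, −λ_1)`. -/
def starVec {k : ℕ} (x : Fin k → ℝ) : Fin k → ℝ := fun i => -x i.rev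

/-- `ŝ^{p,q} = (s₁, …, s_q, 0, …, 0, −s_q, …, −s₁) ∈ ℝ^{p+q}` (with `p − q` middle zeros). -/
noncomputable def hatPQ (p q : ℕ) (s : Fin q → ℝ) : Fin (p + q) → ℝ :=
  fun i =>
    if h : (i : ℕ) < q then s ⟨i, h⟩
    else if h' : (i : ℕ) < p then 0
    else -s ⟨p + q - 1 - i, by have := i.isLt; omega⟩

/-- The cone `A(p,q)`: pairs `(e(X), s(X₁₂))` for `X` Hermitian of size `p+q`. -/
def coneA (p q : ℕ) : Set ((Fin (p + q) → ℝ) × (Fin q → ℝ)) :=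
  { v | ∃ (X : Matrix (Fin (p + q)) (Fin (p + q)) ℂ) (hX : X.IsHermitian),
      v.1 = eigVec X hX ∧ ∀ i : Fin q, v.2 i = sval (blockTR p q X) (i : ℕ) }

/-- The cone `S(p,q)`: triples `(s(X), s(X₁₂), s(X₂₁))`. -/
def coneS (p q : ℕ) : Set ((Fin (p + q) → ℝ) × (Fin q → ℝ) × (Fin q → ℝ)) :=
  { v | ∃ X : Matrix (Fin (p + q)) (Fin (p + q)) ℂ,
      (∀ i : Fin (p + q), v.1 i = sval X (i : ℕ)) ∧
      (∀ i : Fin q, v.2.1 i = sval (blockTR p q X) (i : ℕ)) ∧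
      (∀ i : Fin q, v.2.2 i = sval (blockBL p q X) (i : ℕ)) }

/-- The cone `T(p,q)`: triples `(s(X), s(X₁₁), s(X₂₂))`. -/
def coneT (p q : ℕ) : Set ((Fin (p + q) → ℝ) × (Fin p → ℝ) × (Fin q → ℝ)) :=
  { v | ∃ X : Matrix (Fin (p + q)) (Fin (p + q)) ℂ,
      (∀ i : Fin (p + q), v.1 i = sval X (i : ℕ)) ∧
      (∀ i : Fin p, v.2.1 i = sval (blockTL p q X) (i : ℕ)) ∧
      (∀ i : Fin q, v.2.2 i = sval (blockBR p q X) (i : ℕ)) }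

/-- `μ(A) = (a_r − r ≥ … ≥ a₂ − 2 ≥ a₁ − 1)` as a decreasing real vector, for
`A = {a₁ < … < a_r}` a subset of `[n]` (0-based indexing internally). -/
noncomputable def muVec {n r : ℕ} (A : Finset (Fin n)) (h : A.card = r) : Fin r → ℝ :=
  fun k => (((A.orderIsoOfFin h k.rev : Fin n) : ℕ) : ℝ) - ((k.rev : ℕ) : ℝ)

/-- `A^o = {ℓ + 1 − a : a ∈ A}` inside `[ℓ]`. -/
def opp {n : ℕ} (A : Finset (Fin n)) : Finset (Fin n) := A.image Fin.rev

/-- `|s|_{K ∩ [q]}` where `K ⊆ [n]`, `s ∈ ℝ^q` and `[q]` is viewed inside `[n]`. -/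
noncomputable def sumRestr {n q : ℕ} (s : Fin q → ℝ) (K : Finset (Fin n)) : ℝ :=
  ∑ i ∈ K, (if h : (i : ℕ) < q then s ⟨i, h⟩ else 0)

/-- The augmented matrix `Ŷ^{p,q} = [[0, Y], [Yᴴ, 0]]` of size `p + q`. -/
def hatM (p q : ℕ) (Y : Matrix (Fin p) (Fin q) ℂ) : Matrix (Fin (p + q)) (Fin (p + q)) ℂ :=
  Matrix.reindex finSumFinEquiv finSumFinEquiv (Matrix.fromBlocks 0 Y Yᴴ 0)

lemma eigVec_antitone {k : ℕ} (X : Matrix (Fin k) (Fin k) ℂ) (hX : X.IsHermitian) :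
    Antitone (eigVec X hX) := by
  intro i j hij
  exact Tuple.monotone_sort hX.eigenvalues (Fin.rev_le_rev.mpr hij)

/-- Two decreasing vectors with the same multiset of entries agree. -/
lemma eq_of_antitone_of_map_eq {k : ℕ} {x y : Fin k → ℝ} (hx : Antitone x) (hy : Antitone y)
    (h : Multiset.map x Finset.univ.val = Multiset.map y Finset.univ.val) : x = y := by
  have hl : List.ofFn x = List.ofFn y := by
    apply List.Perm.eq_of_pairwise' (r := (· ≥ ·))
    · exact List.pairwise_ofFn.mpr fun i j hij => hx hij.le
    · exact List.pairwise_ofFn.mpr fun i j hij => hy hij.le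
    · rw [← Multiset.coe_eq_coe]
      simpa [Fin.univ_val_map] using h
  exact List.ofFn_injective hl

lemma eigVec_map_eq {k : ℕ} (X : Matrix (Fin k) (Fin k) ℂ) (hX : X.IsHermitian) :
    Multiset.map (eigVec X hX) Finset.univ.val = Multiset.map hX.eigenvalues Finset.univ.val := by
  let σ : Equiv.Perm (Fin k) := Fin.revPerm.trans (Tuple.sort hX.eigenvalues)
  have : eigVec X hX = hX.eigenvalues ∘ σ := rfl
  rw [this, ← Multiset.map_map]
  congr 1
  exact Multiset.map_univ_val_equiv σ

/-- A unitary conjugate of a real diagonal matrix is Hermitian. -/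
lemma isHermitian_conj_diagonal {k : ℕ} (U : Matrix (Fin k) (Fin k) ℂ) (d : Fin k → ℝ) :
    (U * diagonal (fun i => (d i : ℂ)) * Uᴴ).IsHermitian := by
  unfold IsHermitian
  rw [conjTranspose_mul, conjTranspose_mul, conjTranspose_conjTranspose, diagonal_conjTranspose,
    Matrix.mul_assoc]
  congr 3
  ext i; simp

lemma exists_unitary_eigVec {k : ℕ} (X : Matrix (Fin k) (Fin k) ℂ) (hX : X.IsHermitian) :
    ∃ U : Matrix (Fin k) (Fin k) ℂ, Uᴴ * U = 1 ∧
      X = U * diagonal (fun i => (eigVec X hX i : ℂ)) * Uᴴ := by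
  let σ : Equiv.Perm (Fin k) := Fin.revPerm.trans (Tuple.sort hX.eigenvalues)
  let V : Matrix (Fin k) (Fin k) ℂ := hX.eigenvectorUnitary
  have hV : Vᴴ * V = 1 := by
    have := (hX.eigenvectorUnitary).2
    exact (Unitary.mem_iff.mp this).1
  refine ⟨V.submatrix id σ, ?_, ?_⟩
  · have h2 := submatrix_mul_equiv Vᴴ V σ (Equiv.refl _) σ
    rw [hV, Equiv.coe_refl] at h2
    rw [conjTranspose_submatrix, h2]
    ext i j; simp [Matrix.one_apply]
  · have h1 : diagonal (fun i => (eigVec X hX i : ℂ)) =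
        (diagonal (fun i => (hX.eigenvalues i : ℂ))).submatrix σ σ := by
      rw [submatrix_diagonal_equiv]; rfl
    rw [h1, submatrix_mul_equiv, conjTranspose_submatrix, submatrix_mul_equiv]
    have := hX.spectral_theorem
    rw [Unitary.conjStarAlgAut_apply] at this
    rw [submatrix_id_id]
    exact this

lemma eigVec_unique {k : ℕ} {X U : Matrix (Fin k) (Fin k) ℂ} (hX : X.IsHermitian)
    {d : Fin k → ℝ} (hd : Antitone d) (hU : Uᴴ * U = 1)
    (h : X = U * diagonal (fun i => (d i : ℂ)) * Uᴴ) : eigVec X hX = d := by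
  apply eq_of_antitone_of_map_eq (eigVec_antitone X hX) hd
  rw [eigVec_map_eq]
  have h1 := hX.roots_charpoly_eq_eigenvalues
  have h2 : X.charpoly = (diagonal (fun i => (d i : ℂ))).charpoly := by
    let u : (Matrix (Fin k) (Fin k) ℂ)ˣ := ⟨U, Uᴴ, mul_eq_one_comm.mp hU, hU⟩
    have := Matrix.charpoly_units_conj u (diagonal (fun i => (d i : ℂ)))
    rw [← coe_units_inv] at this
    rw [← this, h]; rfl
  rw [h2, charpoly_diagonal, Polynomial.roots_prod _ _ (by
    rw [Finset.prod_ne_zero_iff]; intro i _; exact Polynomial.X_sub_C_ne_zero _)] at h1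
  simp only [Polynomial.roots_X_sub_C, Multiset.bind_singleton] at h1
  have h3 := congrArg (Multiset.map Complex.re) h1
  simpa [Multiset.map_map, Function.comp_def] using h3.symm

/-- For `I = {i₀ < i₁ < …}`, the number `i_a - a` of non-elements of `I` below `i_a`. -/
def level {n r : ℕ} (I : Finset (Fin n)) (h : I.card = r) (a : Fin r) : ℕ :=
  (I.orderEmbOfFin h a : ℕ) - a

/-- Unitary conjugates of the diagonal matrices with entries `c i` sum up to `m` times the
identity. -/
def ScalarSum (r m : ℕ) (c : Fin 3 → Fin r → ℕ) : Prop :=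
  ∃ E : Fin 3 → Matrix (Fin r) (Fin r) ℂ, (∀ i, (E i)ᴴ * E i = 1) ∧
    ∑ i, E i * diagonal (fun a => (c i a : ℂ)) * (E i)ᴴ = (m : ℂ) • (1 : Matrix (Fin r) (Fin r) ℂ)

lemma le_orderEmbOfFin {n r : ℕ} (I : Finset (Fin n)) (h : I.card = r) (a : Fin r) :
    (a : ℕ) ≤ I.orderEmbOfFin h a := by
  obtain ⟨a, ha⟩ := a
  induction a with
  | zero => simp
  | succ k ih =>
    have h1 := ih (by omega)
    have h2 : I.orderEmbOfFin h ⟨k, by omega⟩ < I.orderEmbOfFin h ⟨k + 1, ha⟩ :=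
      (I.orderEmbOfFin h).strictMono (by simp [Fin.lt_def])
    rw [Fin.lt_def] at h2
    simp only at h1 ⊢
    omega

lemma level_add {n r : ℕ} (I : Finset (Fin n)) (h : I.card = r) (a : Fin r) :
    level I h a + a = I.orderEmbOfFin h a := by
  have := le_orderEmbOfFin I h a
  unfold level; omega

lemma level_mono {n r : ℕ} (I : Finset (Fin n)) (h : I.card = r) : Monotone (level I h) := by
  intro a b hab
  obtain ⟨a, ha⟩ := a
  obtain ⟨b, hb⟩ := b
  induction b with
  | zero =>
    have : a = 0 := by simpa [Fin.le_def] using hab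
    subst this; rfl
  | succ k ih =>
    rcases Nat.lt_or_ge a (k + 1) with hlt | hge
    · refine (ih (by omega) (by simp [Fin.le_def]; omega)).trans ?_
      have h2 : I.orderEmbOfFin h ⟨k, by omega⟩ < I.orderEmbOfFin h ⟨k + 1, hb⟩ :=
        (I.orderEmbOfFin h).strictMono (by simp [Fin.lt_def])
      have e1 := level_add I h ⟨k, by omega⟩
      have e2 := level_add I h ⟨k + 1, hb⟩
      rw [Fin.lt_def] at h2
      simp only at e1 e2
      omega
    · have : a = k + 1 := by simp [Fin.le_def] at hab; omega
      subst this; rfl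

lemma muVec_eq_level {n r : ℕ} (I : Finset (Fin n)) (h : I.card = r) (k : Fin r) :
    muVec I h k = level I h k.rev := by
  have := level_add I h k.rev
  unfold muVec
  rw [Finset.coe_orderIsoOfFin_apply, ← this]
  push_cast; ring

lemma muVec_antitone {n r : ℕ} (I : Finset (Fin n)) (h : I.card = r) : Antitone (muVec I h) := by
  intro a b hab
  rw [muVec_eq_level, muVec_eq_level]
  exact_mod_cast level_mono I h (Fin.rev_le_rev.mpr hab)

lemma opp_card {n : ℕ} (K : Finset (Fin n)) : (opp K).card = K.card :=
  Finset.card_image_of_injective _ Fin.rev_injective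

lemma opp_opp {n : ℕ} (K : Finset (Fin n)) : opp (opp K) = K := by
  ext x
  simp [opp]

lemma orderEmbOfFin_opp {n r : ℕ} (K : Finset (Fin n)) (h : K.card = r)
    (h' : (opp K).card = r) (a : Fin r) :
    (opp K).orderEmbOfFin h' a = (K.orderEmbOfFin h a.rev).rev := by
  have : (fun a : Fin r => (K.orderEmbOfFin h a.rev).rev) = (opp K).orderEmbOfFin h' := by
    apply Finset.orderEmbOfFin_unique
    · intro x
      exact Finset.mem_image_of_mem _ (Finset.orderEmbOfFin_mem _ _ _)
    · intro x y hxy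
      exact Fin.rev_lt_rev.mpr ((K.orderEmbOfFin h).strictMono (Fin.rev_lt_rev.mpr hxy))
  exact (congrFun this a).symm

lemma level_opp {n r : ℕ} (K : Finset (Fin n)) (h : K.card = r) (h' : (opp K).card = r)
    (a : Fin r) : level (opp K) h' a + level K h a.rev = n - r := by
  have h1 := level_add K h a.rev
  have h2 := level_add (opp K) h' a
  rw [orderEmbOfFin_opp K h h', Fin.val_rev] at h2
  have h3 := (K.orderEmbOfFin h a.rev).isLt
  have h4 := a.isLt
  have h5 := le_orderEmbOfFin (opp K) h' a
  rw [orderEmbOfFin_opp K h h', Fin.val_rev] at h5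
  rw [Fin.val_rev] at h1
  have h6 : r ≤ n := by rw [← h]; simpa using Finset.card_le_univ K
  omega

lemma conj_diagonal_rev {k : ℕ} (U : Matrix (Fin k) (Fin k) ℂ) (d : Fin k → ℂ) :
    U.submatrix id Fin.revPerm * diagonal (fun i => d i.rev) * (U.submatrix id Fin.revPerm)ᴴ
      = U * diagonal d * Uᴴ := by
  have h1 : diagonal (fun i => d i.rev) = (diagonal d).submatrix Fin.revPerm Fin.revPerm := by
    rw [submatrix_diagonal_equiv]; rfl
  rw [h1, submatrix_mul_equiv, conjTranspose_submatrix, submatrix_mul_equiv, submatrix_id_id]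

lemma unitary_rev {k : ℕ} {U : Matrix (Fin k) (Fin k) ℂ} (hU : Uᴴ * U = 1) :
    (U.submatrix id Fin.revPerm)ᴴ * U.submatrix id Fin.revPerm = 1 := by
  have h2 := submatrix_mul_equiv Uᴴ U Fin.revPerm (Equiv.refl _) Fin.revPerm
  rw [hU, Equiv.coe_refl] at h2
  rw [conjTranspose_submatrix, h2]
  ext i j; simp [Matrix.one_apply]

lemma conj_diagonal_scalar_sub {k : ℕ} {U : Matrix (Fin k) (Fin k) ℂ} (hU : Uᴴ * U = 1)
    (m : ℂ) (d : Fin k → ℂ) :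
    U * diagonal (fun i => m - d i) * Uᴴ = m • (1 : Matrix (Fin k) (Fin k) ℂ) -
      U * diagonal d * Uᴴ := by
  have : diagonal (fun i => m - d i) = m • (1 : Matrix (Fin k) (Fin k) ℂ) - diagonal d := by
    rw [← diagonal_one, ← diagonal_smul, diagonal_sub]; simp
  rw [this, Matrix.mul_sub, Matrix.sub_mul, Matrix.mul_smul, Matrix.smul_mul, Matrix.mul_one,
    mul_eq_one_comm.mp hU]

theorem mem_Horn_iff_scalarSum {n r : ℕ} (I J K : Finset (Fin n)) (hI : I.card = r)
    (hJ : J.card = r) (hK : K.card = r) :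
    (muVec I hI, muVec J hJ, muVec K hK) ∈ Horn r ↔
      ScalarSum r (n - r) ![level I hI, level J hJ, level (opp K) ((opp_card K).trans hK)] := by
  have key : ∀ a : Fin r, ((level (opp K) ((opp_card K).trans hK) a : ℕ) : ℂ) =
      ((n - r : ℕ) : ℂ) - ((muVec K hK a : ℝ) : ℂ) := by
    intro a
    have := level_opp K hK ((opp_card K).trans hK) a
    rw [← this, muVec_eq_level]
    push_cast; ring
  have keyI : ∀ (I : Finset (Fin n)) (hI : I.card = r) (a : Fin r),
      ((level I hI a : ℕ) : ℂ) = ((muVec I hI a.rev : ℝ) : ℂ) := by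
    intro I hI a
    rw [muVec_eq_level, Fin.rev_rev]; simp
  constructor
  · rintro ⟨X, Y, hX, hY, h1, h2, h3⟩
    simp only at h1 h2 h3
    obtain ⟨U, hU, hU'⟩ := exists_unitary_eigVec X hX
    obtain ⟨V, hV, hV'⟩ := exists_unitary_eigVec Y hY
    obtain ⟨W, hW, hW'⟩ := exists_unitary_eigVec (X + Y) (hX.add hY)
    rw [← h1] at hU'
    rw [← h2] at hV'
    rw [← h3] at hW'
    refine ⟨![U.submatrix id Fin.revPerm, V.submatrix id Fin.revPerm, W], ?_, ?_⟩
    · intro i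
      fin_cases i
      · exact unitary_rev hU
      · exact unitary_rev hV
      · exact hW
    · rw [Fin.sum_univ_three]
      simp only [cons_val_zero, cons_val_one, cons_val]
      simp only [key, keyI]
      rw [conj_diagonal_rev U (fun a => ((muVec I hI a : ℝ) : ℂ)),
        conj_diagonal_rev V (fun a => ((muVec J hJ a : ℝ) : ℂ)), conj_diagonal_scalar_sub hW,
        ← hU', ← hV', ← hW']
      abel
  · rintro ⟨E, hE, hs⟩
    rw [Fin.sum_univ_three] at hs
    simp only [cons_val_zero, cons_val_one, cons_val] at hs
    simp only [key, keyI] at hs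
    rw [conj_diagonal_scalar_sub (hE 2)] at hs
    have eI := conj_diagonal_rev ((E 0).submatrix id Fin.revPerm)
      (fun a => ((muVec I hI a : ℝ) : ℂ))
    have eJ := conj_diagonal_rev ((E 1).submatrix id Fin.revPerm)
      (fun a => ((muVec J hJ a : ℝ) : ℂ))
    have hrr : ∀ A : Matrix (Fin r) (Fin r) ℂ,
        (A.submatrix id Fin.revPerm).submatrix id Fin.revPerm = A := by
      intro A; ext i j; simp
    rw [hrr] at eI eJ
    rw [eI, eJ] at hs
    refine ⟨_, _, isHermitian_conj_diagonal ((E 0).submatrix id Fin.revPerm) (muVec I hI),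
      isHermitian_conj_diagonal ((E 1).submatrix id Fin.revPerm) (muVec J hJ), ?_, ?_, ?_⟩
    · exact (eigVec_unique _ (muVec_antitone I hI) (unitary_rev (hE 0)) rfl).symm
    · exact (eigVec_unique _ (muVec_antitone J hJ) (unitary_rev (hE 1)) rfl).symm
    · refine (eigVec_unique _ (muVec_antitone K hK) (hE 2) ?_).symm
      rw [← add_sub_assoc, sub_eq_iff_eq_add, add_comm ((_ : ℂ) • _)] at hs
      exact add_right_cancel hs

lemma det_eq_one_of_unitary {k : ℕ} {U : Matrix (Fin k) (Fin k) ℂ} (hU : Uᴴ * U = 1) :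
    U.det * (Uᴴ).det = 1 := by
  rw [← det_mul, mul_eq_one_comm.mp hU, det_one]

lemma hatM_isHermitian (p q : ℕ) (Y : Matrix (Fin p) (Fin q) ℂ) : (hatM p q Y).IsHermitian := by
  unfold hatM
  rw [reindex_apply]
  apply IsHermitian.submatrix
  rw [isHermitian_fromBlocks_iff]
  simp [IsHermitian]

lemma hatPQ_antitone {p q : ℕ} {s : Fin q → ℝ} (hs : Antitone s) (hs0 : ∀ i, 0 ≤ s i) :
    Antitone (hatPQ p q s) := by
  intro i j hij
  have hij' : (i : ℕ) ≤ j := hij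
  unfold hatPQ
  split_ifs with h1 h2 h3 h4 h5 h6 h7 h8
  · exact hs hij'
  · omega
  · omega
  · exact hs0 _
  · exact le_rfl
  · omega
  · exact (neg_nonpos.mpr (hs0 _)).trans (hs0 _)
  · exact neg_nonpos.mpr (hs0 _)
  · apply neg_le_neg
    apply hs
    simp only [Fin.le_def]
    omega

lemma prod_sub_hatPQ (d q : ℕ) (s : Fin q → ℝ) (t : ℂ) :
    ∏ k, (t - (hatPQ (q + d) q s k : ℂ)) = t ^ d * ∏ i, ((t - s i) * (t + s i)) := by
  rw [Fin.prod_univ_add, Fin.prod_univ_add]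
  have h1 : ∀ i : Fin q, hatPQ (q + d) q s (Fin.castAdd q (Fin.castAdd d i)) = s i := by
    intro i; simp [hatPQ]
  have h2 : ∀ i : Fin d, hatPQ (q + d) q s (Fin.castAdd q (Fin.natAdd q i)) = 0 := by
    intro i; simp [hatPQ]
  have h3 : ∀ i : Fin q, hatPQ (q + d) q s (Fin.natAdd (q + d) i) = - s i.rev := by
    intro i
    have e1 : ¬ (q + d + (i : ℕ) < q) := by omega
    simp only [hatPQ, Fin.val_natAdd, e1, dite_false]
    rw [dif_neg (by omega)]
    congr 2
    ext
    simp only [Fin.val_rev]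
    omega
  simp only [h1, h2, h3]
  have h4 : ∏ i : Fin q, (t - ((- s i.rev : ℝ) : ℂ)) = ∏ i : Fin q, (t + s i) := by
    rw [← Equiv.prod_comp Fin.revPerm]
    simp
  rw [h4, Finset.prod_mul_distrib]
  simp
  ring

open scoped ComplexOrder in
lemma eigVec_mul_conjTranspose_eq_zero {p q : ℕ} (Y : Matrix (Fin p) (Fin q) ℂ) (i : Fin p)
    (hi : q ≤ i) : eigVec (Y * Yᴴ) (isHermitian_mul_conjTranspose_self Y) i = 0 := by
  set hX := isHermitian_mul_conjTranspose_self Y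
  by_contra hne
  have hnn : ∀ j, 0 ≤ eigVec (Y * Yᴴ) hX j := fun j =>
    (posSemidef_self_mul_conjTranspose Y).eigenvalues_nonneg _
  have hpos : ∀ j ≤ i, eigVec (Y * Yᴴ) hX j ≠ 0 := by
    intro j hj
    have h1 := eigVec_antitone _ hX hj
    have h2 := lt_of_le_of_ne (hnn i) (Ne.symm hne)
    exact (h2.trans_le h1).ne'
  have hr : (Y * Yᴴ).rank ≤ q := by
    refine (rank_mul_le_left _ _).trans ?_
    simpa using rank_le_width Y
  rw [hX.rank_eq_card_non_zero_eigs, Fintype.card_subtype] at hr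
  let σ : Equiv.Perm (Fin p) := Fin.revPerm.trans (Tuple.sort hX.eigenvalues)
  have : ((Finset.Iic i).map σ.toEmbedding).card ≤ q := by
    refine le_trans (Finset.card_le_card ?_) hr
    intro x hx
    rw [Finset.mem_map] at hx
    obtain ⟨j, hj, rfl⟩ := hx
    simp only [Finset.mem_filter, Finset.mem_univ, true_and]
    exact hpos j (Finset.mem_Iic.mp hj)
  rw [Finset.card_map, Fin.card_Iic] at this
  omega

open scoped ComplexOrder in
theorem eigVec_hatM {p q : ℕ} (hpq : q ≤ p) (Y : Matrix (Fin p) (Fin q) ℂ) :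
    eigVec (hatM p q Y) (hatM_isHermitian p q Y) = hatPQ p q (fun i => sval Y i) := by
  obtain ⟨d, rfl⟩ := Nat.exists_eq_add_of_le hpq
  set hX := isHermitian_mul_conjTranspose_self Y with hXdef
  set μ := eigVec (Y * Yᴴ) hX with hμ
  have hnn : ∀ j, 0 ≤ μ j := fun j =>
    (posSemidef_self_mul_conjTranspose Y).eigenvalues_nonneg _
  have hsval : ∀ i : Fin q, sval Y i = Real.sqrt (μ (Fin.castAdd d i)) := by
    intro i
    have : (i : ℕ) < q + d := by omega
    simp only [sval, this, dite_true]
    rfl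
  have hanti : Antitone (fun i : Fin q => sval Y i) := by
    intro i j hij
    simp only [hsval]
    have hij' : Fin.castAdd d i ≤ Fin.castAdd d j := hij
    exact Real.sqrt_le_sqrt (eigVec_antitone _ hX hij')
  have hs0 : ∀ i : Fin q, 0 ≤ sval Y i := fun i => by rw [hsval]; exact Real.sqrt_nonneg _
  obtain ⟨U, hU, hU'⟩ := exists_unitary_eigVec (Y * Yᴴ) hX
  set H := hatM_isHermitian (q + d) q Y
  have hchar : (hatM (q + d) q Y).charpoly =
      ∏ k, (Polynomial.X - Polynomial.C (hatPQ (q + d) q (fun i => sval Y i) k : ℂ)) := by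
    apply Polynomial.eq_of_infinite_eval_eq
    refine Set.Infinite.mono (s := {0}ᶜ) ?_ (Set.Finite.infinite_compl (Set.finite_singleton 0))
    intro t (ht : t ≠ 0)
    simp only [Set.mem_ofPred_eq]
    rw [eval_charpoly, Polynomial.eval_prod]
    simp only [Polynomial.eval_sub, Polynomial.eval_X, Polynomial.eval_C]
    rw [prod_sub_hatPQ]
    have e1 : scalar (Fin (q + d + q)) t - hatM (q + d) q Y =
        reindex finSumFinEquiv finSumFinEquiv
          (fromBlocks (t • (1 : Matrix (Fin (q + d)) (Fin (q + d)) ℂ)) (-Y) (-Yᴴ)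
            (t • (1 : Matrix (Fin q) (Fin q) ℂ))) := by
      have : scalar (Fin (q + d + q)) t = reindex finSumFinEquiv finSumFinEquiv
          (fromBlocks (t • (1 : Matrix (Fin (q + d)) (Fin (q + d)) ℂ)) 0 0
            (t • (1 : Matrix (Fin q) (Fin q) ℂ))) := by
        rw [show (fromBlocks (t • (1 : Matrix (Fin (q + d)) (Fin (q + d)) ℂ)) 0 0
            (t • (1 : Matrix (Fin q) (Fin q) ℂ))) =
            t • (1 : Matrix (Fin (q + d) ⊕ Fin q) (Fin (q + d) ⊕ Fin q) ℂ) by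
          rw [← fromBlocks_one, fromBlocks_smul]; simp]
        ext i j
        simp [scalar_apply, diagonal_apply, one_apply]
      rw [this, hatM]
      ext i j
      simp only [reindex_apply, submatrix_apply, Matrix.sub_apply]
      rcases finSumFinEquiv.symm i with a | a <;> rcases finSumFinEquiv.symm j with b | b <;>
        simp
    rw [e1, det_reindex_self]
    let inv : Invertible (t • (1 : Matrix (Fin q) (Fin q) ℂ)) :=
      ⟨t⁻¹ • 1, by simp [ht], by simp [ht]⟩
    rw [det_fromBlocks₂₂]
    have e2 : t • (1 : Matrix (Fin (q + d)) (Fin (q + d)) ℂ) -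
        -Y * ⅟(t • (1 : Matrix (Fin q) (Fin q) ℂ)) * -Yᴴ =
        U * diagonal (fun i => t - t⁻¹ * (μ i : ℂ)) * Uᴴ := by
      rw [conj_diagonal_scalar_sub hU]
      have : ⅟(t • (1 : Matrix (Fin q) (Fin q) ℂ)) = t⁻¹ • 1 := rfl
      rw [this]
      have e3 : diagonal (fun i => t⁻¹ * (μ i : ℂ)) = t⁻¹ • diagonal (fun i => (μ i : ℂ)) := by
        rw [← diagonal_smul]; rfl
      rw [e3, Matrix.mul_smul U, Matrix.smul_mul _ (U * _), ← hU']
      simp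
    rw [e2, det_mul, det_mul, mul_right_comm, det_eq_one_of_unitary hU, one_mul, det_diagonal,
      Fin.prod_univ_add]
    have e4 : ∀ i : Fin d, μ (Fin.natAdd q i) = 0 := fun i =>
      eigVec_mul_conjTranspose_eq_zero Y _ (by simp)
    have e5 : ∀ i : Fin q, (μ (Fin.castAdd d i) : ℂ) = (sval Y i : ℂ) ^ 2 := by
      intro i
      rw [hsval, ← Complex.ofReal_pow, Real.sq_sqrt (hnn _)]
    simp only [e4, e5, det_smul, det_one, Fintype.card_fin, Complex.ofReal_zero, mul_zero,
      sub_zero, Finset.prod_const, Finset.card_univ, mul_one]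
    have e6 : ∀ i : Fin q, t - t⁻¹ * (sval Y i : ℂ) ^ 2 =
        t⁻¹ * ((t - sval Y i) * (t + sval Y i)) := by
      intro i; field_simp; ring
    simp only [e6]
    rw [Finset.prod_mul_distrib (f := fun _ => t⁻¹)]
    simp only [Finset.prod_const, Finset.card_univ, Fintype.card_fin]
    rw [inv_pow]
    field_simp
  apply eq_of_antitone_of_map_eq (eigVec_antitone _ H) (hatPQ_antitone hanti hs0)
  rw [eigVec_map_eq]
  have h1 := H.roots_charpoly_eq_eigenvalues
  rw [hchar, Polynomial.roots_prod _ _ (by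
    rw [Finset.prod_ne_zero_iff]; intro i _; exact Polynomial.X_sub_C_ne_zero _)] at h1
  simp only [Polynomial.roots_X_sub_C, Multiset.bind_singleton] at h1
  have h3 := congrArg (Multiset.map Complex.re) h1
  simpa [Multiset.map_map, Function.comp_def] using h3.symm

open scoped Topology

/-- Along an entire family of tuples of vectors, linear independence at one parameter implies
linear independence at all parameters close to, but different from, any given one. -/
lemma eventually_linearIndependent {ι κ : Type*} [Finite ι] [Finite κ]
    (w : ℂ → ι → κ → ℂ) (hw : ∀ i x, Differentiable ℂ fun t => w t i x) {t₁ : ℂ}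
    (h₁ : LinearIndependent ℂ (w t₁)) (t₀ : ℂ) :
    ∀ᶠ t in 𝓝[≠] t₀, LinearIndependent ℂ (w t) := by
  classical
  cases nonempty_fintype ι
  cases nonempty_fintype κ
  obtain ⟨L, hL⟩ := LinearMap.exists_leftInverse_of_injective
    (Fintype.linearCombination ℂ (w t₁)) (by
      rw [LinearMap.ker_eq_bot]
      exact h₁.fintypeLinearCombination_injective)
  have hL' : ∀ i, L (w t₁ i) = Pi.single i 1 := by
    intro i
    have := LinearMap.congr_fun hL (Pi.single i 1)
    simpa [Fintype.linearCombination_apply, Pi.single_apply, ite_smul] using this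
  let D : ℂ → ℂ := fun t => (Matrix.of fun i => L (w t i)).det
  have hLe : ∀ t i j, L (w t i) j = ∑ x, w t i x * L (Pi.single x 1) j := by
    intro t i j
    have hx : w t i = ∑ x, w t i x • (Pi.single x 1 : κ → ℂ) := by
      ext y; simp [Pi.single_apply]
    conv_lhs => rw [hx, map_sum, Finset.sum_apply]
    simp
  have hD : Differentiable ℂ D := by
    simp only [D, det_apply, of_apply, hLe]
    fun_prop
  have hD1 : D t₁ = 1 := by
    have : (Matrix.of fun i => L (w t₁ i)) = 1 := by
      ext i j
      rw [of_apply, hL', one_apply, Pi.single_apply]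
      simp [eq_comm]
    simp only [D, this, det_one]
  have hne : ∀ᶠ t in 𝓝[≠] t₀, D t ≠ 0 := by
    by_contra hcon
    rw [Filter.not_eventually] at hcon
    have := AnalyticOnNhd.eqOn_of_preconnected_of_frequently_eq (f := D) (g := fun _ => 0)
      (U := Set.univ) (z₀ := t₀) (fun z _ => hD.analyticAt z) (fun z _ => analyticAt_const)
      isPreconnected_univ (Set.mem_univ _) (hcon.mono fun t ht => not_not.mp ht)
    have h2 := this (Set.mem_univ t₁)
    rw [hD1] at h2
    exact one_ne_zero h2
  filter_upwards [hne] with t ht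
  refine LinearIndependent.of_comp L ?_
  have hu : IsUnit (Matrix.of fun i => L (w t i)) := by
    rw [isUnit_iff_isUnit_det]; exact isUnit_iff_ne_zero.mpr ht
  exact Matrix.linearIndependent_rows_iff_isUnit.mpr hu

lemma eventually_linearIndepOn {ι κ : Type*} [Finite ι] [Finite κ] {s : Set ι}
    (w : ℂ → ι → κ → ℂ) (hw : ∀ i x, Differentiable ℂ fun t => w t i x) {t₁ : ℂ}
    (h₁ : LinearIndepOn ℂ (w t₁) s) (t₀ : ℂ) :
    ∀ᶠ t in 𝓝[≠] t₀, LinearIndepOn ℂ (w t) s :=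
  eventually_linearIndependent (fun t (i : s) => w t i) (fun i x => hw i x) h₁ t₀

lemma linearIndepOn_iff_forall_sum {ι K V : Type*} [Fintype ι] [DivisionRing K] [AddCommGroup V]
    [Module K V] {v : ι → V} {s : Set ι} :
    LinearIndepOn K v s ↔
      ∀ x : ι → K, (∀ i ∉ s, x i = 0) → ∑ i, x i • v i = 0 → ∀ i, x i = 0 := by
  classical
  rw [linearIndepOn_iff'']
  constructor
  · intro h x hx hs i
    by_cases hi : i ∈ s
    · exact h (Finset.univ.filter (· ∈ s)) x (by intro j; simp) (by
        intro j hj; apply hx; simpa using hj) (by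
        rw [← hs]
        apply Finset.sum_subset (Finset.subset_univ _)
        intro j _ hj
        rw [hx j (by simpa using hj), zero_smul]) i (by simpa using hi)
    · exact hx i hi
  · intro h t g hts h0 hs i
    refine fun _ => h g (fun j hj => h0 j fun hj' => hj (hts hj')) ?_ i
    rw [← hs]
    symm
    apply Finset.sum_subset (Finset.subset_univ _)
    intro j _ hj
    rw [h0 j hj, zero_smul]

/-- A basis adapted to an increasing chain of subspaces. -/
lemma exists_adapted_set {V : Type*} [AddCommGroup V] [Module ℂ V] (E : ℕ → Submodule ℂ V)
    (hE : Monotone E) (l : ℕ) :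
    ∃ B : Set V, B ⊆ E l ∧ LinearIndepOn ℂ id B ∧
      ∀ i ≤ l, Submodule.span ℂ (B ∩ E i) = E i := by
  induction l with
  | zero =>
    obtain ⟨B, h1, -, h3, h4⟩ := exists_linearIndepOn_id_extension
      (linearIndepOn_empty ℂ (id : V → V)) (Set.empty_subset (E 0 : Set V))
    refine ⟨B, h1, h4, ?_⟩
    intro i hi
    obtain rfl : i = 0 := by omega
    rw [Set.inter_eq_left.mpr h1]
    exact le_antisymm (Submodule.span_le.mpr h1) h3
  | succ l ih =>
    obtain ⟨A, hA1, hA2, hA3⟩ := ih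
    obtain ⟨B, h1, h2, h3, h4⟩ := exists_linearIndepOn_id_extension hA2
      (hA1.trans (hE (Nat.le_succ l)))
    refine ⟨B, h1, h4, ?_⟩
    intro i hi
    apply le_antisymm (Submodule.span_le.mpr Set.inter_subset_right)
    rcases Nat.lt_or_ge i (l + 1) with hlt | hge
    · conv_lhs => rw [← hA3 i (by omega)]
      exact Submodule.span_mono (Set.inter_subset_inter_left _ h2)
    · obtain rfl : i = l + 1 := by omega
      rw [Set.inter_eq_left.mpr h1]
      exact h3

/-- A basis adapted to a decreasing chain of subspaces of `ℂ^k`. -/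
lemma exists_adapted_basis {k m : ℕ} (D : Fin m → Submodule ℂ (Fin k → ℂ)) (hD : Antitone D) :
    ∃ (b : Fin k → Fin k → ℂ) (c : Fin k → ℕ), LinearIndependent ℂ b ∧
      ∀ j : Fin m, D j = Submodule.span ℂ (b '' {a | (j : ℕ) < c a}) := by
  classical
  let E : ℕ → Submodule ℂ (Fin k → ℂ) := fun l =>
    if h : l < m then D ⟨m - 1 - l, by omega⟩ else ⊤
  have hE : Monotone E := by
    intro a b hab
    simp only [E]
    split_ifs with h1 h2
    · apply hD
      simp only [Fin.le_def]
      omega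
    · exact le_top
    · omega
    · exact le_rfl
  obtain ⟨B, -, hB2, hB3⟩ := exists_adapted_set E hE m
  have htop : Submodule.span ℂ B = ⊤ := by
    have := hB3 m le_rfl
    simpa [E] using this
  have hBD : ∀ j : Fin m, Submodule.span ℂ (B ∩ D j) = D j := by
    intro j
    have hj := j.isLt
    have := hB3 (m - 1 - j) (by omega)
    have hlt : m - 1 - (j : ℕ) < m := by omega
    have hjj : (⟨m - 1 - (m - 1 - (j : ℕ)), by omega⟩ : Fin m) = j := by
      ext; simp only; omega
    simpa [E, hlt, hjj] using this
  let bas : Module.Basis B ℂ (Fin k → ℂ) := Module.Basis.mk hB2 (by simp [htop])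
  have hfin : Finite B := Module.Finite.finite_basis bas
  cases nonempty_fintype B
  have hcard : Fintype.card B = k := by
    have := Module.finrank_eq_card_basis bas
    simpa using this.symm
  let e : Fin k ≃ B := (Fintype.equivFinOfCardEq hcard).symm
  refine ⟨fun a => (e a : Fin k → ℂ),
    fun a => (Finset.univ.filter fun j : Fin m => (e a : Fin k → ℂ) ∈ D j).card, ?_, ?_⟩
  · exact hB2.comp e e.injective
  · intro j
    have hlev : ∀ a : Fin k, (j : ℕ) < (Finset.univ.filter
        fun j : Fin m => (e a : Fin k → ℂ) ∈ D j).card ↔ (e a : Fin k → ℂ) ∈ D j := by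
      intro a
      constructor
      · intro h
        by_contra hcon
        have : (Finset.univ.filter fun j : Fin m => (e a : Fin k → ℂ) ∈ D j) ⊆ Finset.Iio j := by
          intro j' hj'
          simp only [Finset.mem_filter, Finset.mem_univ, true_and] at hj'
          rw [Finset.mem_Iio]
          by_contra hle
          exact hcon (hD (not_lt.mp hle) hj')
        have := Finset.card_le_card this
        rw [Fin.card_Iio] at this
        omega
      · intro h
        have : Finset.Iic j ⊆ (Finset.univ.filter fun j : Fin m => (e a : Fin k → ℂ) ∈ D j) := by
          intro j' hj'
          simp only [Finset.mem_filter, Finset.mem_univ, true_and]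
          exact hD (Finset.mem_Iic.mp hj') h
        have := Finset.card_le_card this
        rw [Fin.card_Iic] at this
        omega
    conv_lhs => rw [← hBD j]
    congr 1
    ext v
    simp only [Set.mem_inter_iff, SetLike.mem_coe, Set.mem_image, Set.mem_ofPred_eq, hlev]
    constructor
    · rintro ⟨h1, h2⟩
      exact ⟨e.symm ⟨v, h1⟩, by simpa using h2, by simp⟩
    · rintro ⟨a, h1, rfl⟩
      exact ⟨(e a).2, h1⟩

/-- The elementary tensor `v ⊗ q`, as a function of two indices. -/
def tmul (k m : ℕ) : (Fin k → ℂ) →ₗ[ℂ] (Fin m → ℂ) →ₗ[ℂ] (Fin k × Fin m → ℂ) :=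
  LinearMap.mk₂ ℂ (fun v q z => v z.1 * q z.2)
    (by intros; ext; simp [add_mul]) (by intros; ext; simp [mul_assoc])
    (by intros; ext; simp [mul_add]) (by intros; ext; simp [mul_left_comm])

@[simp] lemma tmul_apply {k m : ℕ} (v : Fin k → ℂ) (q : Fin m → ℂ) (z : Fin k × Fin m) :
    tmul k m v q z = v z.1 * q z.2 := rfl

/-- The tensors built from two families of triples of frames. -/
def frameTensor {k m : ℕ} (e : Fin 3 → Fin k → Fin k → ℂ) (ξ : Fin 3 → Fin m → Fin m → ℂ)
    (t : Fin 3 × Fin k × Fin m) : Fin k × Fin m → ℂ :=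
  tmul k m (e t.1 t.2.1) (ξ t.1 t.2.2)

/-- The union of the three diagrams with row lengths `c i`. -/
def diagram {k : ℕ} (m : ℕ) (c : Fin 3 → Fin k → ℕ) : Set (Fin 3 × Fin k × Fin m) :=
  {t | (t.2.2 : ℕ) < c t.1 t.2.1}

/-- The span of those vectors of the `i`-th frame whose level exceeds `j`. -/
def flagSpan {k : ℕ} (c : Fin 3 → Fin k → ℕ) (e : Fin 3 → Fin k → Fin k → ℂ) (i : Fin 3)
    (j : ℕ) : Submodule ℂ (Fin k → ℂ) :=
  Submodule.span ℂ (e i '' {a | j < c i a})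

/-- Semistability of a triple of weighted frames. -/
def SemiStable {k : ℕ} (m : ℕ) (c : Fin 3 → Fin k → ℕ) (e : Fin 3 → Fin k → Fin k → ℂ) : Prop :=
  ∀ N : Submodule ℂ (Fin k → ℂ),
    ∑ i, ∑ j : Fin m, Module.finrank ℂ ↥(N ⊓ flagSpan c e i j) ≤ m * Module.finrank ℂ N

lemma continuous_frameTensor {k m : ℕ} (t : Fin 3 × Fin k × Fin m) :
    Continuous fun p : (Fin 3 → Fin k → Fin k → ℂ) × (Fin 3 → Fin m → Fin m → ℂ) =>
      frameTensor p.1 p.2 t := by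
  unfold frameTensor
  refine continuous_pi fun z => ?_
  simp only [tmul_apply]
  fun_prop

lemma isOpen_linearIndepOn_frameTensor {k m : ℕ} (s : Set (Fin 3 × Fin k × Fin m)) :
    IsOpen {p : (Fin 3 → Fin k → Fin k → ℂ) × (Fin 3 → Fin m → Fin m → ℂ) |
      LinearIndepOn ℂ (frameTensor p.1 p.2) s} := by
  have h := isOpen_setOfPred_linearIndependent (𝕜 := ℂ) (E := Fin k × Fin m → ℂ) (ι := s)
  exact h.preimage (continuous_pi fun t : s => continuous_frameTensor (t : Fin 3 × Fin k × Fin m))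

lemma isOpen_forall_linearIndependent (k : ℕ) :
    IsOpen {e : Fin 3 → Fin k → Fin k → ℂ | ∀ i, LinearIndependent ℂ (e i)} := by
  have h := isOpen_setOfPred_linearIndependent (𝕜 := ℂ) (E := Fin k → ℂ) (ι := Fin k)
  have : {e : Fin 3 → Fin k → Fin k → ℂ | ∀ i, LinearIndependent ℂ (e i)} =
      ⋂ i, (fun e : Fin 3 → Fin k → Fin k → ℂ => e i) ⁻¹' {f | LinearIndependent ℂ f} := by
    ext; simp
  rw [this]
  exact isOpen_iInter_of_finite fun i => h.preimage (continuous_apply i)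

/-- Moving only the first frames along a line. -/
lemma eventually_frameTensor_left {k m : ℕ} {s : Set (Fin 3 × Fin k × Fin m)}
    (e₀ e₁ : Fin 3 → Fin k → Fin k → ℂ) {ξ : Fin 3 → Fin m → Fin m → ℂ}
    (h : LinearIndepOn ℂ (frameTensor e₁ ξ) s) :
    ∀ᶠ t in 𝓝[≠] (0 : ℂ), LinearIndepOn ℂ (frameTensor (e₀ + t • (e₁ - e₀)) ξ) s := by
  refine eventually_linearIndepOn (fun t => frameTensor (e₀ + t • (e₁ - e₀)) ξ) ?_ (t₁ := 1) ?_ 0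
  · intro i x
    simp only [frameTensor, tmul_apply, Pi.add_apply, Pi.smul_apply, smul_eq_mul]
    fun_prop
  · simpa using h

/-- Moving only the second frames along a line. -/
lemma eventually_frameTensor_right {k m : ℕ} {s : Set (Fin 3 × Fin k × Fin m)}
    {e : Fin 3 → Fin k → Fin k → ℂ} (ξ₀ ξ₁ : Fin 3 → Fin m → Fin m → ℂ)
    (h : LinearIndepOn ℂ (frameTensor e ξ₁) s) :
    ∀ᶠ t in 𝓝[≠] (0 : ℂ), LinearIndepOn ℂ (frameTensor e (ξ₀ + t • (ξ₁ - ξ₀))) s := by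
  refine eventually_linearIndepOn (fun t => frameTensor e (ξ₀ + t • (ξ₁ - ξ₀))) ?_ (t₁ := 1) ?_ 0
  · intro i x
    simp only [frameTensor, tmul_apply, Pi.add_apply, Pi.smul_apply, smul_eq_mul]
    fun_prop
  · simpa using h

lemma tendsto_line {E : Type*} [TopologicalSpace E] [AddCommGroup E] [Module ℂ E]
    [ContinuousAdd E] [ContinuousSMul ℂ E] (a b : E) :
    Filter.Tendsto (fun t : ℂ => a + t • b) (𝓝[≠] 0) (𝓝 a) := by
  have h : Continuous fun t : ℂ => a + t • b := by fun_prop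
  have := h.tendsto 0
  simp only [zero_smul, add_zero] at this
  exact this.mono_left nhdsWithin_le_nhds

/-- A linear relation among the tensors, perturbed in one second-factor vector. -/
lemma tmul_mem_span_of_relation {k m : ℕ} {s Δ : Set (Fin 3 × Fin k × Fin m)}
    (e : Fin 3 → Fin k → Fin k → ℂ)
    (hmax : ∀ ξ, LinearIndepOn ℂ (frameTensor e ξ) s → ∀ t ∈ Δ,
      frameTensor e ξ t ∈ Submodule.span ℂ (frameTensor e ξ '' s))
    (ξ : Fin 3 → Fin m → Fin m → ℂ) (hLI : LinearIndepOn ℂ (frameTensor e ξ) s)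
    (x : Fin 3 × Fin k × Fin m → ℂ) (hx : ∀ t ∉ Δ, x t = 0)
    (hsum : ∑ t, x t • frameTensor e ξ t = 0) (i : Fin 3) (j : Fin m) (η : Fin m → ℂ) :
    tmul k m (∑ a, x (i, a, j) • e i a) η ∈ Submodule.span ℂ (frameTensor e ξ '' s) := by
  by_contra hcon
  set y := ∑ a, x (i, a, j) • e i a with hy
  let ζ : ℂ → Fin 3 → Fin m → Fin m → ℂ := fun τ =>
    ξ + τ • fun i' j' => if i' = i ∧ j' = j then η else 0
  have hζ : Continuous ζ := by fun_prop
  have hrel : ∀ τ, ∑ t, x t • frameTensor e (ζ τ) t = τ • tmul k m y η := by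
    intro τ
    have h1 : ∀ t, frameTensor e (ζ τ) t = frameTensor e ξ t +
        if t.1 = i ∧ t.2.2 = j then τ • tmul k m (e i t.2.1) η else 0 := by
      rintro ⟨i', a, j'⟩
      simp only [frameTensor, ζ, Pi.add_apply, Pi.smul_apply, map_add, map_smul]
      split_ifs with h
      · obtain ⟨rfl, rfl⟩ := h; rfl
      · simp
    simp only [h1, smul_add, Finset.sum_add_distrib, hsum, zero_add]
    rw [Fintype.sum_prod_type, Finset.sum_eq_single i]
    · rw [Fintype.sum_prod_type, hy, map_sum, LinearMap.sum_apply, Finset.smul_sum]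
      refine Finset.sum_congr rfl fun a _ => ?_
      rw [Finset.sum_eq_single j]
      · simp [smul_comm τ]
      · intro j' _ hj'; simp [hj']
      · simp
    · intro i' _ hi'; simp [hi']
    · simp
  have hopt : LinearIndependent ℂ (fun o : Option s =>
      o.elim (tmul k m y η) fun t => frameTensor e (ζ 0) t) := by
    rw [linearIndependent_option]
    have h0 : ζ 0 = ξ := by simp [ζ]
    rw [h0]
    refine ⟨hLI, ?_⟩
    simpa [Set.image_eq_range, Function.comp_def] using hcon
  have hopen := isOpen_setOfPred_linearIndependent (𝕜 := ℂ) (E := Fin k × Fin m → ℂ)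
    (ι := Option s)
  have hcont : Continuous fun τ : ℂ => (fun o : Option s =>
      o.elim (tmul k m y η) fun t => frameTensor e (ζ τ) t) := by
    refine continuous_pi fun o => ?_
    cases o with
    | none => exact continuous_const
    | some t =>
      exact (continuous_frameTensor (t : Fin 3 × Fin k × Fin m)).comp
        (Continuous.prodMk continuous_const hζ)
  have hev := (hopen.preimage hcont).mem_nhds (show (0 : ℂ) ∈ _ from hopt)
  have hev' : ∀ᶠ τ in 𝓝[≠] (0 : ℂ), LinearIndependent ℂ (fun o : Option s =>
      o.elim (tmul k m y η) fun t => frameTensor e (ζ τ) t) := nhdsWithin_le_nhds hev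
  obtain ⟨τ, hτ, hτ0⟩ := (hev'.and self_mem_nhdsWithin).exists
  rw [linearIndependent_option] at hτ
  obtain ⟨hτ1, hτ2⟩ := hτ
  apply hτ2
  have hmem : τ • tmul k m y η ∈ Submodule.span ℂ (frameTensor e (ζ τ) '' s) := by
    rw [← hrel]
    refine Submodule.sum_mem _ fun t _ => ?_
    by_cases ht : t ∈ Δ
    · exact Submodule.smul_mem _ _ (hmax (ζ τ) hτ1 t ht)
    · rw [hx t ht, zero_smul]; exact Submodule.zero_mem _
  have := Submodule.smul_mem _ τ⁻¹ hmem
  rw [smul_smul, inv_mul_cancel₀ hτ0, one_smul] at this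
  simpa [Set.image_eq_range, Function.comp_def] using this

/-- Deforming frames of a subspace lifts to the ambient space. -/
lemma exists_frame_lift {k k' : ℕ} {m : ℕ} (ν : (Fin k' → ℂ) →ₗ[ℂ] (Fin k → ℂ))
    (hν : Function.Injective ν) (c : Fin 3 → Fin k → ℕ) (c' : Fin 3 → Fin k' → ℕ)
    (e : Fin 3 → Fin k → Fin k → ℂ) (u : Fin 3 → Fin k' → Fin k' → ℂ)
    (hu : ∀ i, LinearIndependent ℂ (u i))
    (hc : ∀ i (j : Fin m), (flagSpan c e i j).comap ν = flagSpan c' u i j) :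
    ∃ lift : (Fin 3 → Fin k' → Fin k' → ℂ) → (Fin 3 → Fin k → Fin k → ℂ),
      Continuous lift ∧ lift u = e ∧
      (∀ u' i a, lift u' i a - e i a ∈ LinearMap.range ν) ∧
      ∀ u' i (j : Fin m), (flagSpan c (lift u') i j).comap ν = flagSpan c' u' i j := by
  obtain ⟨π, hπ⟩ := LinearMap.exists_leftInverse_of_injective ν (LinearMap.ker_eq_bot.mpr hν)
  let B : ∀ i, Module.Basis (Fin k') ℂ (Fin k' → ℂ) := fun i =>
    basisOfLinearIndependentOfCardEqFinrank' (u i) (hu i) (by simp)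
  have hB : ∀ i b, B i b = u i b := by intro i b; simp [B]
  let T : (Fin 3 → Fin k' → Fin k' → ℂ) → Fin 3 → (Fin k' → ℂ) →ₗ[ℂ] (Fin k' → ℂ) :=
    fun u' i => (Fintype.linearCombination ℂ fun b => u' i b - u i b) ∘ₗ
      (B i).equivFun.toLinearMap
  have hT : ∀ u' i b, T u' i (u i b) = u' i b - u i b := by
    intro u' i b
    simp only [T, LinearMap.comp_apply, LinearEquiv.coe_coe]
    have h1 : (B i).equivFun (u i b) = Pi.single b 1 := by
      rw [← hB]; ext; simp [Pi.single_apply, eq_comm]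
    rw [h1]
    simp [Fintype.linearCombination_apply]
  let P : (Fin 3 → Fin k' → Fin k' → ℂ) → Fin 3 → (Fin k → ℂ) →ₗ[ℂ] (Fin k → ℂ) :=
    fun u' i => LinearMap.id + ν ∘ₗ T u' i ∘ₗ π
  have hP : ∀ u' i v, P u' i v = v + ν (T u' i (π v)) := by intros; rfl
  have hPν : ∀ u' i z, P u' i (ν z) = ν (z + T u' i z) := by
    intro u' i z
    have : π (ν z) = z := LinearMap.congr_fun hπ z
    rw [hP, this, map_add]
  have hspan : ∀ u' i j, flagSpan c (fun i a => P u' i (e i a)) i j =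
      (flagSpan c e i j).map (P u' i) := by
    intro u' i j
    unfold flagSpan
    rw [Submodule.map_span, Set.image_image]
  have hspan' : ∀ u' i j, flagSpan c' u' i j =
      (flagSpan c' u i j).map (LinearMap.id + T u' i) := by
    intro u' i j
    unfold flagSpan
    rw [Submodule.map_span, Set.image_image]
    congr 1
    refine Set.image_congr' fun b => ?_
    simp [hT]
  refine ⟨fun u' i a => P u' i (e i a), ?_, ?_, ?_, ?_⟩
  · refine continuous_pi fun i => continuous_pi fun a => ?_
    simp only [hP]
    refine continuous_const.add (ν.continuous_of_finiteDimensional.comp ?_)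
    simp only [T, LinearMap.comp_apply, Fintype.linearCombination_apply]
    fun_prop
  · funext i a
    change P u i (e i a) = e i a
    rw [hP]
    have : T u i = 0 := by
      ext z; simp [T, Fintype.linearCombination_apply]
    simp [this]
  · intro u' i a
    change P u' i (e i a) - e i a ∈ _
    rw [hP, add_sub_cancel_left]
    exact LinearMap.mem_range_self _ _
  · intro u' i j
    rw [hspan, hspan']
    ext w
    rw [Submodule.mem_comap, Submodule.mem_map, Submodule.mem_map]
    constructor
    · rintro ⟨v, hv, hvw⟩
      have : v = ν (w - T u' i (π v)) := by
        rw [map_sub, ← hvw, hP]; simp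
      refine ⟨w - T u' i (π v), ?_, ?_⟩
      · rw [← hc, Submodule.mem_comap, ← this]; exact hv
      · apply hν
        rw [LinearMap.add_apply, LinearMap.id_apply, ← hPν, ← this, hvw]
    · rintro ⟨z, hz, rfl⟩
      rw [← hc, Submodule.mem_comap] at hz
      exact ⟨ν z, hz, by rw [hPν]; rfl⟩

lemma SemiStable.of_comap {k k' m : ℕ} {ν : (Fin k' → ℂ) →ₗ[ℂ] (Fin k → ℂ)}
    (hν : Function.Injective ν) {c : Fin 3 → Fin k → ℕ} {c' : Fin 3 → Fin k' → ℕ}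
    {e : Fin 3 → Fin k → Fin k → ℂ} {u : Fin 3 → Fin k' → Fin k' → ℂ}
    (hc : ∀ i (j : Fin m), (flagSpan c e i j).comap ν = flagSpan c' u i j)
    (h : SemiStable m c e) : SemiStable m c' u := by
  have hfr : ∀ A : Submodule ℂ (Fin k' → ℂ), Module.finrank ℂ (A.map ν) = Module.finrank ℂ A :=
    fun A => (Submodule.equivMapOfInjective ν hν A).finrank_eq.symm
  intro N
  have := h (N.map ν)
  rw [hfr] at this
  refine le_trans (Finset.sum_le_sum fun i _ => Finset.sum_le_sum fun j _ => ?_) this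
  rw [← hc, ← hfr]
  apply Submodule.finrank_mono
  rintro _ ⟨z, ⟨hz1, hz2⟩, rfl⟩
  exact ⟨Submodule.mem_map_of_mem hz1, hz2⟩

lemma exists_generic_frames (m : ℕ) {O : Set (Fin 3 → Fin m → Fin m → ℂ)} (hO : IsOpen O)
    (hne : O.Nonempty) :
    ∃ ξ ∈ O, ∀ (k : ℕ) (c : Fin 3 → Fin k → ℕ),
      (∃ e ξ', LinearIndepOn ℂ (frameTensor e ξ') (diagram m c)) →
        ∃ e, LinearIndepOn ℂ (frameTensor e ξ) (diagram m c) := by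
  let J := Σ k : ℕ, Fin 3 → Fin k → ℕ
  let G : J → Set (Fin 3 → Fin m → Fin m → ℂ) := fun x =>
    {ξ | (∃ e ξ', LinearIndepOn ℂ (frameTensor e ξ') (diagram m x.2)) →
        ∃ e, LinearIndepOn ℂ (frameTensor e ξ) (diagram m x.2)}
  have hG : ∀ x, IsOpen (G x) ∧ Dense (G x) := by
    intro x
    by_cases hx : ∃ e ξ', LinearIndepOn ℂ (frameTensor e ξ') (diagram m x.2)
    · have hGx : G x = ⋃ e, {ξ | LinearIndepOn ℂ (frameTensor e ξ) (diagram m x.2)} := by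
        ext ξ
        simp only [G, Set.mem_ofPred_eq, Set.mem_iUnion]
        exact ⟨fun h => h hx, fun h _ => h⟩
      rw [hGx]
      refine ⟨isOpen_iUnion fun e => ?_, ?_⟩
      · exact (isOpen_linearIndepOn_frameTensor (diagram m x.2)).preimage
          (Continuous.prodMk_right e)
      · intro ξ₀
        obtain ⟨e, ξ', h⟩ := hx
        rw [mem_closure_iff_frequently]
        have h1 := (eventually_frameTensor_right ξ₀ ξ' h).frequently
        refine (tendsto_line ξ₀ (ξ' - ξ₀)).frequently (h1.mono fun t ht => ?_)
        exact Set.mem_iUnion.mpr ⟨e, ht⟩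
    · have hGx : G x = Set.univ := by
        ext ξ
        simp only [G, Set.mem_ofPred_eq, Set.mem_univ, iff_true]
        exact fun h => absurd h hx
      rw [hGx]
      exact ⟨isOpen_univ, dense_univ⟩
  have hd := dense_iInter_of_isOpen (fun x => (hG x).1) (fun x => (hG x).2)
  obtain ⟨ξ, hξO, hξ⟩ := hd.inter_open_nonempty O hO hne
  exact ⟨ξ, hξO, fun k c => Set.mem_iInter.mp hξ ⟨k, c⟩⟩

lemma SemiStable.card_diagram_le {k m : ℕ} {c : Fin 3 → Fin k → ℕ}
    {e : Fin 3 → Fin k → Fin k → ℂ} (he : ∀ i, LinearIndependent ℂ (e i))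
    (h : SemiStable m c e) : (diagram m c).ncard ≤ k * m := by
  classical
  have h1 := h ⊤
  rw [finrank_top, Module.finrank_fintype_fun_eq_card, Fintype.card_fin] at h1
  have h2 : ∀ i (j : Fin m), Module.finrank ℂ (flagSpan c e i j) =
      (Finset.univ.filter fun a : Fin k => (j : ℕ) < c i a).card := by
    intro i j
    unfold flagSpan
    have := finrank_span_eq_card (R := ℂ) (b := fun a : {a : Fin k // (j : ℕ) < c i a} => e i a)
      ((he i).comp _ Subtype.val_injective)
    rw [Fintype.card_subtype] at this
    rw [← this, Set.image_eq_range]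
    rfl
  have h4 : ∀ i (j : Fin m), Module.finrank ℂ ↥(⊤ ⊓ flagSpan c e i j) =
      (Finset.univ.filter fun a : Fin k => (j : ℕ) < c i a).card := by
    intro i j
    rw [top_inf_eq, h2]
  simp only [h4] at h1
  rw [mul_comm k m]
  refine le_trans (le_of_eq ?_) h1
  rw [Set.ncard_eq_toFinset_card']
  have h3 : (diagram m c).toFinset = Finset.univ.filter
      (fun t : Fin 3 × Fin k × Fin m => (t.2.2 : ℕ) < c t.1 t.2.1) := by
    ext t
    rw [Set.mem_toFinset, Finset.mem_filter]
    exact ⟨fun h => ⟨Finset.mem_univ _, h⟩, fun h => h.2⟩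
  rw [h3, Finset.card_filter, Fintype.sum_prod_type]
  refine Finset.sum_congr rfl fun i _ => ?_
  rw [Fintype.sum_prod_type, Finset.sum_comm]
  refine Finset.sum_congr rfl fun j _ => ?_
  rw [Finset.card_filter]

/-- Coefficients of a vector in a flag span. -/
lemma exists_coeff_of_mem_flagSpan {k : ℕ} {c : Fin 3 → Fin k → ℕ}
    {e : Fin 3 → Fin k → Fin k → ℂ} {i : Fin 3} {j : ℕ} {v : Fin k → ℂ}
    (hv : v ∈ flagSpan c e i j) :
    ∃ z : Fin k → ℂ, (∀ a, ¬ j < c i a → z a = 0) ∧ v = ∑ a, z a • e i a := by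
  induction hv using Submodule.span_induction with
  | mem x hx =>
    obtain ⟨a, ha, rfl⟩ := hx
    refine ⟨Pi.single a 1, ?_, ?_⟩
    · intro b hb
      rw [Pi.single_apply, if_neg]
      rintro rfl; exact hb ha
    · simp [Pi.single_apply, ite_smul]
  | zero => exact ⟨0, by simp, by simp⟩
  | add x y _ _ hx hy =>
    obtain ⟨z, hz, rfl⟩ := hx
    obtain ⟨w, hw, rfl⟩ := hy
    exact ⟨z + w, fun a ha => by simp [hz a ha, hw a ha], by
      simp [add_smul, Finset.sum_add_distrib]⟩
  | smul r x _ hx =>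
    obtain ⟨z, hz, rfl⟩ := hx
    exact ⟨r • z, fun a ha => by simp [hz a ha], by simp [Finset.smul_sum, mul_smul]⟩

lemma mem_flagSpan_of_coeff {k m : ℕ} {c : Fin 3 → Fin k → ℕ}
    {e : Fin 3 → Fin k → Fin k → ℂ} (x : Fin 3 × Fin k × Fin m → ℂ)
    (hx : ∀ t ∉ diagram m c, x t = 0) (i : Fin 3) (j : Fin m) :
    ∑ a, x (i, a, j) • e i a ∈ flagSpan c e i j := by
  refine Submodule.sum_mem _ fun a _ => ?_
  by_cases h : (j : ℕ) < c i a
  · exact Submodule.smul_mem _ _ (Submodule.subset_span ⟨a, h, rfl⟩)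
  · rw [hx (i, a, j) h, zero_smul]; exact Submodule.zero_mem _

lemma sum_smul_frameTensor {k m : ℕ} (e : Fin 3 → Fin k → Fin k → ℂ)
    (ξ : Fin 3 → Fin m → Fin m → ℂ) (x : Fin 3 × Fin k × Fin m → ℂ) :
    ∑ t, x t • frameTensor e ξ t =
      ∑ i, ∑ j, tmul k m (∑ a, x (i, a, j) • e i a) (ξ i j) := by
  rw [Fintype.sum_prod_type]
  refine Finset.sum_congr rfl fun i _ => ?_
  rw [Fintype.sum_prod_type, Finset.sum_comm]
  refine Finset.sum_congr rfl fun j _ => ?_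
  simp [frameTensor, map_sum, LinearMap.sum_apply]

/-- Injectivity of `ν ⊗ id`. -/
lemma sum_tmul_eq_zero_of_map {k k' m : ℕ} {ν : (Fin k' → ℂ) →ₗ[ℂ] (Fin k → ℂ)}
    (hν : Function.Injective ν) {ι : Type*} [Fintype ι] (y : ι → Fin k' → ℂ) (q : ι → Fin m → ℂ)
    (h : ∑ i, tmul k m (ν (y i)) (q i) = 0) : ∑ i, tmul k' m (y i) (q i) = 0 := by
  have hcol : ∀ b, ∑ i, q i b • y i = 0 := by
    intro b
    apply hν
    rw [map_sum, map_zero]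
    ext a
    have := congrFun h (a, b)
    simpa [mul_comm] using this
  ext ⟨a, b⟩
  have := congrFun (hcol b) a
  simpa [mul_comm] using this

theorem exists_linearIndepOn_of_semiStable (m : ℕ) (k : ℕ) : ∀ (c : Fin 3 → Fin k → ℕ)
    (e₀ : Fin 3 → Fin k → Fin k → ℂ), (∀ i, LinearIndependent ℂ (e₀ i)) →
    (∀ᶠ e in 𝓝 e₀, SemiStable m c e) →
    ∃ e ξ, LinearIndepOn ℂ (frameTensor e ξ) (diagram m c) := by
  induction k using Nat.strong_induction_on with
  | _ k IH =>
  intro c e₀ he₀ hss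
  by_contra hno
  push Not at hno
  set Δ := diagram m c with hΔ
  let O : Set (Fin 3 → Fin k → Fin k → ℂ) :=
    {e | ∀ i, LinearIndependent ℂ (e i)} ∩ interior {e | SemiStable m c e}
  have hO : IsOpen O := (isOpen_forall_linearIndependent k).inter isOpen_interior
  have he₀O : e₀ ∈ O := ⟨he₀, mem_interior_iff_mem_nhds.mpr hss⟩
  obtain ⟨s, hs⟩ := (Set.toFinite {s : Set (Fin 3 × Fin k × Fin m) | s ⊆ Δ ∧
    ∃ e ξ, LinearIndepOn ℂ (frameTensor e ξ) s}).exists_maximal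
      ⟨∅, Set.empty_subset _, 0, 0, linearIndepOn_empty _ _⟩
  obtain ⟨⟨hsΔ, e₁, ξ₁, hs₁⟩, hsmax⟩ := hs
  have hmax : ∀ e ξ, LinearIndepOn ℂ (frameTensor e ξ) s → ∀ t ∈ Δ,
      frameTensor e ξ t ∈ Submodule.span ℂ (frameTensor e ξ '' s) := by
    intro e ξ hLI t ht
    by_contra hcon
    have h1 := hsmax (y := insert t s) ⟨Set.insert_subset ht hsΔ, e, ξ, hLI.insert hcon⟩
      (Set.subset_insert _ _)
    exact hcon (Submodule.subset_span (Set.mem_image_of_mem _ (h1 (Set.mem_insert t s))))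
  have hsne : s ≠ Δ := fun h => hno e₁ ξ₁ (h ▸ hs₁)
  -- choose a point where the tensors indexed by `s` are independent
  obtain ⟨e', he'O, he's⟩ : ∃ e' ∈ O, LinearIndepOn ℂ (frameTensor e' ξ₁) s := by
    have h1 := eventually_frameTensor_left e₀ e₁ hs₁
    have h2 := (tendsto_line e₀ (e₁ - e₀)).eventually (hO.mem_nhds he₀O)
    obtain ⟨t, ht1, ht2⟩ := (h1.and h2).exists
    exact ⟨_, ht2, ht1⟩
  obtain ⟨ξ, hξs, hξgen⟩ := exists_generic_frames m
    ((isOpen_linearIndepOn_frameTensor s).preimage (Continuous.prodMk_right e')) ⟨ξ₁, he's⟩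
  replace hξs : LinearIndepOn ℂ (frameTensor e' ξ) s := hξs
  -- a functional vanishing on all tensors
  have hcard : s.ncard < k * m :=
    (Set.ncard_lt_ncard (hsΔ.ssubset_of_ne hsne)).trans_le
      (SemiStable.card_diagram_le he'O.1 (interior_subset he'O.2))
  have hspan : Submodule.span ℂ (frameTensor e' ξ '' s) ≠ ⊤ := by
    intro htop
    have h1 := congrArg (fun W : Submodule ℂ (Fin k × Fin m → ℂ) => Module.finrank ℂ W) htop
    simp only [finrank_top, Module.finrank_fintype_fun_eq_card, Fintype.card_prod,
      Fintype.card_fin] at h1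
    classical
    have : Fintype ↥(frameTensor e' ξ '' s) := Fintype.ofFinite _
    have h2 := finrank_span_le_card (R := ℂ) (frameTensor e' ξ '' s)
    rw [h1, ← Set.ncard_eq_toFinset_card'] at h2
    exact absurd (h2.trans (Set.ncard_image_le (Set.toFinite s))) (not_le.mpr hcard)
  obtain ⟨φ, hφ0, hφ⟩ := Submodule.exists_le_ker_of_lt_top _ (lt_top_iff_ne_top.mpr hspan)
  have hφΔ : ∀ t ∈ Δ, φ (frameTensor e' ξ t) = 0 := fun t ht => hφ (hmax e' ξ hξs t ht)
  let N : Submodule ℂ (Fin k → ℂ) := LinearMap.ker ((tmul k m).compr₂ φ)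
  have hN : ∀ v, v ∈ N ↔ ∀ q, φ (tmul k m v q) = 0 := by
    intro v
    simp only [N, LinearMap.mem_ker]
    exact ⟨fun h q => LinearMap.congr_fun h q, fun h => LinearMap.ext h⟩
  have hNtop : N ≠ ⊤ := by
    intro htop
    apply hφ0
    refine LinearMap.pi_ext' fun x => LinearMap.ext_ring ?_
    have h1 : (Pi.single x.1 1 : Fin k → ℂ) ∈ N := htop ▸ Submodule.mem_top
    have h2 := (hN _).mp h1 (Pi.single x.2 1)
    have h3 : tmul k m (Pi.single x.1 1) (Pi.single x.2 1) = Pi.single x 1 := by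
      ext z
      obtain ⟨z1, z2⟩ := z
      obtain ⟨x1, x2⟩ := x
      simp only [tmul_apply, Pi.single_apply, Prod.mk.injEq]
      split_ifs <;> simp_all
    rw [h3] at h2
    simpa using h2
  set k' := Module.finrank ℂ N with hk'
  have hk'k : k' < k := by
    have := Submodule.finrank_lt (lt_top_iff_ne_top.mpr hNtop).ne
    simpa using this
  let ν₀ : N ≃ₗ[ℂ] (Fin k' → ℂ) := LinearEquiv.ofFinrankEq _ _ (by simp [hk'])
  let ν : (Fin k' → ℂ) →ₗ[ℂ] (Fin k → ℂ) := N.subtype ∘ₗ ν₀.symm.toLinearMap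
  have hν : Function.Injective ν := N.injective_subtype.comp ν₀.symm.injective
  have hνN : LinearMap.range ν = N := by
    simp only [ν]
    rw [LinearMap.range_comp, LinearEquiv.range, Submodule.map_top, Submodule.range_subtype]
  have hadapt := fun i : Fin 3 => exists_adapted_basis
    (fun j : Fin m => (flagSpan c e' i j).comap ν) (by
      intro j j' hjj'
      refine Submodule.comap_mono (Submodule.span_mono (Set.image_mono fun a ha => ?_))
      exact lt_of_le_of_lt (show (j : ℕ) ≤ j' from hjj') ha)
  choose u c' hu hc using hadapt
  obtain ⟨lift, hlcont, hlu, hlν, hlc⟩ := exists_frame_lift (m := m) ν hν c c' e' u hu hc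
  have hopen : ∀ᶠ u' in 𝓝 u, lift u' ∈ O ∧ LinearIndepOn ℂ (frameTensor (lift u') ξ) s := by
    have h1 : IsOpen (O ∩ {e | LinearIndepOn ℂ (frameTensor e ξ) s}) :=
      hO.inter ((isOpen_linearIndepOn_frameTensor s).preimage (Continuous.prodMk_left ξ))
    exact (h1.preimage hlcont).mem_nhds (by
      rw [Set.mem_preimage, hlu]; exact ⟨he'O, hξs⟩)
  have hss' : ∀ᶠ u' in 𝓝 u, SemiStable m c' u' := by
    filter_upwards [hopen] with u' hu'
    exact SemiStable.of_comap hν (hlc u') (interior_subset hu'.1.2 : _)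
  obtain ⟨u₂, hu₂⟩ := hξgen k' c' (IH k' hk'k c' u hu hss')
  obtain ⟨u', hu'LI, ⟨hu'O, hu's⟩⟩ : ∃ u', LinearIndepOn ℂ (frameTensor u' ξ) (diagram m c') ∧
      lift u' ∈ O ∧ LinearIndepOn ℂ (frameTensor (lift u') ξ) s := by
    have h1 := eventually_frameTensor_left u u₂ hu₂
    have h2 := (tendsto_line u (u₂ - u)).eventually hopen
    obtain ⟨t, ht1, ht2⟩ := (h1.and h2).exists
    exact ⟨_, ht1, ht2⟩
  set f := lift u' with hf
  have hφf : ∀ t ∈ Δ, φ (frameTensor f ξ t) = 0 := by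
    intro t ht
    have h1 : frameTensor f ξ t = frameTensor e' ξ t +
        tmul k m (f t.1 t.2.1 - e' t.1 t.2.1) (ξ t.1 t.2.2) := by
      simp [frameTensor]
    have h2 : f t.1 t.2.1 - e' t.1 t.2.1 ∈ N := hνN ▸ hlν u' t.1 t.2.1
    rw [h1, map_add, hφΔ t ht, (hN _).mp h2, add_zero]
  have hφs : Submodule.span ℂ (frameTensor f ξ '' s) ≤ LinearMap.ker φ := by
    rw [Submodule.span_le]
    rintro _ ⟨t, ht, rfl⟩
    exact hφf t (hsΔ ht)
  -- all tensors are independent at the deformed frames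
  apply hno f ξ
  rw [linearIndepOn_iff_forall_sum]
  intro x hx hsum
  have hyN : ∀ i j, ∑ a, x (i, a, j) • f i a ∈ N := by
    intro i j
    rw [hN]
    intro q
    exact hφs (tmul_mem_span_of_relation f (hmax f) ξ hu's x hx hsum i j q)
  have hz : ∀ i (j : Fin m), ∃ z : Fin k' → ℂ, (∀ b, ¬ (j : ℕ) < c' i b → z b = 0) ∧
      ∑ a, x (i, a, j) • f i a = ν (∑ b, z b • u' i b) := by
    intro i j
    have h1 := hyN i j
    rw [← hνN] at h1
    obtain ⟨w, hw⟩ := h1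
    have h2 : w ∈ (flagSpan c f i j).comap ν := by
      rw [Submodule.mem_comap, hw]
      exact mem_flagSpan_of_coeff x hx i j
    rw [hlc] at h2
    obtain ⟨z, hz1, hz2⟩ := exists_coeff_of_mem_flagSpan h2
    exact ⟨z, hz1, by rw [← hw, hz2]⟩
  choose z hz1 hz2 using hz
  rw [sum_smul_frameTensor] at hsum
  simp only [hz2] at hsum
  rw [← Fintype.sum_prod_type' (f := fun i j =>
    tmul k m (ν (∑ b, z i j b • u' i b)) (ξ i j))] at hsum
  have hsum' := sum_tmul_eq_zero_of_map hν _ _ hsum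
  rw [Fintype.sum_prod_type' (f := fun i j =>
    tmul k' m (∑ b, z i j b • u' i b) (ξ i j))] at hsum'
  have hz0 := linearIndepOn_iff_forall_sum.mp hu'LI (fun t => z t.1 t.2.2 t.2.1)
    (fun t ht => hz1 _ _ _ ht) (by rw [sum_smul_frameTensor]; exact hsum')
  rintro ⟨i, a, j⟩
  have h0 : ∑ a, x (i, a, j) • f i a = 0 := by
    rw [hz2]
    have : ∀ b, z i j b = 0 := fun b => hz0 (i, b, j)
    simp [this]
  exact Fintype.linearIndependent_iff.mp (hu'O.1 i) (fun a => x (i, a, j)) h0 a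

/-- Coordinates in a perturbed orthonormal frame are close to orthonormal coordinates. -/
lemma eventually_frame_coordinates {k : ℕ} {E : Matrix (Fin k) (Fin k) ℂ} (hE : Eᴴ * E = 1)
    {δ : ℝ} (hδ : 0 < δ) :
    ∀ᶠ f in 𝓝 (fun a x => E x a : Fin k → Fin k → ℂ), ∀ z : Fin k → ℂ,
      ∑ a, ‖(Eᴴ *ᵥ ∑ b, z b • f b) a - z a‖ ^ 2 ≤ δ * ∑ a, ‖(Eᴴ *ᵥ ∑ b, z b • f b) a‖ ^ 2 := by
  let G : (Fin k → Fin k → ℂ) → Matrix (Fin k) (Fin k) ℂ := fun f => Eᴴ * (Matrix.of f)ᵀ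
  have hGc : Continuous G := by
    refine continuous_const.matrix_mul (Continuous.matrix_transpose ?_)
    exact continuous_id
  have hG0 : G (fun a x => E x a) = 1 := by
    simp only [G]; rw [← hE]; rfl
  have hdet : ∀ᶠ f in 𝓝 (fun a x => E x a : Fin k → Fin k → ℂ), (G f).det ≠ 0 := by
    refine (hGc.matrix_det.continuousAt).eventually_ne ?_
    rw [hG0]; simp
  have hH : ∀ᶠ f in 𝓝 (fun a x => E x a : Fin k → Fin k → ℂ),
      ∑ a, ∑ b, ‖(1 - (G f)⁻¹) a b‖ ^ 2 < δ := by
    have hc : ContinuousAt (fun f => (G f)⁻¹) (fun a x => E x a) := by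
      have : (fun f => (G f)⁻¹) = fun f => ((G f).det)⁻¹ • (G f).adjugate := by
        funext f; rw [Matrix.inv_def, Ring.inverse_eq_inv']
      rw [this]
      refine ContinuousAt.smul (ContinuousAt.inv₀ hGc.matrix_det.continuousAt ?_)
        hGc.matrix_adjugate.continuousAt
      rw [hG0]; simp
    have hc2 : ContinuousAt (fun f => ∑ a, ∑ b, ‖(1 - (G f)⁻¹) a b‖ ^ 2) (fun a x => E x a) := by
      refine tendsto_finsetSum _ fun a _ => tendsto_finsetSum _ fun b _ => ?_
      have h1 : ContinuousAt (fun f => (1 - (G f)⁻¹) a b) (fun a x => E x a) := by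
        have : Continuous fun A : Matrix (Fin k) (Fin k) ℂ => (1 - A) a b :=
          (continuous_const.sub continuous_id).matrix_elem a b
        exact this.continuousAt.comp hc
      exact (h1.norm.pow 2)
    refine hc2.eventually_lt continuousAt_const ?_
    simp [hG0, hδ]
  filter_upwards [hdet, hH] with f hf1 hf2 z
  have hy : Eᴴ *ᵥ ∑ b, z b • f b = G f *ᵥ z := by
    simp only [G, ← Matrix.mulVec_mulVec]
    congr 1
    ext x
    simp [Matrix.mulVec, dotProduct, Finset.sum_apply, mul_comm]
  have hz : z = (G f)⁻¹ *ᵥ (G f *ᵥ z) := by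
    rw [Matrix.mulVec_mulVec, Matrix.nonsing_inv_mul _ (isUnit_iff_ne_zero.mpr hf1),
      Matrix.one_mulVec]
  rw [hy]
  set y := G f *ᵥ z with hydef
  have hyz : ∀ a, y a - z a = ∑ b, (1 - (G f)⁻¹) a b * y b := by
    intro a
    have : y - z = (1 - (G f)⁻¹) *ᵥ y := by
      rw [Matrix.sub_mulVec, Matrix.one_mulVec, ← hz]
    exact congrFun this a
  calc ∑ a, ‖y a - z a‖ ^ 2
      ≤ ∑ a, (∑ b, ‖(1 - (G f)⁻¹) a b‖ ^ 2) * ∑ b, ‖y b‖ ^ 2 := by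
        refine Finset.sum_le_sum fun a _ => ?_
        rw [hyz a]
        refine le_trans ?_ (Finset.sum_mul_sq_le_sq_mul_sq _ _ _)
        gcongr
        refine (norm_sum_le _ _).trans (le_of_eq ?_)
        simp only [norm_mul]
    _ = (∑ a, ∑ b, ‖(1 - (G f)⁻¹) a b‖ ^ 2) * ∑ b, ‖y b‖ ^ 2 := by rw [Finset.sum_mul]
    _ ≤ δ * ∑ b, ‖y b‖ ^ 2 := by gcongr

/-- Bessel's inequality inside a subspace, in terms of an orthonormal basis of it. -/
lemma sum_sq_inner_le_of_mem {k : ℕ} {ι κ : Type*} [Fintype ι] [Fintype κ]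
    {N : Submodule ℂ (EuclideanSpace ℂ (Fin k))} (b : OrthonormalBasis κ ℂ N)
    {w : ι → EuclideanSpace ℂ (Fin k)} (hw : Orthonormal ℂ w) (hwN : ∀ l, w l ∈ N)
    (x : EuclideanSpace ℂ (Fin k)) :
    ∑ l, ‖inner ℂ (w l) x‖ ^ 2 ≤ ∑ l, ‖inner ℂ (b l : EuclideanSpace ℂ (Fin k)) x‖ ^ 2 := by
  have h1 : ∀ u : N, inner ℂ (u : EuclideanSpace ℂ (Fin k)) x
      = inner ℂ u (N.orthogonalProjectionOnto x) := fun u =>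
    (Submodule.inner_orthogonalProjectionOnto_eq_of_mem_left u x).symm
  have h2 : Orthonormal ℂ (fun l => (⟨w l, hwN l⟩ : N)) := by
    rw [← N.subtypeₗᵢ.orthonormal_comp_iff]
    exact hw
  simp only [h1]
  rw [OrthonormalBasis.sum_sq_norm_inner_right]
  refine le_trans (le_of_eq ?_) (h2.sum_inner_products_le (N.orthogonalProjectionOnto x)
    (s := Finset.univ))
  exact Finset.sum_congr rfl fun l _ => by rw [← h1 ⟨w l, hwN l⟩]

lemma inner_column {k : ℕ} (E : Matrix (Fin k) (Fin k) ℂ) (a : Fin k)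
    (x : EuclideanSpace ℂ (Fin k)) :
    inner ℂ (WithLp.toLp 2 (fun y => E y a) : EuclideanSpace ℂ (Fin k)) x = (Eᴴ *ᵥ x.ofLp) a := by
  rw [EuclideanSpace.inner_eq_star_dotProduct]
  simp [Matrix.mulVec, dotProduct, mul_comm]

lemma sum_norm_sq_mulVec_of_unitary {k : ℕ} {E : Matrix (Fin k) (Fin k) ℂ} (hE : Eᴴ * E = 1)
    (x : Fin k → ℂ) : ∑ a, ‖(Eᴴ *ᵥ x) a‖ ^ 2 = ∑ a, ‖x a‖ ^ 2 := by
  have h : ∀ v : Fin k → ℂ, ((∑ a, ‖v a‖ ^ 2 : ℝ) : ℂ) = star v ⬝ᵥ v := by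
    intro v
    push_cast
    refine Finset.sum_congr rfl fun a _ => ?_
    have := Complex.normSq_eq_conj_mul_self (z := v a)
    rw [Complex.normSq_eq_norm_sq] at this
    push_cast at this
    exact this
  have h2 : E * Eᴴ = 1 := mul_eq_one_comm.mp hE
  have : ((∑ a, ‖(Eᴴ *ᵥ x) a‖ ^ 2 : ℝ) : ℂ) = ((∑ a, ‖x a‖ ^ 2 : ℝ) : ℂ) := by
    rw [h, h, Matrix.star_mulVec, Matrix.conjTranspose_conjTranspose,
      Matrix.dotProduct_mulVec, Matrix.vecMul_vecMul, h2, Matrix.vecMul_one]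
  exact_mod_cast this

lemma semiStable_of_coordinates {k m : ℕ} {c : Fin 3 → Fin k → ℕ} (hc : ∀ i a, c i a ≤ m)
    {E : Fin 3 → Matrix (Fin k) (Fin k) ℂ} (hE : ∀ i, (E i)ᴴ * E i = 1)
    (hsum : ∑ i, E i * diagonal (fun a => (c i a : ℂ)) * (E i)ᴴ = (m : ℂ) • 1)
    {e : Fin 3 → Fin k → Fin k → ℂ}
    (he : ∀ i, ∀ z : Fin k → ℂ, ∑ a, ‖((E i)ᴴ *ᵥ ∑ b, z b • e i b) a - z a‖ ^ 2 ≤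
      (1 / (3 * m * k + 1) : ℝ) * ∑ a, ‖((E i)ᴴ *ᵥ ∑ b, z b • e i b) a‖ ^ 2) :
    SemiStable m c e := by
  classical
  intro N
  set δ : ℝ := 1 / (3 * m * k + 1) with hδ
  let φ := (WithLp.linearEquiv 2 ℂ (Fin k → ℂ)).symm
  let N' : Submodule ℂ (EuclideanSpace ℂ (Fin k)) := N.map φ.toLinearMap
  let b := stdOrthonormalBasis ℂ N'
  let T : Fin 3 → Fin k → ℝ := fun i a =>
    ∑ l, ‖inner ℂ (b l : EuclideanSpace ℂ (Fin k)) (WithLp.toLp 2 (fun y => E i y a))‖ ^ 2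
  have hT0 : ∀ i a, 0 ≤ T i a := fun i a => Finset.sum_nonneg fun l _ => by positivity
  have hN' : Module.finrank ℂ N' = Module.finrank ℂ N := LinearEquiv.finrank_map_eq φ N
  -- the total weight
  have htot : ∑ i, ∑ a, (c i a : ℝ) * T i a = m * Module.finrank ℂ N := by
    have hx : ∀ x : EuclideanSpace ℂ (Fin k), ∑ i, ∑ a, (c i a : ℝ) *
        ‖inner ℂ x (WithLp.toLp 2 (fun y => E i y a) : EuclideanSpace ℂ (Fin k))‖ ^ 2
          = m * ‖x‖ ^ 2 := by
      intro x
      have h1 : ∀ i, ((∑ a, (c i a : ℝ) *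
          ‖inner ℂ x (WithLp.toLp 2 (fun y => E i y a) : EuclideanSpace ℂ (Fin k))‖ ^ 2 : ℝ) : ℂ)
          = star x.ofLp ⬝ᵥ ((E i * diagonal (fun a => (c i a : ℂ)) * (E i)ᴴ) *ᵥ x.ofLp) := by
        intro i
        rw [Matrix.mul_assoc, ← Matrix.mulVec_mulVec, ← Matrix.mulVec_mulVec,
          Matrix.dotProduct_mulVec]
        have h2 : star x.ofLp ᵥ* E i = star ((E i)ᴴ *ᵥ x.ofLp) := by
          rw [Matrix.star_mulVec, Matrix.conjTranspose_conjTranspose]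
        rw [h2]
        push_cast
        refine Finset.sum_congr rfl fun a _ => ?_
        rw [norm_inner_symm, inner_column, Matrix.mulVec_diagonal, Pi.star_apply]
        have := Complex.normSq_eq_conj_mul_self (z := ((E i)ᴴ *ᵥ x.ofLp) a)
        rw [Complex.normSq_eq_norm_sq] at this
        push_cast at this
        rw [this]
        simp only [Complex.star_def]
        ring
      have h3 : ((∑ i, ∑ a, (c i a : ℝ) *
          ‖inner ℂ x (WithLp.toLp 2 (fun y => E i y a) : EuclideanSpace ℂ (Fin k))‖ ^ 2 : ℝ) : ℂ)
          = ((m * ‖x‖ ^ 2 : ℝ) : ℂ) := by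
        rw [Complex.ofReal_sum]
        simp only [h1]
        rw [← dotProduct_sum, ← Matrix.sum_mulVec, hsum, Matrix.smul_mulVec,
          Matrix.one_mulVec, dotProduct_smul, dotProduct_comm,
          ← EuclideanSpace.inner_eq_star_dotProduct, inner_self_eq_norm_sq_to_K]
        push_cast
        rfl
      exact_mod_cast h3
    simp only [T, Finset.mul_sum]
    calc _ = ∑ l, ∑ i, ∑ a, (c i a : ℝ) * ‖inner ℂ (b l : EuclideanSpace ℂ (Fin k))
          (WithLp.toLp 2 (fun y => E i y a))‖ ^ 2 := by
          rw [Finset.sum_comm' (t' := Finset.univ) (s' := fun _ => Finset.univ) (by simp)]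
          refine (Finset.sum_congr rfl fun i _ => Finset.sum_comm).trans ?_
          rw [Finset.sum_comm]
          refine Finset.sum_congr rfl fun l _ => ?_
          rw [Finset.sum_comm]
      _ = _ := by
          simp only [hx]
          have : ∀ l, ‖(b l : EuclideanSpace ℂ (Fin k))‖ = 1 := fun l => b.orthonormal.1 l
          simp [this, hN', mul_comm]
  have hpiece : ∀ i (j : Fin m), (1 - δ) * Module.finrank ℂ ↥(N ⊓ flagSpan c e i j) ≤
      ∑ a ∈ Finset.univ.filter (fun a => (j : ℕ) < c i a), T i a := by
    intro i j
    let W' : Submodule ℂ (EuclideanSpace ℂ (Fin k)) := (N ⊓ flagSpan c e i j).map φ.toLinearMap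
    let w := stdOrthonormalBasis ℂ W'
    have hW' : Module.finrank ℂ W' = Module.finrank ℂ ↥(N ⊓ flagSpan c e i j) :=
      LinearEquiv.finrank_map_eq φ _
    have hwN : ∀ l, (w l : EuclideanSpace ℂ (Fin k)) ∈ N' := fun l =>
      Submodule.map_mono inf_le_left (w l).2
    have hwo : Orthonormal ℂ (fun l => (w l : EuclideanSpace ℂ (Fin k))) :=
      w.orthonormal.comp_linearIsometry W'.subtypeₗᵢ
    calc (1 - δ) * Module.finrank ℂ ↥(N ⊓ flagSpan c e i j)
        = ∑ l : Fin (Module.finrank ℂ W'), (1 - δ) := by simp [hW']; ring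
      _ ≤ ∑ l, ∑ a ∈ Finset.univ.filter (fun a => (j : ℕ) < c i a),
            ‖inner ℂ (w l : EuclideanSpace ℂ (Fin k))
              (WithLp.toLp 2 (fun y => E i y a) : EuclideanSpace ℂ (Fin k))‖ ^ 2 := by
          refine Finset.sum_le_sum fun l _ => ?_
          obtain ⟨v, hv, hvw⟩ := (w l).2
          obtain ⟨z, hz, hvz⟩ := exists_coeff_of_mem_flagSpan hv.2
          have h1 := he i z
          rw [← hvz] at h1
          have hvl : (w l : EuclideanSpace ℂ (Fin k)).ofLp = v := by rw [← hvw]; rfl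
          have hnorm : ∑ a, ‖((E i)ᴴ *ᵥ v) a‖ ^ 2 = 1 := by
            rw [sum_norm_sq_mulVec_of_unitary (hE i), ← hvl, ← EuclideanSpace.norm_sq_eq]
            rw [hwo.1 l]; norm_num
          simp only [norm_inner_symm (w l : EuclideanSpace ℂ (Fin k)), inner_column, hvl]
          rw [hnorm, mul_one] at h1
          rw [← Finset.sum_filter_add_sum_filter_not Finset.univ
            (fun a => (j : ℕ) < c i a)] at hnorm
          have h2 : ∑ a ∈ Finset.univ.filter (fun a => ¬ (j : ℕ) < c i a),
              ‖((E i)ᴴ *ᵥ v) a‖ ^ 2 ≤ δ := by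
            refine le_trans ?_ h1
            refine le_trans (Finset.sum_le_sum fun a ha => ?_)
              (Finset.sum_le_univ_sum_of_nonneg fun a => by positivity)
            rw [hz a (Finset.mem_filter.mp ha).2, sub_zero]
          linarith
      _ = ∑ a ∈ Finset.univ.filter (fun a => (j : ℕ) < c i a), ∑ l,
            ‖inner ℂ (w l : EuclideanSpace ℂ (Fin k))
              (WithLp.toLp 2 (fun y => E i y a) : EuclideanSpace ℂ (Fin k))‖ ^ 2 :=
          Finset.sum_comm
      _ ≤ _ := Finset.sum_le_sum fun a _ => sum_sq_inner_le_of_mem b hwo hwN _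
  have hcount : ∀ i, ∑ j : Fin m, ∑ a ∈ Finset.univ.filter (fun a => (j : ℕ) < c i a), T i a
      = ∑ a, (c i a : ℝ) * T i a := by
    intro i
    simp only [Finset.sum_filter]
    rw [Finset.sum_comm]
    refine Finset.sum_congr rfl fun a _ => ?_
    rw [← Finset.sum_filter, Finset.sum_const, nsmul_eq_mul, Fin.card_filter_val_lt,
      min_eq_right (hc i a)]
  set D := ∑ i, ∑ j : Fin m, Module.finrank ℂ ↥(N ⊓ flagSpan c e i j) with hD
  have h1 : (1 - δ) * D ≤ m * Module.finrank ℂ N := by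
    rw [← htot, hD]
    push_cast
    simp only [Finset.mul_sum]
    refine Finset.sum_le_sum fun i _ => ?_
    rw [← hcount i]
    exact Finset.sum_le_sum fun j _ => hpiece i j
  have h2 : D ≤ 3 * m * k := by
    rw [hD]
    calc _ ≤ ∑ i : Fin 3, ∑ j : Fin m, k := by
          refine Finset.sum_le_sum fun i _ => Finset.sum_le_sum fun j _ => ?_
          exact (Submodule.finrank_le _).trans (by simp)
      _ = _ := by simp [mul_assoc]
  have h3 : δ * D < 1 := by
    rw [hδ, div_mul_eq_mul_div, one_mul, div_lt_one (by positivity)]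
    have : (D : ℝ) ≤ 3 * m * k := by exact_mod_cast h2
    linarith
  have h4 : (D : ℝ) < (m * Module.finrank ℂ N : ℕ) + 1 := by push_cast; linarith
  have h5 : D < m * Module.finrank ℂ N + 1 := by exact_mod_cast h4
  omega

theorem exists_frames_of_scalarSum {k m : ℕ} {c : Fin 3 → Fin k → ℕ} (hc : ∀ i a, c i a ≤ m)
    (h : ScalarSum k m c) :
    ∃ (e : Fin 3 → Fin k → Fin k → ℂ) (ξ : Fin 3 → Fin m → Fin m → ℂ),
      (∀ i, LinearIndependent ℂ (e i)) ∧ (∀ i, LinearIndependent ℂ (ξ i)) ∧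
        LinearIndepOn ℂ (frameTensor e ξ) (diagram m c) := by
  obtain ⟨E, hE, hsum⟩ := h
  let e₀ : Fin 3 → Fin k → Fin k → ℂ := fun i a x => E i x a
  have hLI : ∀ i, LinearIndependent ℂ (e₀ i) := by
    intro i
    have := Matrix.linearIndependent_cols_iff_isUnit.mpr
      (IsUnit.of_mul_eq_one _ (mul_eq_one_comm.mp (hE i)))
    exact this
  have hss : ∀ᶠ e in 𝓝 e₀, SemiStable m c e := by
    have h1 : ∀ i, ∀ᶠ e in 𝓝 e₀, ∀ z : Fin k → ℂ,
        ∑ a, ‖((E i)ᴴ *ᵥ ∑ b, z b • e i b) a - z a‖ ^ 2 ≤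
        (1 / (3 * m * k + 1) : ℝ) * ∑ a, ‖((E i)ᴴ *ᵥ ∑ b, z b • e i b) a‖ ^ 2 := fun i =>
      ((continuous_apply i).tendsto e₀).eventually
        (eventually_frame_coordinates (hE i) (by positivity))
    filter_upwards [Filter.eventually_all.mpr h1] with e he
    exact semiStable_of_coordinates hc hE hsum he
  obtain ⟨e₁, ξ₁, h1⟩ := exists_linearIndepOn_of_semiStable m k c e₀ hLI hss
  have h2 := eventually_frameTensor_left e₀ e₁ h1
  have h3 := (tendsto_line e₀ (e₁ - e₀)).eventually
    ((isOpen_forall_linearIndependent k).mem_nhds hLI)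
  obtain ⟨t, ht2, ht3⟩ := (h2.and h3).exists
  let ξ₀ : Fin 3 → Fin m → Fin m → ℂ := fun _ a => Pi.single a 1
  have hξ₀ : ∀ i, LinearIndependent ℂ (ξ₀ i) := fun i => Pi.linearIndependent_single_one (Fin m) ℂ
  have h4 := eventually_frameTensor_right ξ₀ ξ₁ ht2
  have h5 := (tendsto_line ξ₀ (ξ₁ - ξ₀)).eventually
    ((isOpen_forall_linearIndependent m).mem_nhds hξ₀)
  obtain ⟨t', ht4, ht5⟩ := (h4.and h5).exists
  exact ⟨_, _, ht3, ht5, ht4⟩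

lemma card_filter_lt_orderEmbOfFin {n r : ℕ} (S : Finset (Fin n)) (h : S.card = r) (b : Fin r) :
    (S.filter fun x => x < S.orderEmbOfFin h b).card = b := by
  have : (S.filter fun x => x < S.orderEmbOfFin h b) =
      (Finset.univ.filter fun a : Fin r => a < b).map (S.orderEmbOfFin h).toEmbedding := by
    ext x
    simp only [Finset.mem_filter, Finset.mem_map, Finset.mem_univ, true_and]
    constructor
    · rintro ⟨hx, hlt⟩
      have : x ∈ Set.range (S.orderEmbOfFin h) := by
        rw [Finset.range_orderEmbOfFin]; exact hx
      obtain ⟨a, rfl⟩ := this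
      exact ⟨a, (S.orderEmbOfFin h).lt_iff_lt.mp hlt, rfl⟩
    · rintro ⟨a, ha, rfl⟩
      exact ⟨Finset.orderEmbOfFin_mem _ _ _, (S.orderEmbOfFin h).lt_iff_lt.mpr ha⟩
  rw [this, Finset.card_map, show (Finset.univ.filter fun a : Fin r => a < b) = Finset.Iio b by
    ext; simp, Fin.card_Iio]

lemma card_filter_compl_lt {n r : ℕ} (I : Finset (Fin n)) (h : I.card = r) (a : Fin r) :
    (Iᶜ.filter fun x => x < I.orderEmbOfFin h a).card = level I h a := by
  have h1 := card_filter_lt_orderEmbOfFin I h a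
  have h2 := level_add I h a
  have h3 : (Finset.univ.filter fun x => x < I.orderEmbOfFin h a).card
      = (I.orderEmbOfFin h a : ℕ) := by
    rw [show (Finset.univ.filter fun x => x < I.orderEmbOfFin h a)
      = Finset.Iio (I.orderEmbOfFin h a) by ext; simp, Fin.card_Iio]
  have h4 : (Finset.univ.filter fun x => x < I.orderEmbOfFin h a).card =
      (I.filter fun x => x < I.orderEmbOfFin h a).card +
      (Iᶜ.filter fun x => x < I.orderEmbOfFin h a).card := by
    rw [← Finset.union_compl I, Finset.filter_union, Finset.card_union_of_disjoint]
    exact Finset.disjoint_filter_filter disjoint_compl_right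
  omega

lemma compl_orderEmbOfFin_lt_iff {n r m : ℕ} (I : Finset (Fin n)) (h : I.card = r)
    (h' : Iᶜ.card = m) (a : Fin r) (b : Fin m) :
    Iᶜ.orderEmbOfFin h' b < I.orderEmbOfFin h a ↔ (b : ℕ) < level I h a := by
  rw [← card_filter_compl_lt I h a, ← card_filter_lt_orderEmbOfFin Iᶜ h' b]
  constructor
  · intro hlt
    refine Finset.card_lt_card ⟨fun x hx => ?_, fun hsub => ?_⟩
    · rw [Finset.mem_filter] at hx ⊢
      exact ⟨hx.1, hx.2.trans hlt⟩
    · have := hsub (Finset.mem_filter.mpr ⟨Finset.orderEmbOfFin_mem _ h' b, hlt⟩)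
      exact lt_irrefl _ (Finset.mem_filter.mp this).2
  · intro hlt
    by_contra hge
    refine absurd hlt (not_lt.mpr (Finset.card_le_card fun x hx => ?_))
    rw [Finset.mem_filter] at hx ⊢
    exact ⟨hx.1, hx.2.trans_le (not_lt.mp hge)⟩

lemma level_le {n r : ℕ} (I : Finset (Fin n)) (h : I.card = r) (a : Fin r) :
    level I h a ≤ n - r := by
  rw [← card_filter_compl_lt I h a]
  refine (Finset.card_filter_le _ _).trans ?_
  rw [Finset.card_compl, h, Fintype.card_fin]

/-- Solvability of an equation persists under perturbation when the partial derivative in the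
unknown is surjective. -/
lemma eventually_exists_zero {E₁ E₂ F : Type*} [NormedAddCommGroup E₁] [NormedSpace ℂ E₁]
    [CompleteSpace E₁] [NormedAddCommGroup E₂] [NormedSpace ℂ E₂] [CompleteSpace E₂]
    [NormedAddCommGroup F] [NormedSpace ℂ F] [CompleteSpace F] {G : E₁ × E₂ → F}
    (hG : ContDiff ℂ 1 G) {a : E₁} {b : E₂} (h0 : G (a, b) = 0)
    (hsurj : ∀ y : F, ∃ d : E₂, HasDerivAt (fun t : ℂ => G (a, b + t • d)) y 0)
    {W : Set E₂} (hW : W ∈ 𝓝 b) : ∀ᶠ k in 𝓝 a, ∃ x ∈ W, G (k, x) = 0 := by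
  let Φ : E₁ × E₂ → E₁ × F := fun x => (x.1, G x)
  have h1 : HasStrictFDerivAt G (fderiv ℂ G (a, b)) (a, b) :=
    hG.contDiffAt.hasStrictFDerivAt one_ne_zero
  have h2 : HasStrictFDerivAt Φ ((ContinuousLinearMap.fst ℂ E₁ E₂).prod (fderiv ℂ G (a, b)))
      (a, b) := hasStrictFDerivAt_fst.prodMk h1
  have h3 := h2.map_nhds_eq_of_surj (by
    rw [LinearMap.range_eq_top]
    rintro ⟨u, y⟩
    obtain ⟨d, hd⟩ := hsurj (y - fderiv ℂ G (a, b) (u, 0))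
    refine ⟨(u, d), ?_⟩
    have hline : HasDerivAt (fun t : ℂ => ((a, b + t • d) : E₁ × E₂)) (0, d) 0 := by
      refine (hasDerivAt_const _ _).prodMk ?_
      simpa using ((hasDerivAt_id (0 : ℂ)).smul_const d).const_add b
    have hG' : HasFDerivAt G (fderiv ℂ G (a, b)) ((fun t : ℂ => ((a, b + t • d) : E₁ × E₂)) 0) := by
      simpa using h1.hasFDerivAt
    have h4 := (hG'.comp_hasDerivAt (0 : ℂ) hline).unique hd
    have h5 : fderiv ℂ G (a, b) (u, d) = y := by
      have : ((u, d) : E₁ × E₂) = (u, 0) + (0, d) := by simp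
      rw [this, map_add, h4]; abel
    simp [h5])
  have h4 : Φ '' (Set.univ ×ˢ W) ∈ 𝓝 (a, (0 : F)) := by
    have : Φ (a, b) = (a, 0) := by simp [Φ, h0]
    rw [← this, ← h3]
    exact Filter.image_mem_map (prod_mem_nhds Filter.univ_mem hW)
  have h5 : Filter.Tendsto (fun k : E₁ => (k, (0 : F))) (𝓝 a) (𝓝 (a, 0)) :=
    (Continuous.prodMk_left (0 : F)).tendsto a
  filter_upwards [h5 h4] with k hk
  obtain ⟨⟨k', x⟩, ⟨-, hx⟩, hkx⟩ := hk
  simp only [Φ, Prod.mk.injEq] at hkx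
  exact ⟨x, hx, by rw [← hkx.1]; exact hkx.2⟩

lemma exists_dual_of_linearIndepOn {ι κ : Type*} [Fintype κ] {s : Set ι} {v : ι → κ → ℂ}
    (hv : LinearIndepOn ℂ v s) (y : ι → ℂ) : ∃ x : κ → ℂ, ∀ t ∈ s, ∑ z, v t z * x z = y t := by
  classical
  have hv' : LinearIndependent ℂ (fun t : s => v t) := hv
  let b := Module.Basis.span hv'
  obtain ⟨g, hg⟩ := LinearMap.exists_extend (b.constr ℂ fun t : s => y t)
  refine ⟨fun z => g (Pi.single z 1), fun t ht => ?_⟩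
  have h1 : g (v t) = y t := by
    have h2 := b.constr_basis ℂ (fun t : s => y t) ⟨t, ht⟩
    rw [← hg, LinearMap.comp_apply, Submodule.subtype_apply, Module.Basis.span_apply] at h2
    exact h2
  rw [← h1]
  conv_rhs => rw [pi_eq_sum_univ' (v t), map_sum]
  refine Finset.sum_congr rfl fun z _ => ?_
  rw [map_smul, smul_eq_mul]

/-- The tensor power of a matrix. -/
def tensorPow {α β : Type*} (r : ℕ) (k : Matrix α β ℂ) : Matrix (Fin r → α) (Fin r → β) ℂ :=
  fun f g => ∏ a, k (f a) (g a)

lemma tensorPow_mulVec_minors {α β : Type*} [Fintype β] {r : ℕ} (k : Matrix α β ℂ)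
    (M : Matrix β (Fin r) ℂ) (f : Fin r → α) :
    ∑ g, tensorPow r k f g * (M.submatrix g id).det = ((k * M).submatrix f id).det := by
  classical
  have h := (detRowAlternating (n := Fin r) (R := ℂ)).toMultilinearMap.map_sum
    (fun a (x : β) => k (f a) x • M x)
  have h2 : ((k * M).submatrix f id) = fun a => ∑ x, k (f a) x • M x := by
    ext a b
    simp [Matrix.mul_apply, Finset.sum_apply]
  rw [h2]
  refine Eq.trans ?_ h.symm
  refine Finset.sum_congr rfl fun g _ => ?_
  rw [MultilinearMap.map_smul_univ]
  rfl

lemma det_submatrix_eq_zero {n r : ℕ} (A : Matrix (Fin n) (Fin r) ℂ) (I : Fin r → Fin n)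
    (hA : ∀ j a, j < I a → A j a = 0) (f : Fin r → Fin n)
    (hf : ∀ σ : Equiv.Perm (Fin r), ∃ a, f (σ a) < I a) : (A.submatrix f id).det = 0 := by
  rw [Matrix.det_apply]
  refine Finset.sum_eq_zero fun σ _ => ?_
  obtain ⟨a, ha⟩ := hf σ
  have h1 : ∏ b, A.submatrix f id (σ b) b = 0 :=
    Finset.prod_eq_zero (Finset.mem_univ a) (hA _ _ ha)
  rw [h1, smul_zero]

lemma exists_tensor_of_intersection {n r : ℕ} {ν : Type*} [Fintype ν]
    (k : Fin 3 → Matrix (Fin n) ν ℂ) (I : Fin 3 → Fin r → Fin n) (M : Matrix ν (Fin r) ℂ)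
    (c : Fin 3 → Matrix (Fin r) (Fin r) ℂ) {g : Fin r → ν} (hM : (M.submatrix g id).det ≠ 0)
    (hc : ∀ i, (c i).det ≠ 0) (h : ∀ i j a, j < I i a → (k i * M * c i) j a = 0) :
    ∃ ω : (Fin r → ν) → ℂ, ω ≠ 0 ∧ ∀ i f, (∀ σ : Equiv.Perm (Fin r), ∃ a, f (σ a) < I i a) →
      (tensorPow r (k i) *ᵥ ω) f = 0 := by
  refine ⟨fun g => (M.submatrix g id).det, fun h0 => hM (congrFun h0 g), fun i f hf => ?_⟩
  have h1 := det_submatrix_eq_zero _ (I i) (h i) f hf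
  have h2 : ((k i * M * c i).submatrix f id) = ((k i * M).submatrix f id) * c i := by
    ext; simp [Matrix.mul_apply]
  rw [h2, det_mul] at h1
  refine (tensorPow_mulVec_minors (k i) M f).trans ?_
  exact (mul_eq_zero.mp h1).resolve_right (hc i)

/-- Every triple of changes of coordinates near a suitable base point admits a common subspace in
the prescribed Schubert positions. -/
lemma exists_open_intersection {n r m : ℕ} (I : Fin 3 → Finset (Fin n))
    (hI : ∀ i, (I i).card = r) (hm : ∀ i, (I i)ᶜ.card = m)
    {e : Fin 3 → Fin r → Fin r → ℂ} {ξ : Fin 3 → Fin m → Fin m → ℂ}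
    (he : ∀ i, LinearIndependent ℂ (e i))
    (hLI : LinearIndepOn ℂ (frameTensor e ξ) (diagram m fun i => level (I i) (hI i))) :
    ∃ k₀ : Fin 3 → Fin n → (Fin r ⊕ Fin m) → ℂ, ∀ᶠ k in 𝓝 k₀,
      ∃ (M : Matrix (Fin r ⊕ Fin m) (Fin r) ℂ) (c : Fin 3 → Matrix (Fin r) (Fin r) ℂ),
        (M.submatrix Sum.inl id).det ≠ 0 ∧ (∀ i, (c i).det ≠ 0) ∧
        ∀ i j a, j < (I i).orderEmbOfFin (hI i) a → (Matrix.of (k i) * M * c i) j a = 0 := by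
  classical
  let C : Fin 3 → Matrix (Fin r) (Fin r) ℂ := fun i x a => e i a x
  have hC : ∀ i, IsUnit (C i).det := fun i =>
    (Matrix.isUnit_iff_isUnit_det _).mp (Matrix.linearIndependent_cols_iff_isUnit.mp (he i))
  let σ : Fin 3 → Fin r ⊕ Fin m ≃ Fin n := fun i => finSumEquivOfFinset (hI i) (hm i)
  let C' : Fin 3 → Fin r → Fin r → ℂ := C
  let k₀ : Fin 3 → Fin n → (Fin r ⊕ Fin m) → ℂ := fun i j =>
    Sum.elim (fun b => Sum.elim ((C i)⁻¹ b) 0) (fun b => Sum.elim 0 (ξ i b)) ((σ i).symm j)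
  let M₀ : (Fin r ⊕ Fin m) → Fin r → ℂ := Matrix.fromRows 1 0
  let T := {t : Fin 3 × Fin n × Fin r // t.2.1 < (I t.1).orderEmbOfFin (hI t.1) t.2.2}
  let G : (Fin 3 → Fin n → (Fin r ⊕ Fin m) → ℂ) ×
      (((Fin r ⊕ Fin m) → Fin r → ℂ) × (Fin 3 → Fin r → Fin r → ℂ)) → (T → ℂ) :=
    fun x t => ∑ z, (∑ y, x.1 t.1.1 t.1.2.1 y * x.2.1 y z) * x.2.2 t.1.1 z t.1.2.2
  have hG : ContDiff ℂ 1 G := by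
    refine contDiff_pi.mpr fun t => ?_
    simp only [G]
    refine ContDiff.sum fun z _ => ContDiff.mul (ContDiff.sum fun y _ => ContDiff.mul ?_ ?_) ?_
    all_goals fun_prop
  have hGeq : ∀ x t, G x t = (Matrix.of (x.1 t.1.1) * Matrix.of x.2.1 * Matrix.of (x.2.2 t.1.1))
      t.1.2.1 t.1.2.2 := fun x t => rfl
  let W : Set (((Fin r ⊕ Fin m) → Fin r → ℂ) × (Fin 3 → Fin r → Fin r → ℂ)) :=
    {x | ((Matrix.of x.1).submatrix Sum.inl id).det ≠ 0 ∧ ∀ i, (Matrix.of (x.2 i)).det ≠ 0}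
  have hW : W ∈ 𝓝 (M₀, C') := by
    have hopen : IsOpen W := by
      refine IsOpen.inter ?_ ?_
      · refine isOpen_ne_fun (Continuous.matrix_det ?_) continuous_const
        exact Continuous.matrix_submatrix continuous_fst _ _
      · have : {x : ((Fin r ⊕ Fin m) → Fin r → ℂ) × (Fin 3 → Fin r → Fin r → ℂ) |
            ∀ i, (Matrix.of (x.2 i)).det ≠ 0} = ⋂ i, {x | (Matrix.of (x.2 i)).det ≠ 0} := by
          ext; simp
        change IsOpen {x : ((Fin r ⊕ Fin m) → Fin r → ℂ) × (Fin 3 → Fin r → Fin r → ℂ) |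
            ∀ i, (Matrix.of (x.2 i)).det ≠ 0}
        rw [this]
        refine isOpen_iInter_of_finite fun i => ?_
        refine isOpen_ne_fun (Continuous.matrix_det ?_) continuous_const
        exact (continuous_apply i).comp continuous_snd
    refine hopen.mem_nhds ⟨?_, fun i => (hC i).ne_zero⟩
    have : (Matrix.of M₀).submatrix Sum.inl id = (1 : Matrix (Fin r) (Fin r) ℂ) := by
      ext; rfl
    rw [this, det_one]; exact one_ne_zero
  have hrow : ∀ i (M : (Fin r ⊕ Fin m) → Fin r → ℂ) (c : Fin r → Fin r → ℂ) b a,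
      (Matrix.of (k₀ i) * Matrix.of M * Matrix.of c) (σ i (Sum.inl b)) a =
        ((C i)⁻¹ * Matrix.of (fun x z => M (Sum.inl x) z) * Matrix.of c) b a := by
    intro i M c b a
    simp [Matrix.mul_apply, k₀, Fintype.sum_sum_type]
  have hrow' : ∀ i (M : (Fin r ⊕ Fin m) → Fin r → ℂ) (c : Fin r → Fin r → ℂ) b a,
      (Matrix.of (k₀ i) * Matrix.of M * Matrix.of c) (σ i (Sum.inr b)) a =
        (Matrix.of (ξ i) * Matrix.of (fun x z => M (Sum.inr x) z) * Matrix.of c) b a := by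
    intro i M c b a
    simp [Matrix.mul_apply, k₀, Fintype.sum_sum_type]
  have hMl : Matrix.of (fun x z => M₀ (Sum.inl x) z) = 1 := by ext; rfl
  have hMr : Matrix.of (fun (x : Fin m) z => M₀ (Sum.inr x) z) = 0 := by ext; rfl
  have hT : ∀ t : T, (∃ b, t.1.2.1 = σ t.1.1 (Sum.inl b) ∧ b < t.1.2.2) ∨
      (∃ b : Fin m, t.1.2.1 = σ t.1.1 (Sum.inr b) ∧
        (t.1.1, t.1.2.2, b) ∈ diagram m fun i => level (I i) (hI i)) := by
    rintro ⟨⟨i, j, a⟩, ht⟩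
    obtain ⟨b | b, rfl⟩ := (σ i).surjective j
    · left
      refine ⟨b, rfl, ?_⟩
      simp only [σ, finSumEquivOfFinset_inl] at ht
      exact ((I i).orderEmbOfFin (hI i)).lt_iff_lt.mp ht
    · right
      refine ⟨b, rfl, ?_⟩
      simp only [σ, finSumEquivOfFinset_inr] at ht
      exact (compl_orderEmbOfFin_lt_iff _ (hI i) (hm i) _ _).mp ht
  have h0 : G (k₀, (M₀, C')) = 0 := by
    ext t
    rw [hGeq]
    obtain ⟨b, hb, hlt⟩ | ⟨b, hb, -⟩ := hT t
    · rw [hb]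
      refine (hrow _ _ _ _ _).trans ?_
      rw [hMl, Matrix.mul_one]
      change ((C t.1.1)⁻¹ * C t.1.1) b _ = 0
      rw [Matrix.nonsing_inv_mul _ (hC _), Matrix.one_apply_ne hlt.ne]
    · rw [hb]
      refine (hrow' _ _ _ _ _).trans ?_
      rw [hMr, Matrix.mul_zero, Matrix.zero_mul]; rfl
  refine ⟨k₀, ?_⟩
  have hsurj : ∀ y : T → ℂ, ∃ d : ((Fin r ⊕ Fin m) → Fin r → ℂ) × (Fin 3 → Fin r → Fin r → ℂ),
      HasDerivAt (fun t : ℂ => G (k₀, (M₀, C') + t • d)) y 0 := by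
    intro y
    let y' : Fin 3 → Fin n → Fin r → ℂ := fun i j a =>
      if h : j < (I i).orderEmbOfFin (hI i) a then y ⟨(i, j, a), h⟩ else 0
    have hy' : ∀ t : T, y' t.1.1 t.1.2.1 t.1.2.2 = y t := fun t => dif_pos t.2
    obtain ⟨X, hX⟩ := exists_dual_of_linearIndepOn hLI
      (fun t => y' t.1 (σ t.1 (Sum.inr t.2.2)) t.2.1)
    let dM : (Fin r ⊕ Fin m) → Fin r → ℂ :=
      Matrix.fromRows (0 : Matrix (Fin r) (Fin r) ℂ) (fun q x => X (x, q))
    let dc : Fin 3 → Fin r → Fin r → ℂ := fun i =>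
      C i * Matrix.of (fun b a => y' i (σ i (Sum.inl b)) a)
    refine ⟨(dM, dc), hasDerivAt_pi.mpr fun t => ?_⟩
    have hexp : ∀ s : ℂ, G (k₀, (M₀, C') + s • (dM, dc)) t =
        (Matrix.of (k₀ t.1.1) * Matrix.of M₀ * Matrix.of (C t.1.1)) t.1.2.1 t.1.2.2 +
        s * ((Matrix.of (k₀ t.1.1) * Matrix.of dM * Matrix.of (C t.1.1)) t.1.2.1 t.1.2.2 +
          (Matrix.of (k₀ t.1.1) * Matrix.of M₀ * Matrix.of (dc t.1.1)) t.1.2.1 t.1.2.2) +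
        s ^ 2 * (Matrix.of (k₀ t.1.1) * Matrix.of dM * Matrix.of (dc t.1.1)) t.1.2.1 t.1.2.2 := by
      intro s
      rw [hGeq]
      have e1 : Matrix.of (((M₀, C') + s • (dM, dc)).1) = Matrix.of M₀ + s • Matrix.of dM := rfl
      have e2 : Matrix.of (((M₀, C') + s • (dM, dc)).2 t.1.1) =
        Matrix.of (C t.1.1) + s • Matrix.of (dc t.1.1) := rfl
      simp only [e1, e2, Matrix.mul_add, Matrix.add_mul, Matrix.mul_smul, Matrix.smul_mul,
        Matrix.add_apply, Matrix.smul_apply, smul_eq_mul]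
      ring
    simp only [hexp]
    have hval : (Matrix.of (k₀ t.1.1) * Matrix.of dM * Matrix.of (C t.1.1)) t.1.2.1 t.1.2.2 +
        (Matrix.of (k₀ t.1.1) * Matrix.of M₀ * Matrix.of (dc t.1.1)) t.1.2.1 t.1.2.2 = y t := by
      rw [← hy' t]
      obtain ⟨b, hb, hlt⟩ | ⟨b, hb, hd⟩ := hT t
      · rw [hb, hrow, hrow, hMl]
        have h1 : Matrix.of (fun x z => dM (Sum.inl x) z) = (0 : Matrix (Fin r) (Fin r) ℂ) := by
          ext; rfl
        have h2 : Matrix.of (dc t.1.1) =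
          C t.1.1 * Matrix.of (fun b a => y' t.1.1 (σ t.1.1 (Sum.inl b)) a) := rfl
        rw [h1, h2, Matrix.mul_zero, Matrix.zero_mul, Matrix.mul_one, ← Matrix.mul_assoc,
          Matrix.nonsing_inv_mul _ (hC _), Matrix.one_mul, Matrix.zero_apply, zero_add]
        rfl
      · rw [hb, hrow', hrow', hMr, Matrix.mul_zero, Matrix.zero_mul, Matrix.zero_apply, add_zero,
          ← hX _ hd]
        simp only [Matrix.mul_apply, Matrix.of_apply, frameTensor, tmul_apply,
          Fintype.sum_prod_type, Finset.sum_mul]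
        refine Finset.sum_congr rfl fun x _ => Finset.sum_congr rfl fun q _ => ?_
        change ξ t.1.1 b q * X (x, q) * e t.1.1 t.1.2.2 x = _
        ring
    have hd := (((hasDerivAt_id (0 : ℂ)).mul_const (y t)).const_add
      ((Matrix.of (k₀ t.1.1) * Matrix.of M₀ * Matrix.of (C t.1.1)) t.1.2.1 t.1.2.2)).add
      (((hasDerivAt_id (0 : ℂ)).pow 2).mul_const
        ((Matrix.of (k₀ t.1.1) * Matrix.of dM * Matrix.of (dc t.1.1)) t.1.2.1 t.1.2.2))
    rw [hval]
    simp only [id_eq, one_mul, Nat.cast_ofNat, mul_one, mul_zero, zero_mul, add_zero, pow_one,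
      Nat.add_one_sub_one] at hd
    exact hd
  filter_upwards [eventually_exists_zero hG h0 hsurj hW] with k hk
  obtain ⟨x, hxW, hx⟩ := hk
  refine ⟨Matrix.of x.1, fun i => Matrix.of (x.2 i), hxW.1, hxW.2, fun i j a hj => ?_⟩
  exact congrFun hx ⟨(i, j, a), hj⟩

theorem exists_tensor_of_frames {n r m : ℕ} (I : Fin 3 → Finset (Fin n))
    (hI : ∀ i, (I i).card = r) (hm : ∀ i, (I i)ᶜ.card = m)
    {e : Fin 3 → Fin r → Fin r → ℂ} {ξ : Fin 3 → Fin m → Fin m → ℂ}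
    (he : ∀ i, LinearIndependent ℂ (e i))
    (hLI : LinearIndepOn ℂ (frameTensor e ξ) (diagram m fun i => level (I i) (hI i)))
    (k : Fin 3 → Matrix (Fin n) (Fin r ⊕ Fin m) ℂ) :
    ∃ ω : (Fin r → Fin r ⊕ Fin m) → ℂ, ω ≠ 0 ∧ ∀ i f,
      (∀ σ : Equiv.Perm (Fin r), ∃ a, f (σ a) < (I i).orderEmbOfFin (hI i) a) →
        (tensorPow r (k i) *ᵥ ω) f = 0 := by
  classical
  obtain ⟨k₀, hk₀⟩ := exists_open_intersection I hI hm he hLI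
  let T := {t : Fin 3 × (Fin r → Fin n) //
    ∀ σ : Equiv.Perm (Fin r), ∃ a, t.2 (σ a) < (I t.1).orderEmbOfFin (hI t.1) a}
  let w : (Fin 3 → Fin n → (Fin r ⊕ Fin m) → ℂ) → (Fin r → Fin r ⊕ Fin m) → T → ℂ :=
    fun k g t => tensorPow r (Matrix.of (k t.1.1)) t.1.2 g
  let k' : Fin 3 → Fin n → (Fin r ⊕ Fin m) → ℂ := k
  by_contra hcon
  have hk : LinearIndependent ℂ (w k') := by
    rw [Fintype.linearIndependent_iff]
    intro ω hω
    by_contra hne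
    refine hcon ⟨ω, fun h0 => hne fun g => congrFun h0 g, fun i f hf => ?_⟩
    have h1 := congrFun hω ⟨(i, f), hf⟩
    simp only [Finset.sum_apply, Pi.smul_apply, smul_eq_mul, Pi.zero_apply] at h1
    rw [← h1]
    exact Finset.sum_congr rfl fun g _ => mul_comm _ _
  have h1 := eventually_linearIndependent (fun t : ℂ => w (k₀ + t • (k' - k₀)))
    (fun g t => by
      simp only [w, tensorPow, Matrix.of_apply, Pi.add_apply, Pi.smul_apply]
      fun_prop) (t₁ := 1) (by simpa using hk) 0
  obtain ⟨t, ht1, M, c, hM, hc, hMc⟩ :=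
    (h1.and ((tendsto_line k₀ (k' - k₀)).eventually hk₀)).exists
  obtain ⟨ω, hω0, hω⟩ := exists_tensor_of_intersection
    (fun i => Matrix.of ((k₀ + t • (k' - k₀)) i))
    (fun i => (I i).orderEmbOfFin (hI i)) M c hM hc hMc
  apply hω0
  funext g
  refine Fintype.linearIndependent_iff.mp ht1 ω ?_ g
  ext x
  simp only [Finset.sum_apply, Pi.smul_apply, smul_eq_mul, Pi.zero_apply]
  rw [← hω x.1.1 x.1.2 x.2]
  exact Finset.sum_congr rfl fun g _ => mul_comm _ _

lemma tensorPow_weight {α β : Type*} [Fintype α] [DecidableEq β] {r : ℕ}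
    {k : Matrix α β ℂ} (hk : kᴴ * k = 1) (x : α → ℂ) (a : Fin r) (g h : Fin r → β) :
    ∑ f, star (tensorPow r k f g) * (x (f a) * tensorPow r k f h) =
      (kᴴ * of (fun i j => x i * k i j)) (g a) (h a) *
        ∏ b ∈ Finset.univ.erase a, (1 : Matrix β β ℂ) (g b) (h b) := by
  classical
  have h1 : ∀ f : Fin r → α, star (tensorPow r k f g) * (x (f a) * tensorPow r k f h) =
      ∏ b, star (k (f b) (g b)) * ((if b = a then x (f b) else 1) * k (f b) (h b)) := by
    intro f
    simp only [tensorPow, Finset.prod_mul_distrib, star_prod, Finset.prod_ite_eq',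
      Finset.mem_univ, if_true]
  simp only [h1]
  rw [← Fintype.prod_sum (fun b (j : α) => star (k j (g b)) *
    ((if b = a then x j else 1) * k j (h b))),
    ← Finset.mul_prod_erase _ _ (Finset.mem_univ a)]
  congr 1
  · simp [Matrix.mul_apply]
  · refine Finset.prod_congr rfl fun b hb => ?_
    rw [← hk]
    simp [Matrix.mul_apply, Finset.ne_of_mem_erase hb]

lemma tensorPow_isometry {α β : Type*} [Fintype α] [DecidableEq β] {r : ℕ}
    {k : Matrix α β ℂ} (hk : kᴴ * k = 1) (g h : Fin r → β) :
    ∑ f, star (tensorPow r k f g) * tensorPow r k f h = if g = h then 1 else 0 := by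
  classical
  have h1 : ∀ f : Fin r → α, star (tensorPow r k f g) * tensorPow r k f h =
      ∏ b, star (k (f b) (g b)) * k (f b) (h b) := by
    intro f
    simp only [tensorPow, Finset.prod_mul_distrib, star_prod]
  simp only [h1]
  rw [← Fintype.prod_sum (fun b (j : α) => star (k j (g b)) * k j (h b))]
  have h2 : ∀ b, ∑ j, star (k j (g b)) * k j (h b) = (1 : Matrix β β ℂ) (g b) (h b) := by
    intro b; rw [← hk]; simp [Matrix.mul_apply]
  simp only [h2, Matrix.one_apply]
  split_ifs with hgh
  · subst hgh; simp
  · obtain ⟨b, hb⟩ := Function.ne_iff.mp hgh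
    exact Finset.prod_eq_zero (Finset.mem_univ b) (if_neg hb)

lemma sum_mulVec_quadratic {α β : Type*} [Fintype α] [Fintype β] (K : Matrix α β ℂ) (d : α → ℂ)
    (ω : β → ℂ) :
    ∑ f, d f * ((‖(K *ᵥ ω) f‖ ^ 2 : ℝ) : ℂ) =
      ∑ g, ∑ h, star (ω g) * (∑ f, star (K f g) * (d f * K f h)) * ω h := by
  have h1 : ∀ f, d f * ((‖(K *ᵥ ω) f‖ ^ 2 : ℝ) : ℂ) =
      ∑ g, ∑ h, star (ω g) * (star (K f g) * (d f * K f h)) * ω h := by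
    intro f
    have := Complex.normSq_eq_conj_mul_self (z := (K *ᵥ ω) f)
    rw [Complex.normSq_eq_norm_sq] at this
    rw [this, ← Complex.star_def, Matrix.mulVec, dotProduct, star_sum, Finset.sum_mul_sum,
      Finset.mul_sum]
    refine Finset.sum_congr rfl fun g _ => ?_
    rw [Finset.mul_sum]
    refine Finset.sum_congr rfl fun h _ => ?_
    rw [star_mul']
    ring
  simp only [h1]
  rw [Finset.sum_comm]
  refine Finset.sum_congr rfl fun g _ => ?_
  rw [Finset.sum_comm]
  refine Finset.sum_congr rfl fun h _ => ?_
  rw [Finset.mul_sum, Finset.sum_mul]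

/-- Horn's inequalities for three Hermitian matrices with zero sum. -/
theorem horn_inequality {n r m : ℕ} (hn : r + m = n) (I : Fin 3 → Finset (Fin n))
    (hI : ∀ i, (I i).card = r)
    (hc : ScalarSum r m fun i => level (I i) (hI i))
    {U : Fin 3 → Matrix (Fin n) (Fin n) ℂ} (hU : ∀ i, (U i)ᴴ * U i = 1)
    {x : Fin 3 → Fin n → ℝ} (hx : ∀ i, Antitone (x i))
    (hsum : ∑ i, U i * diagonal (fun j => (x i j : ℂ)) * (U i)ᴴ = 0) :
    0 ≤ ∑ i, ∑ j ∈ I i, x i j := by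
  classical
  have hm : ∀ i, (I i)ᶜ.card = m := by
    intro i; rw [Finset.card_compl, hI, Fintype.card_fin]; omega
  obtain ⟨e, ξ, he, -, hLI⟩ := exists_frames_of_scalarSum
    (fun i a => (level_le (I i) (hI i) a).trans (by omega)) hc
  let φ : Fin r ⊕ Fin m ≃ Fin n := finSumFinEquiv.trans (finCongr hn)
  let k : Fin 3 → Matrix (Fin n) (Fin r ⊕ Fin m) ℂ := fun i => ((U i)ᴴ).submatrix id φ
  have hk : ∀ i, (k i)ᴴ * k i = 1 := by
    intro i
    simp only [k, Matrix.conjTranspose_submatrix, Matrix.conjTranspose_conjTranspose]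
    refine (Matrix.submatrix_mul_equiv (U i) (U i)ᴴ φ (Equiv.refl _) φ).trans ?_
    rw [mul_eq_one_comm.mp (hU i), Matrix.submatrix_one_equiv]
  have hkx : ∑ i, (k i)ᴴ * of (fun j z => (x i j : ℂ) * k i j z) = 0 := by
    have h1 : ∀ i, (k i)ᴴ * of (fun j z => (x i j : ℂ) * k i j z) =
        (U i * diagonal (fun j => (x i j : ℂ)) * (U i)ᴴ).submatrix φ φ := by
      intro i
      ext a b
      rw [Matrix.submatrix_apply, Matrix.mul_apply, Matrix.mul_apply]
      refine Finset.sum_congr rfl fun j _ => ?_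
      rw [Matrix.mul_diagonal]
      simp only [k, Matrix.submatrix_apply, Matrix.conjTranspose_apply, Matrix.of_apply,
        star_star, id_eq]
      ring
    simp only [h1]
    have := congrArg (fun A : Matrix (Fin n) (Fin n) ℂ => A.submatrix φ φ) hsum
    simp only [Matrix.submatrix_zero, Pi.zero_apply] at this
    rw [← this]
    ext a b
    simp [Matrix.sum_apply]
  obtain ⟨ω, hω0, hω⟩ := exists_tensor_of_frames I hI hm he hLI k
  let v : Fin 3 → (Fin r → Fin n) → ℝ := fun i f => ‖(tensorPow r (k i) *ᵥ ω) f‖ ^ 2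
  have hnorm : ∀ i, ∑ f, v i f = ∑ g, ‖ω g‖ ^ 2 := by
    intro i
    have h1 := sum_mulVec_quadratic (tensorPow r (k i)) (fun _ => 1) ω
    simp only [one_mul, tensorPow_isometry (hk i), mul_ite, mul_one, mul_zero, ite_mul, zero_mul,
      Finset.sum_ite_eq, Finset.mem_univ, if_true] at h1
    have h2 : ∀ g, star (ω g) * ω g = ((‖ω g‖ ^ 2 : ℝ) : ℂ) := by
      intro g
      have := Complex.normSq_eq_conj_mul_self (z := ω g)
      rw [Complex.normSq_eq_norm_sq] at this
      rw [this]; rfl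
    simp only [h2] at h1
    exact_mod_cast h1
  have hpos : 0 < ∑ g, ‖ω g‖ ^ 2 := by
    obtain ⟨g, hg⟩ := Function.ne_iff.mp hω0
    refine Finset.sum_pos' (fun _ _ => by positivity) ⟨g, Finset.mem_univ _, ?_⟩
    have : 0 < ‖ω g‖ := norm_pos_iff.mpr hg
    positivity
  have hzero : ∑ i, ∑ f, (∑ a, x i (f a)) * v i f = 0 := by
    have h1 : ∑ i, ∑ f, (∑ a, (x i (f a) : ℂ)) * (v i f : ℂ) = 0 := by
      have h2 : ∀ i, ∑ f, (∑ a, (x i (f a) : ℂ)) * (v i f : ℂ) = ∑ a, ∑ g, ∑ h, star (ω g) *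
          (((k i)ᴴ * of (fun j z => (x i j : ℂ) * k i j z)) (g a) (h a) *
        ∏ b ∈ Finset.univ.erase a, (1 : Matrix _ _ ℂ) (g b) (h b)) * ω h := by
        intro i
        simp only [Finset.sum_mul]
        rw [Finset.sum_comm]
        refine Finset.sum_congr rfl fun a _ => ?_
        rw [sum_mulVec_quadratic (tensorPow r (k i)) (fun f => (x i (f a) : ℂ)) ω]
        refine Finset.sum_congr rfl fun g _ => Finset.sum_congr rfl fun h _ => ?_
        rw [tensorPow_weight (hk i) (fun j => (x i j : ℂ))]
      simp only [h2]
      rw [Finset.sum_comm]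
      refine Finset.sum_eq_zero fun a _ => ?_
      rw [Finset.sum_comm]
      refine Finset.sum_eq_zero fun g _ => ?_
      rw [Finset.sum_comm]
      refine Finset.sum_eq_zero fun h _ => ?_
      rw [← Finset.sum_mul, ← Finset.mul_sum, ← Finset.sum_mul, ← Matrix.sum_apply, hkx]
      simp
    exact_mod_cast h1
  have hle : ∀ i f, (∑ a, x i (f a)) * v i f ≤ (∑ j ∈ I i, x i j) * v i f := by
    intro i f
    by_cases hf : ∀ σ : Equiv.Perm (Fin r), ∃ a, f (σ a) < (I i).orderEmbOfFin (hI i) a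
    · have : v i f = 0 := by simp only [v]; rw [hω i f hf]; simp
      rw [this]; simp
    · push Not at hf
      obtain ⟨σ, hσ⟩ := hf
      refine mul_le_mul_of_nonneg_right ?_ (by positivity)
      have h1 : ∑ j ∈ I i, x i j = ∑ a, x i ((I i).orderEmbOfFin (hI i) a) := by
        rw [← Finset.sum_image (f := x i) (fun a _ b _ h =>
          ((I i).orderEmbOfFin (hI i)).injective h)]
        congr 1
        ext j
        have := Finset.range_orderEmbOfFin (I i) (hI i)
        rw [Set.ext_iff] at this
        simp
      rw [h1, ← Equiv.sum_comp σ]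
      exact Finset.sum_le_sum fun a _ => hx i (hσ a)
  have hfin : 0 ≤ (∑ i, ∑ j ∈ I i, x i j) * ∑ g, ‖ω g‖ ^ 2 := by
    rw [← hzero, Finset.sum_mul]
    refine Finset.sum_le_sum fun i _ => ?_
    rw [← hnorm i, Finset.mul_sum]
    exact Finset.sum_le_sum fun f _ => hle i f
  exact nonneg_of_mul_nonneg_left hfin hpos

lemma eigVec_conj {k : ℕ} {X V : Matrix (Fin k) (Fin k) ℂ} (hX : X.IsHermitian) (hV : Vᴴ * V = 1)
    (h : (V * X * Vᴴ).IsHermitian) : eigVec (V * X * Vᴴ) h = eigVec X hX := by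
  obtain ⟨U, hU, hUX⟩ := exists_unitary_eigVec X hX
  refine eigVec_unique (U := V * U) h (eigVec_antitone X hX) ?_ ?_
  · rw [conjTranspose_mul, Matrix.mul_assoc, ← Matrix.mul_assoc Vᴴ, hV, Matrix.one_mul, hU]
  · conv_lhs => rw [hUX]
    simp only [conjTranspose_mul, Matrix.mul_assoc]

lemma starVec_antitone {k : ℕ} {x : Fin k → ℝ} (hx : Antitone x) : Antitone (starVec x) :=
  fun _ _ hij => neg_le_neg (hx (Fin.rev_le_rev.mpr hij))

lemma eigVec_neg {k : ℕ} {X : Matrix (Fin k) (Fin k) ℂ} (hX : X.IsHermitian)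
    (h : (-X).IsHermitian) : eigVec (-X) h = starVec (eigVec X hX) := by
  obtain ⟨U, hU, hUX⟩ := exists_unitary_eigVec X hX
  refine eigVec_unique (U := U.submatrix id Fin.rev) h
    (starVec_antitone (eigVec_antitone X hX)) (unitary_rev hU) ?_
  have h1 := conj_diagonal_rev U (fun i => -(eigVec X hX i : ℂ))
  simp only [starVec, Complex.ofReal_neg]
  refine Eq.trans ?_ h1.symm
  conv_lhs => rw [hUX]
  have : diagonal (fun i => -(eigVec X hX i : ℂ)) = -diagonal (fun i => (eigVec X hX i : ℂ)) := by
    rw [Matrix.diagonal_neg]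
  rw [this, Matrix.mul_neg, Matrix.neg_mul]

lemma eigVec_smul {k : ℕ} {X : Matrix (Fin k) (Fin k) ℂ} (hX : X.IsHermitian) {c : ℝ}
    (hc : 0 ≤ c) (h : ((c : ℂ) • X).IsHermitian) (i : Fin k) :
    eigVec ((c : ℂ) • X) h i = c * eigVec X hX i := by
  obtain ⟨U, hU, hUX⟩ := exists_unitary_eigVec X hX
  refine congrFun (eigVec_unique (d := fun i => c * eigVec X hX i) h
    (fun a b hab => mul_le_mul_of_nonneg_left (eigVec_antitone X hX hab) hc) hU ?_) i
  conv_lhs => rw [hUX]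
  have : diagonal (fun i => ((c * eigVec X hX i : ℝ) : ℂ)) =
      (c : ℂ) • diagonal (fun i => (eigVec X hX i : ℂ)) := by
    rw [← Matrix.diagonal_smul]; congr 1; ext; simp
  rw [this, Matrix.mul_smul, Matrix.smul_mul]

lemma hatPQ_eq {p q : ℕ} (hpq : q ≤ p) (s : Fin q → ℝ) (i : Fin (p + q)) :
    hatPQ p q s i = (if h : (i : ℕ) < q then s ⟨i, h⟩ else 0) -
      (if h : (i.rev : ℕ) < q then s ⟨i.rev, h⟩ else 0) := by
  have := i.isLt
  unfold hatPQ
  simp only [Fin.val_rev]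
  split_ifs with h1 h2 h3 h4 h5 <;> first | omega | simp
  exact congrArg s (Fin.ext (by simp only; omega))

lemma starVec_hatPQ {p q : ℕ} (hpq : q ≤ p) (s : Fin q → ℝ) :
    starVec (hatPQ p q s) = hatPQ p q s := by
  ext i
  rw [starVec, hatPQ_eq hpq, hatPQ_eq hpq, Fin.rev_rev]
  ring

lemma sum_opp {n : ℕ} (K : Finset (Fin n)) (f : Fin n → ℝ) :
    ∑ i ∈ opp K, f i = ∑ i ∈ K, f i.rev := by
  unfold opp
  rw [Finset.sum_image fun _ _ _ _ h => Fin.rev_injective h]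

lemma sum_hatPQ {p q : ℕ} (hpq : q ≤ p) (s : Fin q → ℝ) (K : Finset (Fin (p + q))) :
    ∑ i ∈ K, hatPQ p q s i = sumRestr s K - sumRestr s (opp K) := by
  unfold sumRestr
  rw [sum_opp, ← Finset.sum_sub_distrib]
  exact Finset.sum_congr rfl fun i _ => hatPQ_eq hpq s i

lemma inequality_iff {p q : ℕ} (hpq : q ≤ p) (lam : Fin (p + q) → ℝ) (s : Fin q → ℝ)
    (I J K : Finset (Fin (p + q))) :
    ((∑ i ∈ I, lam i) - (∑ i ∈ opp J, lam i) ≥ 2 * sumRestr s K - 2 * sumRestr s (opp K)) ↔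
      0 ≤ ∑ i ∈ I, lam i + ∑ i ∈ J, starVec lam i + ∑ i ∈ opp K, 2 * hatPQ p q s i := by
  rw [← Finset.mul_sum, sum_hatPQ hpq, opp_opp, sum_opp]
  simp only [starVec, Finset.sum_neg_distrib]
  constructor <;> intro h <;> linarith

/-- The signature matrix `diag(1, …, 1, -1, …, -1)`. -/
def signM (p q : ℕ) : Matrix (Fin (p + q)) (Fin (p + q)) ℂ :=
  diagonal fun i => if (i : ℕ) < p then 1 else -1

lemma signM_conjTranspose (p q : ℕ) : (signM p q)ᴴ = signM p q := by
  unfold signM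
  rw [diagonal_conjTranspose]
  congr 1; ext i
  simp only [Pi.star_apply]
  split_ifs <;> simp

lemma signM_mul_self (p q : ℕ) : signM p q * signM p q = 1 := by
  unfold signM
  rw [diagonal_mul_diagonal, ← diagonal_one]
  congr 1; ext i
  split_ifs <;> simp

lemma sub_signM_conj (p q : ℕ) {X : Matrix (Fin (p + q)) (Fin (p + q)) ℂ} (hX : X.IsHermitian) :
    X - signM p q * X * signM p q = (2 : ℂ) • hatM p q (blockTR p q X) := by
  ext i j
  have hij := hX.apply i j
  simp only [signM, Matrix.sub_apply, Matrix.mul_diagonal, Matrix.diagonal_mul,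
    Matrix.smul_apply, smul_eq_mul]
  refine Fin.addCases (fun i => ?_) (fun i => ?_) i <;>
    refine Fin.addCases (fun j => ?_) (fun j => ?_) j
  · simp [hatM]
  · simp [hatM, blockTR]; ring
  · have := hX.apply (Fin.natAdd p i) (Fin.castAdd q j)
    simp only [hatM, blockTR, reindex_apply, submatrix_apply, finSumFinEquiv_symm_apply_natAdd,
      finSumFinEquiv_symm_apply_castAdd, fromBlocks_apply₂₁, conjTranspose_apply, this]
    simp; ring
  · simp [hatM]

lemma scalarSum_of_mem_Horn {n r : ℕ} (I J K : Finset (Fin n)) (hI : I.card = r)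
    (hJ : J.card = r) (hK : (opp K).card = r) (L : Fin 3 → Finset (Fin n))
    (hL : L = ![I, J, opp K]) (hc : ∀ i, (L i).card = r) :
    (fun i => level (L i) (hc i)) = ![level I hI, level J hJ, level (opp K) hK] := by
  subst hL
  ext i
  fin_cases i <;> rfl

theorem inequality_of_mem_coneA {p q : ℕ} (hpq : q ≤ p) {lam : Fin (p + q) → ℝ} {s : Fin q → ℝ}
    (h : (lam, s) ∈ coneA p q) {r : ℕ} (hr : r ≤ p + q) (I J K : Finset (Fin (p + q)))
    (hI : I.card = r) (hJ : J.card = r) (hK : K.card = r)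
    (hH : (muVec I hI, muVec J hJ, muVec K hK) ∈ Horn r) :
    (∑ i ∈ I, lam i) - (∑ i ∈ opp J, lam i) ≥ 2 * sumRestr s K - 2 * sumRestr s (opp K) := by
  obtain ⟨X, hX, h1, h2⟩ := h
  simp only at h1 h2
  obtain rfl : s = fun i : Fin q => sval (blockTR p q X) i := funext h2
  subst h1
  rw [inequality_iff hpq]
  rw [mem_Horn_iff_scalarSum] at hH
  have hZ := hatM_isHermitian p q (blockTR p q X)
  have hgX : (signM p q * X * (signM p q)ᴴ).IsHermitian :=
    isHermitian_mul_mul_conjTranspose _ hX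
  have h2Z : (((2 : ℝ) : ℂ) • hatM p q (blockTR p q X)).IsHermitian :=
    by rw [IsHermitian, conjTranspose_smul, hZ.eq, Complex.star_def, Complex.conj_ofReal]
  have hg : (signM p q)ᴴ * signM p q = 1 := by rw [signM_conjTranspose, signM_mul_self]
  obtain ⟨U₁, hU₁, hX₁⟩ := exists_unitary_eigVec X hX
  obtain ⟨U₂, hU₂, hX₂⟩ := exists_unitary_eigVec _ hgX.neg
  obtain ⟨U₃, hU₃, hX₃⟩ := exists_unitary_eigVec _ h2Z.neg
  rw [eigVec_neg hgX, eigVec_conj hX hg] at hX₂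
  have h3 : eigVec _ h2Z.neg = fun i => 2 * hatPQ p q (fun i : Fin q => sval (blockTR p q X) i) i := by
    rw [eigVec_neg h2Z]
    have : eigVec _ h2Z = fun i => 2 * hatPQ p q (fun i : Fin q => sval (blockTR p q X) i) i := by
      ext i
      rw [eigVec_smul hZ (by norm_num), eigVec_hatM hpq]
    rw [this]
    conv_rhs => rw [← starVec_hatPQ hpq]
    ext i; simp [starVec]
  rw [h3] at hX₃
  have hL : ∀ i, ((![I, J, opp K] : Fin 3 → Finset (Fin (p + q))) i).card = r := by
    intro i; fin_cases i
    exacts [hI, hJ, (opp_card K).trans hK]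
  have := horn_inequality (n := p + q) (m := p + q - r) (by omega) ![I, J, opp K] hL
    (by rw [scalarSum_of_mem_Horn I J K hI hJ ((opp_card K).trans hK) _ rfl]; exact hH)
    (U := ![U₁, U₂, U₃]) (by intro i; fin_cases i; exacts [hU₁, hU₂, hU₃])
    (x := ![eigVec X hX, starVec (eigVec X hX),
      fun i => 2 * hatPQ p q (fun i : Fin q => sval (blockTR p q X) i) i])
    (by
      intro i; fin_cases i
      · exact eigVec_antitone X hX
      · exact starVec_antitone (eigVec_antitone X hX)
      · intro a b hab
        have h4 := eigVec_antitone _ h2Z.neg hab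
        rw [h3] at h4; exact h4)
    (by
      simp only [Fin.sum_univ_three]
      change U₁ * _ * U₁ᴴ + U₂ * _ * U₂ᴴ + U₃ * _ * U₃ᴴ = 0
      simp only [Matrix.cons_val_zero, Matrix.cons_val_one, Matrix.cons_val]
      rw [← hX₁, ← hX₂, ← hX₃, signM_conjTranspose]
      have := sub_signM_conj p q hX
      rw [← sub_eq_add_neg, ← sub_eq_add_neg, this]
      simp)
  simpa [Fin.sum_univ_three] using this

lemma isCompact_unitary_family (ι : Type*) [Finite ι] (k : ℕ) :
    IsCompact {E : ι → Matrix (Fin k) (Fin k) ℂ | ∀ i, (E i)ᴴ * E i = 1} := by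
  have hK : IsCompact (Set.pi Set.univ fun _ : ι => (Set.pi Set.univ fun _ : Fin k =>
      Set.pi Set.univ fun _ : Fin k => Metric.closedBall (0 : ℂ) 1 : Set (Matrix _ _ ℂ))) :=
    isCompact_univ_pi fun _ => isCompact_univ_pi fun _ => isCompact_univ_pi fun _ =>
      isCompact_closedBall _ _
  refine hK.of_isClosed_subset ?_ ?_
  · have : {E : ι → Matrix (Fin k) (Fin k) ℂ | ∀ i, (E i)ᴴ * E i = 1} =
        ⋂ i, {E | (E i)ᴴ * E i = 1} := by
      ext E; simp
    rw [this]
    refine isClosed_iInter fun i => isClosed_eq ?_ continuous_const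
    exact (Continuous.matrix_conjTranspose (continuous_apply i)).matrix_mul (continuous_apply i)
  · intro (E : ι → Matrix (Fin k) (Fin k) ℂ) (hE : ∀ i, (E i)ᴴ * E i = 1) i _ a _ b _
    change E i a b ∈ Metric.closedBall (0 : ℂ) 1
    have h1 := congrFun (congrFun (hE i) b) b
    rw [Matrix.mul_apply] at h1
    have h2 : ∑ x, ‖E i x b‖ ^ 2 = 1 := by
      have h3 := congrArg Complex.re h1
      rw [Complex.re_sum] at h3
      simp only [Matrix.one_apply_eq, Complex.one_re] at h3
      rw [← h3]
      refine Finset.sum_congr rfl fun x _ => ?_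
      rw [conjTranspose_apply, Complex.star_def, ← Complex.normSq_eq_conj_mul_self,
        Complex.normSq_eq_norm_sq, Complex.ofReal_re]
    have h3 : ‖E i a b‖ ^ 2 ≤ 1 := by
      rw [← h2]
      exact Finset.single_le_sum (f := fun x => ‖E i x b‖ ^ 2) (fun _ _ => by positivity)
        (Finset.mem_univ a)
    rw [mem_closedBall_zero_iff]
    nlinarith [norm_nonneg (E i a b)]

/-- The one-parameter group of unitary matrices generated by a skew-Hermitian matrix. -/
lemma exists_unitary_curve {k : ℕ} {S : Matrix (Fin k) (Fin k) ℂ} (hS : Sᴴ = -S) :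
    ∃ U : ℝ → Matrix (Fin k) (Fin k) ℂ, U 0 = 1 ∧ (∀ t, (U t)ᴴ * U t = 1) ∧
      ∀ t i j, HasDerivAt (fun t => U t i j) ((S * U t) i j) t := by
  refine ⟨fun t => NormedSpace.exp (t • S), by simp, fun t => ?_, fun t i j => ?_⟩
  · rw [← Matrix.exp_conjTranspose, conjTranspose_smul, hS, ← Matrix.exp_add_of_commute]
    · simp
    · simp
  · let _ : NormedRing (Matrix (Fin k) (Fin k) ℂ) := Matrix.linftyOpNormedRing
    let _ : NormedAlgebra ℝ (Matrix (Fin k) (Fin k) ℂ) := Matrix.linftyOpNormedAlgebra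
    have h := hasDerivAt_exp_smul_const' (𝕂 := ℝ) S t
    exact ((Matrix.entryLinearMap ℝ ℂ i j).toContinuousLinearMap.hasFDerivAt.comp_hasDerivAt t h)

lemma hasDerivAt_det_of_eq_one {N : Type*} [Fintype N] [DecidableEq N] {M : ℝ → Matrix N N ℂ}
    {M' : Matrix N N ℂ} {t₀ : ℝ} (h : ∀ i j, HasDerivAt (fun t => M t i j) (M' i j) t₀)
    (h0 : M t₀ = 1) : HasDerivAt (fun t => (M t).det) M'.trace t₀ := by
  simp only [det_apply]
  have h1 : ∀ σ : Equiv.Perm N, HasDerivAt (fun t => Equiv.Perm.sign σ • ∏ i, M t (σ i) i)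
      (Equiv.Perm.sign σ • ∑ i, (∏ j ∈ Finset.univ.erase i, M t₀ (σ j) j) • M' (σ i) i) t₀ := by
    intro σ
    have h2 := HasDerivAt.fun_finsetProd (u := Finset.univ)
      (f := fun i t => M t (σ i) i) (f' := fun i => M' (σ i) i) (x := t₀) (fun i _ => h (σ i) i)
    rcases Int.units_eq_one_or (Equiv.Perm.sign σ) with hs | hs
    · rw [hs]; simpa using h2
    · rw [hs]; simpa using h2.fun_neg
  have h3 := HasDerivAt.fun_sum (u := Finset.univ) fun σ _ => h1 σ
  refine h3.congr_deriv ?_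
  rw [Finset.sum_eq_single 1]
  · rw [h0, Matrix.trace]
    simp only [Equiv.Perm.sign_one, one_smul, smul_eq_mul]
    refine Finset.sum_congr rfl fun i _ => ?_
    have h4 : ∏ j ∈ Finset.univ.erase i, (1 : Matrix N N ℂ) ((1 : Equiv.Perm N) j) j = 1 :=
      Finset.prod_eq_one fun j _ => Matrix.one_apply_eq j
    exact (congrArg (fun z => z * M' i i) h4).trans (one_mul _)
  · intro σ _ hσ
    rw [Finset.sum_eq_zero, smul_zero]
    intro i _
    obtain ⟨j, hj⟩ : ∃ j, j ≠ i ∧ σ j ≠ j := by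
      by_contra! hcon
      refine hσ (Equiv.ext fun x => ?_)
      by_cases hx : x = i
      · subst hx
        by_contra hne
        have := hcon (σ x) hne
        exact hne (σ.injective this)
      · exact hcon x hx
    rw [Finset.prod_eq_zero (i := j), zero_smul]
    · simp [hj.1]
    · rw [h0, Matrix.one_apply_ne hj.2]
  · simp

lemma re_trace_eq_zero_of_norm_det_le_one {N : Type*} [Fintype N] [DecidableEq N]
    {M : ℝ → Matrix N N ℂ} {M' : Matrix N N ℂ} {t₀ : ℝ}
    (h : ∀ i j, HasDerivAt (fun t => M t i j) (M' i j) t₀) (h0 : M t₀ = 1)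
    (hle : ∀ t, ‖(M t).det‖ ≤ 1) : M'.trace.re = 0 := by
  have h1 := hasDerivAt_det_of_eq_one h h0
  have h2 : HasDerivAt (fun t => (M t).det.re) M'.trace.re t₀ :=
    (Complex.reCLM.hasFDerivAt.comp_hasDerivAt t₀ h1)
  refine IsLocalMax.hasDerivAt_eq_zero (f := fun t => (M t).det.re) ?_ h2
  refine Filter.Eventually.of_forall fun t => ?_
  simp only [h0, det_one, Complex.one_re]
  exact (Complex.re_le_norm _).trans (hle t)

open scoped ComplexOrder in
lemma isHermitian_of_re_trace_mul_eq_zero {k : ℕ} {T : Matrix (Fin k) (Fin k) ℂ}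
    (h : ∀ S : Matrix (Fin k) (Fin k) ℂ, Sᴴ = -S → (S * T).trace.re = 0) : T.IsHermitian := by
  have h1 := h (T - Tᴴ) (by rw [conjTranspose_sub, conjTranspose_conjTranspose, neg_sub])
  have h2 : ((T - Tᴴ) * (T - Tᴴ)ᴴ).trace.re = 0 := by
    have h3 : ((T - Tᴴ) * Tᴴ).trace = -star ((T - Tᴴ) * T).trace := by
      rw [← trace_conjTranspose, conjTranspose_mul, conjTranspose_sub, conjTranspose_conjTranspose,
        ← trace_neg, ← Matrix.mul_neg, neg_sub, trace_mul_comm]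
    rw [conjTranspose_sub, conjTranspose_conjTranspose, Matrix.mul_sub, trace_sub, Complex.sub_re,
      h3, Complex.neg_re, Complex.star_def, Complex.conj_re, h1]
    simp
  have h4 : ((T - Tᴴ) * (T - Tᴴ)ᴴ).trace = 0 := by
    have h5 := (Matrix.posSemidef_self_mul_conjTranspose (T - Tᴴ)).trace_nonneg
    rw [Complex.nonneg_iff] at h5
    exact Complex.ext h2 h5.2.symm
  rw [Matrix.trace_mul_conjTranspose_self_eq_zero_iff, sub_eq_zero] at h4
  exact h4.symm

lemma card_diagram_fibre {k m : ℕ} (c : Fin 3 → Fin k → ℕ) (hcm : ∀ i a, c i a ≤ m)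
    [Fintype (diagram m c)] (i : Fin 3) (a : Fin k) :
    (Finset.univ.filter fun t : diagram m c => t.1.1 = i ∧ t.1.2.1 = a).card = c i a := by
  have h : (Finset.univ.filter fun t : diagram m c => t.1.1 = i ∧ t.1.2.1 = a).card =
      (Finset.univ : Finset (Fin (c i a))).card := by
    symm
    refine Finset.card_bij (fun j _ => ⟨(i, a, ⟨j, j.2.trans_le (hcm i a)⟩), j.2⟩) ?_ ?_ ?_
    · intro j _; simp
    · intro j _ j' _ h
      have h1 : (j : ℕ) = j' := congrArg (fun t : diagram m c => (t.1.2.2 : ℕ)) h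
      exact Fin.ext h1
    · rintro ⟨⟨i', a', j⟩, ht⟩ h
      simp only [Finset.mem_filter, Finset.mem_univ, true_and] at h
      obtain ⟨rfl, rfl⟩ := h
      exact ⟨⟨j, ht⟩, Finset.mem_univ _, rfl⟩
  rw [h]; simp

theorem scalarSum_of_linearIndepOn {k m : ℕ} {c : Fin 3 → Fin k → ℕ} (hcm : ∀ i a, c i a ≤ m)
    {E₀ : Fin 3 → Matrix (Fin k) (Fin k) ℂ} (hE₀ : ∀ i, (E₀ i)ᴴ * E₀ i = 1)
    {ξ : Fin 3 → Fin m → Fin m → ℂ}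
    (hli : LinearIndepOn ℂ (frameTensor (fun i a x => E₀ i x a) ξ) (diagram m c))
    (hcard : Nat.card (diagram m c) = k * m) : ScalarSum k m c := by
  classical
  let Δ := diagram m c
  let ft : (Fin 3 → Matrix (Fin k) (Fin k) ℂ) → Fin 3 × Fin k × Fin m → Fin k × Fin m → ℂ :=
    fun E t z => E t.1 z.1 t.2.1 * ξ t.1 t.2.2 z.2
  obtain ⟨σ⟩ : Nonempty (Fin k × Fin m ≃ Δ) := by
    refine Fintype.card_eq.mp ?_
    rw [Nat.card_eq_fintype_card] at hcard
    rw [hcard]; simp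
  let M : (Fin 3 → Matrix (Fin k) (Fin k) ℂ) → Matrix (Fin k × Fin m) (Fin k × Fin m) ℂ :=
    fun E z τ => ft E (σ τ) z
  have hMc : Continuous fun E => ‖(M E).det‖ := by
    refine (Continuous.matrix_det ?_).norm
    refine continuous_pi fun z => continuous_pi fun τ => ?_
    simp only [M, ft]
    have : Continuous fun E : Fin 3 → Matrix (Fin k) (Fin k) ℂ => E (σ τ).1.1 z.1 (σ τ).1.2.1 :=
      (continuous_apply _).matrix_elem _ _
    exact this.mul continuous_const
  obtain ⟨E, hE, hmax⟩ := (isCompact_unitary_family (Fin 3) k).exists_isMaxOn ⟨E₀, hE₀⟩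
    hMc.continuousOn
  have hdet0 : (M E₀).det ≠ 0 := by
    have : IsUnit (M E₀) := by
      rw [← Matrix.linearIndependent_cols_iff_isUnit]
      exact (hli.linearIndependent).comp σ σ.injective
    exact (isUnit_iff_ne_zero.mp ((Matrix.isUnit_iff_isUnit_det _).mp this))
  have hdet : (M E).det ≠ 0 := by
    have := hmax hE₀
    have h1 : 0 < ‖(M E₀).det‖ := norm_pos_iff.mpr hdet0
    exact norm_pos_iff.mp (h1.trans_le this)
  set G := (M E)⁻¹ with hG
  have hGM : G * M E = 1 := nonsing_inv_mul _ (isUnit_iff_ne_zero.mpr hdet)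
  have hMG : M E * G = 1 := mul_nonsing_inv _ (isUnit_iff_ne_zero.mpr hdet)
  -- partial traces
  let T : Fin 3 → Matrix (Fin k) (Fin k) ℂ := fun i w v =>
    ∑ τ, ∑ y, G τ (v, y) * if (σ τ).1.1 = i then ft E (σ τ) (w, y) else 0
  have hT : ∀ i, (T i).IsHermitian := by
    intro i
    refine isHermitian_of_re_trace_mul_eq_zero fun S hS => ?_
    obtain ⟨U, hU0, hU1, hU⟩ := exists_unitary_curve hS
    let N : Matrix (Fin k × Fin m) (Fin k × Fin m) ℂ := fun z τ =>
      if (σ τ).1.1 = i then ∑ w, S z.1 w * ft E (σ τ) (w, z.2) else 0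
    have htr : (S * T i).trace = (G * N).trace := by
      have h1 : (S * T i).trace = ∑ v, ∑ w, S v w * T i w v := rfl
      have h2 : (G * N).trace = ∑ τ, ∑ z, G τ z * N z τ := rfl
      rw [h1, h2]
      simp only [T, N, Fintype.sum_prod_type (f := fun z => G _ z * _)]
      rw [Finset.sum_comm (s := (Finset.univ : Finset (Fin k × Fin m)))]
      refine Finset.sum_congr rfl fun v _ => ?_
      simp only [Finset.mul_sum]
      rw [Finset.sum_comm]
      refine Finset.sum_congr rfl fun τ _ => ?_
      rw [Finset.sum_comm]
      refine Finset.sum_congr rfl fun y _ => ?_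
      split_ifs with hi
      · rw [Finset.mul_sum]
        exact Finset.sum_congr rfl fun w _ => by ring
      · simp
    rw [htr]
    refine re_trace_eq_zero_of_norm_det_le_one
      (M := fun t => G * M (Function.update E i (U t * E i))) (t₀ := 0) (fun a b => ?_) ?_ ?_
    · simp only [Matrix.mul_apply]
      refine HasDerivAt.fun_sum fun z _ => HasDerivAt.const_mul _ ?_
      simp only [M, N, ft]
      split_ifs with hi
      · rw [hi]
        simp only [Function.update_self, Matrix.mul_apply]
        simp only [← mul_assoc, ← Finset.sum_mul]
        refine HasDerivAt.mul_const (HasDerivAt.fun_sum fun w _ => HasDerivAt.mul_const ?_ _) _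
        simpa [hU0] using hU 0 z.1 w
      · simp only [Function.update_of_ne hi]
        exact hasDerivAt_const _ _
    · simp [hU0, hGM]
    · intro t
      have h1 : ∀ j, (Function.update E i (U t * E i) j)ᴴ * Function.update E i (U t * E i) j
          = 1 := by
        intro j
        by_cases hj : j = i
        · subst hj
          rw [Function.update_self, conjTranspose_mul, Matrix.mul_assoc, ← Matrix.mul_assoc (U t)ᴴ,
            hU1, Matrix.one_mul, hE]
        · rw [Function.update_of_ne hj, hE]
      have h2 := hmax h1
      have h3 : ‖G.det‖ * ‖(M E).det‖ = 1 := by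
        rw [← norm_mul, ← det_mul, hGM]; simp
      rw [det_mul, norm_mul, ← h3]
      exact mul_le_mul_of_nonneg_left h2 (norm_nonneg _)
  have hsum : ∑ i, T i = (m : ℂ) • (1 : Matrix (Fin k) (Fin k) ℂ) := by
    ext w v
    rw [Matrix.sum_apply]
    have h1 : ∑ i, T i w v = ∑ y, (M E * G) (w, y) (v, y) := by
      simp only [T, Matrix.mul_apply]
      rw [Finset.sum_comm, Finset.sum_comm (s := (Finset.univ : Finset (Fin m)))]
      refine Finset.sum_congr rfl fun τ _ => ?_
      rw [Finset.sum_comm]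
      refine Finset.sum_congr rfl fun y _ => ?_
      rw [← Finset.mul_sum, Finset.sum_ite_eq]
      simp [M, mul_comm]
    rw [h1, hMG]
    simp [Matrix.one_apply, Prod.ext_iff]
  have hG1 : ∀ (t : Fin 3 × Fin k × Fin m), t ∈ Δ → ∀ τ, ∑ z, G τ z * ft E t z =
      if (σ τ).1 = t then 1 else 0 := by
    intro t ht τ
    have h1 := congrFun (congrFun hGM τ) (σ.symm ⟨t, ht⟩)
    rw [Matrix.mul_apply] at h1
    simp only [M, Equiv.apply_symm_apply] at h1
    rw [h1, Matrix.one_apply]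
    refine if_congr ?_ rfl rfl
    rw [Equiv.eq_symm_apply, Subtype.ext_iff]
  have hentry : ∀ i a b, ((E i)ᴴ * T i * E i) a b = ∑ τ,
      if (σ τ).1.1 = i ∧ (σ τ).1.2.1 = a then ∑ z, G τ z * ft E (i, b, (σ τ).1.2.2) z else 0 := by
    intro i a b
    have h1 : ∀ a', ∑ w, star (E i w a) * E i w a' = if a' = a then 1 else 0 := by
      intro a'
      have h2 := congrFun (congrFun (hE i) a) a'
      rw [Matrix.mul_apply, Matrix.one_apply] at h2
      simp only [conjTranspose_apply] at h2
      rw [h2]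
      exact if_congr eq_comm rfl rfl
    have h2 : ∀ v, ((E i)ᴴ * T i) a v = ∑ τ, ∑ y, G τ (v, y) *
        if (σ τ).1.1 = i ∧ (σ τ).1.2.1 = a then ξ (σ τ).1.1 (σ τ).1.2.2 y else 0 := by
      intro v
      have h3 : ((E i)ᴴ * T i) a v = ∑ w, star (E i w a) * T i w v := rfl
      rw [h3]
      simp only [T, Finset.mul_sum]
      rw [Finset.sum_comm]
      refine Finset.sum_congr rfl fun τ _ => ?_
      rw [Finset.sum_comm]
      refine Finset.sum_congr rfl fun y _ => ?_
      by_cases hi : (σ τ).1.1 = i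
      · have h3 := h1 (σ τ).1.2.1
        simp only [hi, if_true, true_and, ft]
        calc ∑ w, star (E i w a) * (G τ (v, y) * (E i w (σ τ).1.2.1 * ξ i (σ τ).1.2.2 y)) =
              G τ (v, y) * ((∑ w, star (E i w a) * E i w (σ τ).1.2.1) * ξ i (σ τ).1.2.2 y) := by
              rw [Finset.sum_mul, Finset.mul_sum]
              exact Finset.sum_congr rfl fun w _ => by ring
          _ = _ := by rw [h3]; split_ifs <;> simp
      · simp [hi]
    rw [Matrix.mul_apply]
    simp only [h2, Finset.sum_mul]
    rw [Finset.sum_comm]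
    refine Finset.sum_congr rfl fun τ _ => ?_
    split_ifs with hi
    · rw [Fintype.sum_prod_type]
      refine Finset.sum_congr rfl fun v _ => Finset.sum_congr rfl fun y _ => ?_
      simp only [ft, hi.1]
      ring
    · simp
  have hgood : ∀ i a b, c i a ≤ c i b → ((E i)ᴴ * T i * E i) a b =
      diagonal (fun a => (c i a : ℂ)) a b := by
    intro i a b hab
    rw [hentry]
    have h1 : ∀ τ, (if (σ τ).1.1 = i ∧ (σ τ).1.2.1 = a then
        ∑ z, G τ z * ft E (i, b, (σ τ).1.2.2) z else 0) =
        if a = b then (if (σ τ).1.1 = i ∧ (σ τ).1.2.1 = a then (1 : ℂ) else 0) else 0 := by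
      intro τ
      split_ifs with h2 h3 h3
      · have hm : (i, b, (σ τ).1.2.2) ∈ Δ := by
          have h5 : ((σ τ).1.2.2 : ℕ) < c (σ τ).1.1 (σ τ).1.2.1 := (σ τ).2
          rw [h2.1, h2.2] at h5
          exact h5.trans_le hab
        rw [hG1 _ hm, if_pos]
        ext1
        · exact h2.1
        · ext1
          · rw [h2.2, h3]
          · rfl
      · have hm : (i, b, (σ τ).1.2.2) ∈ Δ := by
          have h5 : ((σ τ).1.2.2 : ℕ) < c (σ τ).1.1 (σ τ).1.2.1 := (σ τ).2
          rw [h2.1, h2.2] at h5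
          exact h5.trans_le hab
        rw [hG1 _ hm, if_neg]
        intro h4
        exact h3 (h2.2.symm.trans (congrArg (fun t => t.2.1) h4))
      · rfl
      · rfl
    simp only [h1]
    by_cases h : a = b
    · subst h
      simp only [if_true, diagonal_apply_eq]
      rw [Equiv.sum_comp σ (fun t : Δ => if t.1.1 = i ∧ t.1.2.1 = a then (1 : ℂ) else 0),
        Finset.sum_boole, card_diagram_fibre c hcm]
    · simp [h]
  have hdiag : ∀ i, (E i)ᴴ * T i * E i = diagonal (fun a => (c i a : ℂ)) := by
    intro i
    ext a b
    rcases le_total (c i a) (c i b) with h | h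
    · exact hgood i a b h
    · have h1 := hgood i b a h
      have h2 : ((E i)ᴴ * T i * E i).IsHermitian := isHermitian_conjTranspose_mul_mul _ (hT i)
      rw [← h2.apply, h1]
      by_cases hab : a = b
      · subst hab; simp
      · rw [diagonal_apply_ne _ (Ne.symm hab), diagonal_apply_ne _ hab, star_zero]
  refine ⟨E, hE, ?_⟩
  rw [← hsum]
  refine Finset.sum_congr rfl fun i _ => ?_
  have h1 : E i * (E i)ᴴ = 1 := mul_eq_one_comm.mp (hE i)
  rw [← hdiag]
  calc E i * ((E i)ᴴ * T i * E i) * (E i)ᴴ = (E i * (E i)ᴴ) * T i * (E i * (E i)ᴴ) := by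
        simp only [Matrix.mul_assoc]
    _ = T i := by rw [h1, Matrix.one_mul, Matrix.mul_one]

/-- The squared Frobenius norm. -/
noncomputable def frob {k : ℕ} (A : Matrix (Fin k) (Fin k) ℂ) : ℝ := (A * Aᴴ).trace.re

/-- The part of `A` that anticommutes with the involution `g`. -/
noncomputable def oddPart {k : ℕ} (g A : Matrix (Fin k) (Fin k) ℂ) : Matrix (Fin k) (Fin k) ℂ :=
  (1 / 2 : ℂ) • (A - g * A * g)

section oddPart

variable {k : ℕ} {g : Matrix (Fin k) (Fin k) ℂ}

lemma conj_oddPart (hgg : g * g = 1) (A : Matrix (Fin k) (Fin k) ℂ) :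
    g * oddPart g A * g = -oddPart g A := by
  have h : g * (g * A * g) * g = A := by
    calc g * (g * A * g) * g = (g * g) * A * (g * g) := by simp only [Matrix.mul_assoc]
      _ = A := by rw [hgg, Matrix.one_mul, Matrix.mul_one]
  unfold oddPart
  rw [Matrix.mul_smul, Matrix.smul_mul, Matrix.mul_sub, Matrix.sub_mul, h, ← smul_neg, neg_sub]

lemma oddPart_isHermitian (hg : gᴴ = g) {A : Matrix (Fin k) (Fin k) ℂ} (hA : A.IsHermitian) :
    (oddPart g A).IsHermitian := by
  unfold oddPart
  rw [IsHermitian, conjTranspose_smul, conjTranspose_sub, conjTranspose_mul, conjTranspose_mul,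
    hg, hA.eq, Matrix.mul_assoc]
  simp

lemma trace_oddPart_mul {N : Matrix (Fin k) (Fin k) ℂ} (hN : g * N * g = -N)
    (A : Matrix (Fin k) (Fin k) ℂ) : (oddPart g A * N).trace = (A * N).trace := by
  have h : (g * A * g * N).trace = -(A * N).trace := by
    rw [← trace_neg, ← Matrix.mul_neg, ← hN, Matrix.mul_assoc, Matrix.mul_assoc, trace_mul_comm]
    simp only [Matrix.mul_assoc]
  unfold oddPart
  rw [Matrix.smul_mul, Matrix.sub_mul, trace_smul, trace_sub, h, smul_eq_mul]
  ring

end oddPart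

lemma frob_eq_sum {k : ℕ} (A : Matrix (Fin k) (Fin k) ℂ) : frob A = ∑ i, ∑ j, ‖A i j‖ ^ 2 := by
  have h : (A * Aᴴ).trace = ∑ i, ∑ j, A i j * star (A i j) := rfl
  rw [frob, h, Complex.re_sum]
  refine Finset.sum_congr rfl fun i _ => ?_
  rw [Complex.re_sum]
  refine Finset.sum_congr rfl fun j _ => ?_
  rw [Complex.star_def, Complex.mul_conj, Complex.ofReal_re, Complex.normSq_eq_norm_sq]

lemma frob_nonneg {k : ℕ} (A : Matrix (Fin k) (Fin k) ℂ) : 0 ≤ frob A := by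
  rw [frob_eq_sum]; positivity

lemma eq_zero_and_nonneg_of_forall_le {φ ψ : ℝ → ℝ} {d : ℝ} (h1 : ∀ t, HasDerivAt φ (ψ t) t)
    (h2 : HasDerivAt ψ d 0) (hmin : ∀ t, φ 0 ≤ φ t) : ψ 0 = 0 ∧ 0 ≤ d := by
  have h0 : ψ 0 = 0 :=
    IsLocalMin.hasDerivAt_eq_zero (Filter.Eventually.of_forall hmin) (h1 0)
  refine ⟨h0, ?_⟩
  by_contra! hd
  have hφ : deriv φ = ψ := funext fun t => (h1 t).deriv
  have h3 : IsLocalMax φ 0 := by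
    refine isLocalMax_of_deriv_deriv_neg ?_ ?_ (h1 0).continuousAt
    · rw [hφ, h2.deriv]; exact hd
    · rw [hφ, h0]
  have h4 : φ =ᶠ[𝓝 0] fun _ => φ 0 := h3.mono fun t ht => le_antisymm ht (hmin t)
  have h5 : ψ =ᶠ[𝓝 0] fun _ => 0 := by
    have := h4.deriv
    rw [hφ] at this
    simpa using this
  have h6 := h5.deriv_eq
  rw [h2.deriv] at h6
  simp at h6
  exact hd.ne h6

section deriv

variable {k : ℕ} {F G : ℝ → Matrix (Fin k) (Fin k) ℂ} {F' G' : Matrix (Fin k) (Fin k) ℂ} {t : ℝ}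

lemma hasDerivAt_matrix_mul (hF : ∀ i j, HasDerivAt (fun t => F t i j) (F' i j) t)
    (hG : ∀ i j, HasDerivAt (fun t => G t i j) (G' i j) t) (i j : Fin k) :
    HasDerivAt (fun t => (F t * G t) i j) ((F' * G t + F t * G') i j) t := by
  simp only [Matrix.mul_apply, Matrix.add_apply, ← Finset.sum_add_distrib]
  exact HasDerivAt.fun_sum fun x _ => (hF i x).mul (hG x j)

lemma hasDerivAt_matrix_sub (hF : ∀ i j, HasDerivAt (fun t => F t i j) (F' i j) t)
    (hG : ∀ i j, HasDerivAt (fun t => G t i j) (G' i j) t) (i j : Fin k) :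
    HasDerivAt (fun t => (F t - G t) i j) ((F' - G') i j) t := by
  simp only [Matrix.sub_apply]
  exact (hF i j).fun_sub (hG i j)

lemma hasDerivAt_matrix_const (A : Matrix (Fin k) (Fin k) ℂ) (i j : Fin k) :
    HasDerivAt (fun _ : ℝ => A i j) ((0 : Matrix (Fin k) (Fin k) ℂ) i j) t :=
  hasDerivAt_const _ _

lemma hasDerivAt_matrix_oddPart (g : Matrix (Fin k) (Fin k) ℂ)
    (hF : ∀ i j, HasDerivAt (fun t => F t i j) (F' i j) t) (i j : Fin k) :
    HasDerivAt (fun t => oddPart g (F t) i j) (oddPart g F' i j) t := by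
  have h := hasDerivAt_matrix_sub hF
    (hasDerivAt_matrix_mul (hasDerivAt_matrix_mul (hasDerivAt_matrix_const g) hF)
      (hasDerivAt_matrix_const g)) i j
  simp only [Matrix.zero_mul, zero_add, Matrix.mul_zero, add_zero] at h
  exact h.const_mul (1 / 2 : ℂ)

lemma hasDerivAt_trace_re (hF : ∀ i j, HasDerivAt (fun t => F t i j) (F' i j) t) :
    HasDerivAt (fun t => (F t).trace.re) F'.trace.re t := by
  have h : HasDerivAt (fun t => (F t).trace) F'.trace t :=
    HasDerivAt.fun_sum fun i _ => hF i i
  exact Complex.reCLM.hasFDerivAt.comp_hasDerivAt t h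

end deriv

lemma exists_isMin_frob {k : ℕ} (g Λ Z : Matrix (Fin k) (Fin k) ℂ) :
    ∃ U : Matrix (Fin k) (Fin k) ℂ, Uᴴ * U = 1 ∧ ∀ V : Matrix (Fin k) (Fin k) ℂ, Vᴴ * V = 1 →
      frob (oddPart g (U * Λ * Uᴴ) - Z) ≤ frob (oddPart g (V * (U * Λ * Uᴴ) * Vᴴ) - Z) := by
  obtain ⟨f, hf⟩ : ∃ f : Matrix (Fin k) (Fin k) ℂ → ℝ,
      ∀ U, f U = frob (oddPart g (U * Λ * Uᴴ) - Z) := ⟨_, fun _ => rfl⟩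
  have hc : Continuous f := by
    have h1 : Continuous fun U : Matrix (Fin k) (Fin k) ℂ => U * Λ * Uᴴ :=
      (continuous_id.matrix_mul continuous_const).matrix_mul continuous_id.matrix_conjTranspose
    have h3 : Continuous fun U : Matrix (Fin k) (Fin k) ℂ => g * (U * Λ * Uᴴ) * g :=
      (continuous_const.matrix_mul h1).matrix_mul continuous_const
    have h2 : Continuous fun U : Matrix (Fin k) (Fin k) ℂ => oddPart g (U * Λ * Uᴴ) - Z := by
      unfold oddPart
      exact ((h1.sub h3).const_smul (1 / 2 : ℂ)).sub continuous_const
    rw [funext hf]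
    exact Complex.continuous_re.comp (h2.matrix_mul h2.matrix_conjTranspose).matrix_trace
  obtain ⟨E, hE, hmin⟩ := (isCompact_unitary_family (Fin 1) k).exists_isMinOn
    ⟨fun _ => 1, by simp⟩ (hc.comp (continuous_apply 0)).continuousOn
  rw [isMinOn_iff] at hmin
  refine ⟨E 0, hE 0, fun V hV => ?_⟩
  have h2 := hmin (fun i => V * E i) fun i => by
    rw [conjTranspose_mul, Matrix.mul_assoc, ← Matrix.mul_assoc Vᴴ, hV, Matrix.one_mul, hE]
  have h3 : V * E 0 * Λ * (V * E 0)ᴴ = V * (E 0 * Λ * (E 0)ᴴ) * Vᴴ := by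
    simp only [conjTranspose_mul, Matrix.mul_assoc]
  rw [Function.comp_apply, Function.comp_apply, hf, hf, h3] at h2
  exact h2

section critical

variable {k : ℕ} {g X Z : Matrix (Fin k) (Fin k) ℂ}

lemma critical_of_isMin (hg : gᴴ = g) (hgg : g * g = 1) (hX : X.IsHermitian)
    (hZ : Z.IsHermitian) (hgZ : g * Z * g = -Z)
    (hmin : ∀ V : Matrix (Fin k) (Fin k) ℂ, Vᴴ * V = 1 →
      frob (oddPart g X - Z) ≤ frob (oddPart g (V * X * Vᴴ) - Z))
    {S : Matrix (Fin k) (Fin k) ℂ} (hS : Sᴴ = -S) :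
    ((S * X - X * S) * (oddPart g X - Z)).trace.re = 0 ∧
      0 ≤ ((S * (S * X - X * S) - (S * X - X * S) * S) * (oddPart g X - Z)).trace.re +
        ((S * X - X * S) * oddPart g (S * X - X * S)).trace.re := by
  obtain ⟨U, hU0, hU1, hU⟩ := exists_unitary_curve hS
  set F : ℝ → Matrix (Fin k) (Fin k) ℂ := fun t => U t * X * (U t)ᴴ with hFdef
  have hF0 : F 0 = X := by simp [F, hU0]
  have hF : ∀ t i j, HasDerivAt (fun t => F t i j) ((S * F t - F t * S) i j) t := by
    intro t
    have h1 : ∀ i j, HasDerivAt (fun t => (U t)ᴴ i j) ((S * U t)ᴴ i j) t := fun i j =>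
      (hU t j i).star
    have h2 := hasDerivAt_matrix_mul (hasDerivAt_matrix_mul (hU t)
      (hasDerivAt_matrix_const X)) h1
    intro i j
    convert h2 i j using 2
    simp only [F, Matrix.mul_zero, add_zero, conjTranspose_mul, hS, Matrix.mul_neg,
      sub_eq_add_neg, Matrix.mul_assoc]
  set N : ℝ → Matrix (Fin k) (Fin k) ℂ := fun t => oddPart g (F t) - Z
  have hN : ∀ t i j, HasDerivAt (fun t => N t i j) (oddPart g (S * F t - F t * S) i j) t := by
    intro t i j
    have h := hasDerivAt_matrix_sub (hasDerivAt_matrix_oddPart g (hF t))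
      (hasDerivAt_matrix_const Z) i j
    simpa only [sub_zero] using h
  have hFh : ∀ t, (F t).IsHermitian := fun t => isHermitian_mul_mul_conjTranspose _ hX
  have hNh : ∀ t, (N t).IsHermitian := fun t => (oddPart_isHermitian hg (hFh t)).sub hZ
  have hgN : ∀ t, g * N t * g = -N t := by
    intro t
    simp only [N]
    rw [Matrix.mul_sub, Matrix.sub_mul, conj_oddPart hgg, hgZ, neg_sub, sub_neg_eq_add,
      neg_add_eq_sub]
  let ψ : ℝ → ℝ := fun t => 2 * ((S * F t - F t * S) * N t).trace.re
  have hφ : ∀ t, HasDerivAt (fun t => (N t * N t).trace.re) (ψ t) t := by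
    intro t
    have h := hasDerivAt_trace_re (hasDerivAt_matrix_mul (hN t) (hN t))
    refine h.congr_deriv ?_
    rw [trace_add, trace_mul_comm (N t), trace_oddPart_mul (hgN t), Complex.add_re]
    simp only [ψ]; ring
  have hψ : HasDerivAt ψ (2 * (((S * (S * X - X * S) - (S * X - X * S) * S) *
      (oddPart g X - Z)).trace.re + ((S * X - X * S) * oddPart g (S * X - X * S)).trace.re)) 0 := by
    have h1 := hasDerivAt_matrix_mul (hasDerivAt_matrix_const S) (hF 0)
    have h2 := hasDerivAt_matrix_mul (hF 0) (hasDerivAt_matrix_const S)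
    have h3 := hasDerivAt_matrix_mul (hasDerivAt_matrix_sub h1 h2) (hN 0)
    have h4 := (hasDerivAt_trace_re h3).const_mul 2
    refine h4.congr_deriv ?_
    simp only [Matrix.zero_mul, zero_add, Matrix.mul_zero, add_zero, hF0, N, trace_add,
      Complex.add_re]
  have := eq_zero_and_nonneg_of_forall_le hφ hψ fun t => by
    have h := hmin (U t) (hU1 t)
    have h0 : N 0 = oddPart g X - Z := by simp only [N, hF0]
    have h1 : N t = oddPart g (U t * X * (U t)ᴴ) - Z := rfl
    rw [← h0, ← h1, frob, frob, (hNh t).eq, (hNh 0).eq] at h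
    exact h
  simp only [ψ, hF0, N] at this
  constructor <;> linarith [this.1, this.2]

lemma trace_mul_im_eq_zero {k : ℕ} {A B : Matrix (Fin k) (Fin k) ℂ} (hA : A.IsHermitian)
    (hB : B.IsHermitian) : (A * B).trace.im = 0 := by
  have h : star (A * B).trace = (A * B).trace := by
    rw [← trace_conjTranspose, conjTranspose_mul, hA.eq, hB.eq, trace_mul_comm]
  exact Complex.conj_eq_iff_im.mp h

lemma trace_complex_mul {k : ℕ} {A B C D : Matrix (Fin k) (Fin k) ℂ} (hA : A.IsHermitian)
    (hB : B.IsHermitian) (hC : C.IsHermitian) (hD : D.IsHermitian) :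
    ((A + Complex.I • B) * (C + Complex.I • D)ᴴ).trace.re =
      (A * C).trace.re + (B * D).trace.re := by
  have h1 := trace_mul_im_eq_zero hB hC
  have h2 := trace_mul_im_eq_zero hA hD
  have h : (A + Complex.I • B) * (C + Complex.I • D)ᴴ =
      A * C + B * D + Complex.I • (B * C - A * D) := by
    rw [conjTranspose_add, conjTranspose_smul, hC.eq, hD.eq, Complex.star_def, Complex.conj_I]
    simp only [Matrix.add_mul, Matrix.mul_add, Matrix.smul_mul, Matrix.mul_smul, smul_add,
      smul_smul, neg_mul, Complex.I_mul_I]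
    module
  rw [h, trace_add, trace_add, trace_smul, trace_sub, Complex.add_re, Complex.add_re,
    smul_eq_mul, Complex.I_mul_re, Complex.sub_im, h1, h2]
  ring

section critical

variable {k : ℕ} {g X Z : Matrix (Fin k) (Fin k) ℂ}

lemma commute_of_isMin (hg : gᴴ = g) (hgg : g * g = 1) (hX : X.IsHermitian)
    (hZ : Z.IsHermitian) (hgZ : g * Z * g = -Z)
    (hmin : ∀ V : Matrix (Fin k) (Fin k) ℂ, Vᴴ * V = 1 →
      frob (oddPart g X - Z) ≤ frob (oddPart g (V * X * Vᴴ) - Z)) :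
    X * (oddPart g X - Z) = (oddPart g X - Z) * X := by
  have hNh : (oddPart g X - Z).IsHermitian := (oddPart_isHermitian hg hX).sub hZ
  have hcrit : ∀ S : Matrix (Fin k) (Fin k) ℂ, Sᴴ = -S → _ := fun S hS =>
    (critical_of_isMin hg hgg hX hZ hgZ hmin hS).1
  generalize oddPart g X - Z = N at hNh hcrit ⊢
  have hT : (X * N - N * X).IsHermitian := by
    refine isHermitian_of_re_trace_mul_eq_zero fun S hS => ?_
    rw [← hcrit S hS, Matrix.mul_sub, Matrix.sub_mul, trace_sub, trace_sub, ← Matrix.mul_assoc S N X,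
      trace_mul_comm (S * N) X, Matrix.mul_assoc, Matrix.mul_assoc]
  have h2 := hT.eq
  rw [conjTranspose_sub, conjTranspose_mul, conjTranspose_mul, hX.eq, hNh.eq, ← neg_sub,
    neg_eq_iff_add_eq_zero, ← two_smul ℂ, smul_eq_zero] at h2
  exact sub_eq_zero.mp (h2.resolve_left two_ne_zero)

lemma oddPart_add_smul (g A B : Matrix (Fin k) (Fin k) ℂ) (c : ℂ) :
    oddPart g (A + c • B) = oddPart g A + c • oddPart g B := by
  unfold oddPart
  rw [Matrix.mul_add, Matrix.add_mul, Matrix.mul_smul, Matrix.smul_mul, smul_comm c, ← smul_add,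
    smul_sub]
  module

lemma second_order_of_isMin (hg : gᴴ = g) (hgg : g * g = 1) (hX : X.IsHermitian)
    (hZ : Z.IsHermitian) (hgZ : g * Z * g = -Z)
    (hmin : ∀ V : Matrix (Fin k) (Fin k) ℂ, Vᴴ * V = 1 →
      frob (oddPart g X - Z) ≤ frob (oddPart g (V * X * Vᴴ) - Z))
    (C : Matrix (Fin k) (Fin k) ℂ) :
    ((C * (oddPart g X - Z) - (oddPart g X - Z) * C) * (C * X - X * C)ᴴ).trace.re ≤
      frob (oddPart g (C * X - X * C)) := by
  have hNh : (oddPart g X - Z).IsHermitian := (oddPart_isHermitian hg hX).sub hZ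
  have hcrit : ∀ S : Matrix (Fin k) (Fin k) ℂ, Sᴴ = -S → _ := fun S hS =>
    (critical_of_isMin hg hgg hX hZ hgZ hmin hS).2
  generalize oddPart g X - Z = N at hNh hcrit ⊢
  have hbr : ∀ S Y : Matrix (Fin k) (Fin k) ℂ, Sᴴ = -S → Y.IsHermitian →
      (S * Y - Y * S).IsHermitian := by
    intro S Y hS hY
    rw [IsHermitian, conjTranspose_sub, conjTranspose_mul, conjTranspose_mul, hY.eq, hS]
    simp only [Matrix.mul_neg, Matrix.neg_mul]
    abel
  have hreal : ∀ S : Matrix (Fin k) (Fin k) ℂ, Sᴴ = -S →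
      ((S * N - N * S) * (S * X - X * S)).trace.re ≤
        (oddPart g (S * X - X * S) * oddPart g (S * X - X * S)).trace.re := by
    intro S hS
    have h1 := hcrit S hS
    rw [trace_oddPart_mul (conj_oddPart hgg _)]
    have h2 : ((S * (S * X - X * S) - (S * X - X * S) * S) * N).trace =
        -((S * N - N * S) * (S * X - X * S)).trace := by
      generalize S * X - X * S = H
      rw [Matrix.sub_mul, Matrix.sub_mul, trace_sub, trace_sub, neg_sub, trace_mul_comm _ N,
        Matrix.mul_assoc N, Matrix.mul_assoc H, trace_mul_comm H]
    rw [h2, Complex.neg_re] at h1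
    linarith
  let a : Matrix (Fin k) (Fin k) ℂ := (1 / 2 : ℂ) • (C - Cᴴ)
  let b : Matrix (Fin k) (Fin k) ℂ := (-Complex.I / 2 : ℂ) • (C + Cᴴ)
  have ha : aᴴ = -a := by
    simp only [a]
    rw [conjTranspose_smul, conjTranspose_sub, conjTranspose_conjTranspose, ← smul_neg, neg_sub]
    simp
  have hb : bᴴ = -b := by
    simp only [b]
    rw [conjTranspose_smul, conjTranspose_add, conjTranspose_conjTranspose, ← neg_smul, add_comm]
    congr 1
    simp [neg_div]
  have hC : C = a + Complex.I • b := by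
    simp only [a, b]
    rw [smul_smul, show Complex.I * (-Complex.I / 2) = 1 / 2 by
      rw [mul_div_assoc', mul_neg, Complex.I_mul_I]; norm_num, ← smul_add]
    ext i j
    simp only [Matrix.smul_apply, Matrix.add_apply, Matrix.sub_apply, smul_eq_mul]
    ring
  clear_value a b
  have hCY : ∀ Y, C * Y - Y * C = (a * Y - Y * a) + Complex.I • (b * Y - Y * b) := by
    intro Y
    rw [hC, Matrix.add_mul, Matrix.mul_add, Matrix.smul_mul, Matrix.mul_smul, smul_sub]
    abel
  have hoX := fun S hS => oddPart_isHermitian hg (hbr S X hS hX)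
  rw [hCY, hCY, oddPart_add_smul, frob, trace_complex_mul (hbr a N ha hNh) (hbr b N hb hNh)
    (hbr a X ha hX) (hbr b X hb hX), trace_complex_mul (hoX a ha) (hoX b hb) (hoX a ha) (hoX b hb)]
  exact add_le_add (hreal a ha) (hreal b hb)

end critical

lemma exists_unitary_block {k : ℕ} (d : Fin k → ℝ) {N : Matrix (Fin k) (Fin k) ℂ}
    (hN : N.IsHermitian) (hd : ∀ a b, d a ≠ d b → N a b = 0) :
    ∃ (W : Matrix (Fin k) (Fin k) ℂ) (ν : Fin k → ℝ), Wᴴ * W = 1 ∧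
      N * W = W * diagonal (fun i => (ν i : ℂ)) ∧ ∀ a b, d a ≠ d b → W a b = 0 := by
  classical
  let B : ∀ v : ℝ, Matrix {a // d a = v} {a // d a = v} ℂ := fun v =>
    N.submatrix Subtype.val Subtype.val
  have hB : ∀ v, (B v).IsHermitian := fun v => hN.submatrix _
  let V : ∀ v : ℝ, Matrix {a // d a = v} {a // d a = v} ℂ := fun v => (hB v).eigenvectorUnitary
  have hV : ∀ v, (V v)ᴴ * V v = 1 := fun v =>
    (Unitary.mem_iff.mp (hB v).eigenvectorUnitary.2).1
  have hBV : ∀ v, B v * V v = V v * diagonal (fun i => ((hB v).eigenvalues i : ℂ)) := by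
    intro v
    have h := (hB v).spectral_theorem
    rw [Unitary.conjStarAlgAut_apply] at h
    have h1 : B v = V v * diagonal (fun i => ((hB v).eigenvalues i : ℂ)) * (V v)ᴴ := h
    conv_lhs => rw [h1]
    rw [Matrix.mul_assoc, hV, Matrix.mul_one]
  let W : Matrix (Fin k) (Fin k) ℂ := fun a b =>
    if h : d a = d b then V (d b) ⟨a, h⟩ ⟨b, rfl⟩ else 0
  let ν : Fin k → ℝ := fun b => (hB (d b)).eigenvalues ⟨b, rfl⟩
  have hW : ∀ {v a b} (ha : d a = v) (hb : d b = v), W a b = V v ⟨a, ha⟩ ⟨b, hb⟩ := by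
    intro v a b ha hb
    subst hb
    simp only [W, dif_pos ha]
  have hW0 : ∀ a b, d a ≠ d b → W a b = 0 := fun a b h => by simp only [W, dif_neg h]
  have hsum : ∀ (v : ℝ) (f : Fin k → ℂ), (∀ a, d a ≠ v → f a = 0) →
      ∑ a, f a = ∑ a : {a // d a = v}, f a := by
    intro v f hf
    rw [← Finset.sum_subtype (Finset.univ.filter fun a => d a = v) (by simp) f]
    refine (Finset.sum_filter_of_ne fun a _ ha => ?_).symm
    by_contra h
    exact ha (hf a h)
  refine ⟨W, ν, ?_, ?_, hW0⟩
  · ext a b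
    rw [Matrix.mul_apply, hsum (d b) _ fun c hc => by rw [hW0 c b hc, mul_zero]]
    by_cases hab : d a = d b
    · have h := congrFun (congrFun (hV (d b)) ⟨a, hab⟩) ⟨b, rfl⟩
      rw [Matrix.mul_apply] at h
      simp only [conjTranspose_apply] at h ⊢
      rw [Finset.sum_congr rfl fun c _ => by rw [hW c.2 hab, hW c.2 rfl], h]
      simp [Matrix.one_apply]
    · rw [Finset.sum_eq_zero, Matrix.one_apply_ne (fun h => hab (congrArg d h))]
      intro c _
      rw [conjTranspose_apply, hW0 c a (fun h => hab (h.symm.trans c.2)), star_zero, zero_mul]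
  · ext a b
    rw [Matrix.mul_apply, Matrix.mul_diagonal, hsum (d b) _ fun c hc => by rw [hW0 c b hc, mul_zero]]
    by_cases hab : d a = d b
    · have h := congrFun (congrFun (hBV (d b)) ⟨a, hab⟩) ⟨b, rfl⟩
      rw [Matrix.mul_apply, Matrix.mul_diagonal] at h
      rw [hW hab rfl]
      refine Eq.trans ?_ h
      exact Finset.sum_congr rfl fun c _ => by rw [hW c.2 rfl]; rfl
    · rw [hW0 a b hab, zero_mul]
      exact Finset.sum_eq_zero fun c _ => by
        rw [hd a c (fun h => hab (h.trans c.2)), zero_mul]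

/-- Simultaneous diagonalization of commuting Hermitian matrices, with lexicographically sorted
eigenvalues. -/
lemma exists_unitary_of_commute {k : ℕ} {X N : Matrix (Fin k) (Fin k) ℂ} (hX : X.IsHermitian)
    (hN : N.IsHermitian) (hXN : X * N = N * X) :
    ∃ (U : Matrix (Fin k) (Fin k) ℂ) (x ν : Fin k → ℝ), Uᴴ * U = 1 ∧ Antitone x ∧
      (∀ a b, a ≤ b → x a = x b → ν a ≤ ν b) ∧ X = U * diagonal (fun i => (x i : ℂ)) * Uᴴ ∧
      N = U * diagonal (fun i => (ν i : ℂ)) * Uᴴ := by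
  obtain ⟨V, hV, hVX⟩ := exists_unitary_eigVec X hX
  set d := eigVec X hX
  have hV' : V * Vᴴ = 1 := mul_eq_one_comm.mp hV
  have hcomm : diagonal (fun i => (d i : ℂ)) * (Vᴴ * N * V) =
      (Vᴴ * N * V) * diagonal (fun i => (d i : ℂ)) := by
    have h1 : Vᴴ * (X * N) * V = diagonal (fun i => (d i : ℂ)) * (Vᴴ * N * V) := by
      conv_lhs => rw [hVX]
      simp only [Matrix.mul_assoc]
      rw [← Matrix.mul_assoc Vᴴ V, hV, Matrix.one_mul]
    have h2 : Vᴴ * (N * X) * V = (Vᴴ * N * V) * diagonal (fun i => (d i : ℂ)) := by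
      conv_lhs => rw [hVX]
      simp only [Matrix.mul_assoc]
      rw [hV, Matrix.mul_one]
    rw [← h1, ← h2, hXN]
  obtain ⟨W, ν, hW, hNW, hW0⟩ := exists_unitary_block d
    (isHermitian_conjTranspose_mul_mul V hN) fun a b hab => by
      have h := congrFun (congrFun hcomm a) b
      rw [Matrix.diagonal_mul, Matrix.mul_diagonal] at h
      have h1 : ((d a : ℂ) - d b) * (Vᴴ * N * V) a b = 0 := by linear_combination h
      refine (mul_eq_zero.mp h1).resolve_left ?_
      intro h0
      exact hab (by exact_mod_cast sub_eq_zero.mp h0)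
  have hW' : W * Wᴴ = 1 := mul_eq_one_comm.mp hW
  have hdW : diagonal (fun i => (d i : ℂ)) * W = W * diagonal (fun i => (d i : ℂ)) := by
    ext a b
    rw [Matrix.diagonal_mul, Matrix.mul_diagonal]
    by_cases hab : d a = d b
    · rw [hab, mul_comm]
    · rw [hW0 a b hab]; simp
  let σ : Equiv.Perm (Fin k) := Tuple.sort fun b => toLex (-d b, ν b)
  have hσ := Tuple.monotone_sort fun b => toLex (-d b, ν b)
  have hperm : ∀ (A : Matrix (Fin k) (Fin k) ℂ) (f : Fin k → ℝ),
      A * diagonal (fun i => (f i : ℂ)) * Aᴴ = A.submatrix id σ *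
        diagonal (fun i => ((f (σ i) : ℝ) : ℂ)) * (A.submatrix id σ)ᴴ := by
    intro A f
    have h1 : diagonal (fun i => ((f (σ i) : ℝ) : ℂ)) =
        (diagonal (fun i => (f i : ℂ))).submatrix σ σ := by
      rw [submatrix_diagonal_equiv]; rfl
    rw [h1, submatrix_mul_equiv, conjTranspose_submatrix, submatrix_mul_equiv, submatrix_id_id]
  refine ⟨(V * W).submatrix id σ, d ∘ σ, ν ∘ σ, ?_, ?_, ?_, ?_, ?_⟩
  · have h1 : (V * W)ᴴ * (V * W) = 1 := by
      rw [conjTranspose_mul, Matrix.mul_assoc, ← Matrix.mul_assoc Vᴴ, hV, Matrix.one_mul, hW]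
    have h2 := submatrix_mul_equiv (V * W)ᴴ (V * W) σ (Equiv.refl _) σ
    rw [h1, Equiv.coe_refl] at h2
    rw [conjTranspose_submatrix, h2]
    ext i j; simp [Matrix.one_apply]
  · intro a b hab
    have h := Prod.Lex.toLex_le_toLex.mp (hσ hab)
    simp only [Function.comp] at h ⊢
    rcases h with h | h
    · exact (neg_lt_neg_iff.mp h).le
    · exact (neg_inj.mp h.1).ge
  · intro a b hab hx
    have h := Prod.Lex.toLex_le_toLex.mp (hσ hab)
    simp only [Function.comp] at h hx ⊢
    rcases h with h | h
    · exact absurd hx.symm (neg_lt_neg_iff.mp h).ne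
    · exact h.2
  · refine Eq.trans ?_ (hperm (V * W) d)
    conv_lhs => rw [hVX]
    calc V * diagonal (fun i => (d i : ℂ)) * Vᴴ
        = V * (diagonal (fun i => (d i : ℂ)) * (W * Wᴴ)) * Vᴴ := by rw [hW', Matrix.mul_one]
      _ = _ := by
        rw [← Matrix.mul_assoc (diagonal _), hdW]
        simp only [conjTranspose_mul, Matrix.mul_assoc]
  · refine Eq.trans ?_ (hperm (V * W) ν)
    calc N = (V * Vᴴ) * N * (V * Vᴴ) := by rw [hV', Matrix.one_mul, Matrix.mul_one]
      _ = V * ((Vᴴ * N * V) * (W * Wᴴ)) * Vᴴ := by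
        rw [hW', Matrix.mul_one]; simp only [Matrix.mul_assoc]
      _ = _ := by
        rw [← Matrix.mul_assoc _ W, hNW]
        simp only [conjTranspose_mul, Matrix.mul_assoc]

lemma conj_diagonal_comp_eq {k : ℕ} {U V : Matrix (Fin k) (Fin k) ℂ} {x y : Fin k → ℝ}
    (hU : Uᴴ * U = 1) (hV : Vᴴ * V = 1)
    (h : U * diagonal (fun i => (x i : ℂ)) * Uᴴ = V * diagonal (fun i => (y i : ℂ)) * Vᴴ)
    (f : ℝ → ℝ) :
    U * diagonal (fun i => (f (x i) : ℂ)) * Uᴴ = V * diagonal (fun i => (f (y i) : ℂ)) * Vᴴ := by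
  have hU' : U * Uᴴ = 1 := mul_eq_one_comm.mp hU
  have hV' : V * Vᴴ = 1 := mul_eq_one_comm.mp hV
  have h1 : (Vᴴ * U) * diagonal (fun i => (x i : ℂ)) =
      diagonal (fun i => (y i : ℂ)) * (Vᴴ * U) := by
    calc (Vᴴ * U) * diagonal (fun i => (x i : ℂ))
        = Vᴴ * (U * diagonal (fun i => (x i : ℂ)) * Uᴴ) * U := by
          simp only [Matrix.mul_assoc]; rw [hU, Matrix.mul_one]
      _ = (Vᴴ * V) * (diagonal (fun i => (y i : ℂ)) * (Vᴴ * U)) := by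
          rw [h]; simp only [Matrix.mul_assoc]
      _ = _ := by rw [hV, Matrix.one_mul]
  have h2 : (Vᴴ * U) * diagonal (fun i => (f (x i) : ℂ)) =
      diagonal (fun i => (f (y i) : ℂ)) * (Vᴴ * U) := by
    ext a b
    have h3 := congrFun (congrFun h1 a) b
    rw [Matrix.mul_diagonal, Matrix.diagonal_mul] at h3 ⊢
    by_cases hxy : x b = y a
    · rw [hxy, mul_comm]
    · have h4 : ((x b : ℂ) - y a) * (Vᴴ * U) a b = 0 := by linear_combination h3
      rw [(mul_eq_zero.mp h4).resolve_left fun h0 =>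
        hxy (by exact_mod_cast sub_eq_zero.mp h0)]
      simp
  calc U * diagonal (fun i => (f (x i) : ℂ)) * Uᴴ
      = V * ((Vᴴ * U) * diagonal (fun i => (f (x i) : ℂ))) * Uᴴ := by
        simp only [← Matrix.mul_assoc]; rw [hV', Matrix.one_mul]
    _ = V * diagonal (fun i => (f (y i) : ℂ)) * Vᴴ * (U * Uᴴ) := by
        rw [h2]; simp only [Matrix.mul_assoc]
    _ = _ := by rw [hU', Matrix.mul_one]

section offDiagonal

variable {k : ℕ} {g N P X Y : Matrix (Fin k) (Fin k) ℂ} {τ : ℂ}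

lemma trace_sub_conj_mul (hg : gᴴ = g) (hgg : g * g = 1) (hP : Pᴴ = P) (hPgP : P * g * P = 0)
    {a b u v : Matrix (Fin k) (Fin k) ℂ} (ha : a * P = a) (hb : b * P = b) (hu : u * P = u)
    (hv : v * P = v) :
    ((a - g * b * g) * (u - g * v * g)ᴴ).trace = (a * uᴴ).trace + (b * vᴴ).trace := by
  have hz : ∀ c d : Matrix (Fin k) (Fin k) ℂ, c * P = c → d * P = d → c * g * dᴴ = 0 := by
    intro c d hc hd
    calc c * g * dᴴ = (c * P) * g * (d * P)ᴴ := by rw [hc, hd]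
      _ = c * (P * g * P) * dᴴ := by
        rw [conjTranspose_mul, hP]; simp only [Matrix.mul_assoc]
      _ = 0 := by rw [hPgP, Matrix.mul_zero, Matrix.zero_mul]
  have h1 : (a - g * b * g) * (u - g * v * g)ᴴ =
      a * uᴴ + g * (b * (g * g) * vᴴ) * g - (a * g * vᴴ) * g - g * (b * g * uᴴ) := by
    rw [conjTranspose_sub, conjTranspose_mul, conjTranspose_mul, hg]
    simp only [Matrix.mul_sub, Matrix.sub_mul, Matrix.mul_assoc]
    abel
  rw [h1, hz a v ha hv, hz b u hb hu, hgg, Matrix.zero_mul, Matrix.mul_zero, sub_zero, sub_zero,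
    Matrix.mul_one, trace_add, trace_mul_comm (g * _), ← Matrix.mul_assoc, hgg, Matrix.one_mul]

lemma second_order_pair (hg : gᴴ = g) (hgg : g * g = 1) (hgN : g * N * g = -N)
    (hP : Pᴴ = P) (hPgP : P * g * P = 0) (hPN : P * N = -τ • P) (hPX : P * X = X * P)
    (hPY : P * Y = Y * P) (hY : Y = -(g * X * g))
    (hsec : ∀ C : Matrix (Fin k) (Fin k) ℂ,
      ((C * N - N * C) * (C * X - X * C)ᴴ).trace.re ≤ frob (oddPart g (C * X - X * C)))
    {A B : Matrix (Fin k) (Fin k) ℂ} (hA : A * P = A) (hB : B * P = B) :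
    ((N * A + τ • A) * (X * A - A * X)ᴴ).trace.re + ((N * B + τ • B) * (Y * B - B * Y)ᴴ).trace.re ≤
      1 / 2 * frob ((X * A - A * X) + (Y * B - B * Y)) := by
  have hbr : ∀ {M A : Matrix (Fin k) (Fin k) ℂ}, P * M = M * P → A * P = A →
      (M * A - A * M) * P = M * A - A * M := by
    intro M A hM hA
    rw [Matrix.sub_mul, Matrix.mul_assoc, hA, Matrix.mul_assoc, ← hM, ← Matrix.mul_assoc, hA]
  have hW : ∀ {A : Matrix (Fin k) (Fin k) ℂ}, A * P = A →
      (N * A + τ • A) * P = N * A + τ • A := by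
    intro A hA
    rw [Matrix.add_mul, Matrix.mul_assoc, Matrix.smul_mul, hA]
  have hAN : ∀ {A : Matrix (Fin k) (Fin k) ℂ}, A * P = A → A * N = -τ • A := by
    intro A hA
    rw [← hA, Matrix.mul_assoc, hPN, Matrix.mul_smul]
  have hgl : ∀ M, g * (g * M) = M := fun M => by rw [← Matrix.mul_assoc, hgg, Matrix.one_mul]
  have hgNr : g * N = -(N * g) := by
    calc g * N = g * N * g * g := by rw [Matrix.mul_assoc _ g g, hgg, Matrix.mul_one]
      _ = -(N * g) := by rw [hgN, Matrix.neg_mul]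
  have hgXr : g * X = -(Y * g) := by
    rw [hY, Matrix.neg_mul, neg_neg, Matrix.mul_assoc _ g g, hgg, Matrix.mul_one]
  have hXg : X * g = -(g * Y) := by
    rw [hY, Matrix.mul_neg, neg_neg, Matrix.mul_assoc g X g, hgl]
  have hNg : N * g = -(g * N) := by rw [hgNr, neg_neg]
  let C := A + g * B * g
  have hCN : C * N - N * C = -((N * A + τ • A) - g * (N * B + τ • B) * g) := by
    have e1 : A * N = -τ • A := hAN hA
    have e2 : g * B * g * N = τ • (g * B * g) := by
      rw [Matrix.mul_assoc _ g N, hgNr, Matrix.mul_neg, ← Matrix.mul_assoc, Matrix.mul_assoc g B N,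
        hAN hB]
      simp
    have e3 : N * (g * B * g) = -(g * (N * B) * g) := by
      rw [← Matrix.mul_assoc, ← Matrix.mul_assoc, hNg]
      simp only [Matrix.neg_mul, Matrix.mul_assoc]
    have e4 : g * (N * B + τ • B) * g = g * (N * B) * g + τ • (g * B * g) := by
      rw [Matrix.mul_add, Matrix.add_mul, Matrix.mul_smul, Matrix.smul_mul]
    simp only [C]
    rw [Matrix.add_mul, Matrix.mul_add, e1, e2, e3, e4]
    module
  have hCX : C * X - X * C = -((X * A - A * X) - g * (Y * B - B * Y) * g) := by
    have e2 : g * B * g * X = -(g * (B * Y) * g) := by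
      rw [Matrix.mul_assoc _ g X, hgXr]
      simp only [Matrix.mul_neg, Matrix.mul_assoc]
    have e3 : X * (g * B * g) = -(g * (Y * B) * g) := by
      rw [← Matrix.mul_assoc, ← Matrix.mul_assoc, hXg]
      simp only [Matrix.neg_mul, Matrix.mul_assoc]
    simp only [C]
    rw [Matrix.add_mul, Matrix.mul_add, e2, e3, Matrix.mul_sub, Matrix.sub_mul]
    abel
  have h := hsec C
  rw [hCN, hCX, conjTranspose_neg, neg_mul_neg, trace_sub_conj_mul hg hgg hP hPgP (hW hA)
    (hW hB) (hbr hPX hA) (hbr hPY hB), Complex.add_re] at h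
  refine h.trans_eq ?_
  have hu := hbr hPX hA
  have hv := hbr hPY hB
  generalize X * A - A * X = u at hu ⊢
  generalize Y * B - B * Y = v at hv ⊢
  have huv : (u + v) * P = u + v := by rw [Matrix.add_mul, hu, hv]
  have ho : oddPart g (-(u - g * v * g)) = (-(1 / 2) : ℂ) • ((u + v) - g * (u + v) * g) := by
    have e : g * (g * v * g) * g = v := by
      rw [Matrix.mul_assoc g v g, hgl, Matrix.mul_assoc, hgg, Matrix.mul_one]
    unfold oddPart
    rw [Matrix.mul_neg, Matrix.neg_mul, Matrix.mul_sub, Matrix.sub_mul, e, Matrix.mul_add,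
      Matrix.add_mul]
    module
  rw [ho, frob, conjTranspose_smul, Matrix.smul_mul, Matrix.mul_smul, smul_smul, trace_smul,
    trace_sub_conj_mul hg hgg hP hPgP huv huv huv huv, ← two_mul, smul_eq_mul, frob]
  have : -(1 / 2 : ℂ) * star (-(1 / 2) : ℂ) * (2 * ((u + v) * (u + v)ᴴ).trace) =
      ((1 / 2 : ℝ) : ℂ) * ((u + v) * (u + v)ᴴ).trace := by
    simp
    ring
  rw [this, Complex.re_ofReal_mul]

lemma trace_mul_commutator_conjTranspose (hN : Nᴴ = N) (hX : Xᴴ = X) (hτ : star τ = τ)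
    (hXN : X * N = N * X) (A C : Matrix (Fin k) (Fin k) ℂ) :
    ((N * A + τ • A) * (X * C - C * X)ᴴ).trace.re =
      ((N * C + τ • C) * (X * A - A * X)ᴴ).trace.re := by
  have h : ((N * A + τ • A) * (X * C - C * X)ᴴ).trace =
      star ((N * C + τ • C) * (X * A - A * X)ᴴ).trace := by
    rw [← trace_conjTranspose, conjTranspose_mul, conjTranspose_conjTranspose, conjTranspose_add,
      conjTranspose_smul, conjTranspose_sub, conjTranspose_mul, conjTranspose_mul,
      conjTranspose_mul, hN, hX, hτ]
    have e1 : (N * (A * (Cᴴ * X))).trace = (X * (A * (Cᴴ * N))).trace := by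
      rw [← Matrix.mul_assoc A, ← Matrix.mul_assoc N, trace_mul_comm, ← Matrix.mul_assoc X, hXN,
        Matrix.mul_assoc, trace_mul_comm N]
      simp only [Matrix.mul_assoc]
    have e2 : (N * (A * (X * Cᴴ))).trace = (A * (X * (Cᴴ * N))).trace := by
      rw [trace_mul_comm]
      simp only [Matrix.mul_assoc]
    have e3 : (A * (Cᴴ * X)).trace = (X * (A * Cᴴ)).trace := by
      rw [trace_mul_comm X, Matrix.mul_assoc]
    simp only [Matrix.add_mul, Matrix.mul_sub, Matrix.sub_mul, Matrix.mul_add, trace_add, trace_sub,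
      Matrix.smul_mul, Matrix.mul_smul, trace_smul, Matrix.mul_assoc, e1, e2, e3]
    ring
  rw [h, Complex.star_def, Complex.conj_re]

lemma second_order_triple (hPN : P * N = -τ • P)
    (hN : Nᴴ = N) (hX : Xᴴ = X) (hY : Yᴴ = Y) (hτ : star τ = τ) {T : Matrix (Fin k) (Fin k) ℂ}
    (hXN : X * N = N * X) (hYN : Y * N = N * Y) (hsum : X + Y + T = (2 : ℂ) • N)
    (hpair : ∀ {A B : Matrix (Fin k) (Fin k) ℂ}, A * P = A → B * P = B →
      ((N * A + τ • A) * (X * A - A * X)ᴴ).trace.re +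
        ((N * B + τ • B) * (Y * B - B * Y)ᴴ).trace.re ≤
      1 / 2 * frob ((X * A - A * X) + (Y * B - B * Y)))
    {A B C : Matrix (Fin k) (Fin k) ℂ} (hA : A * P = A) (hB : B * P = B) (hC : C * P = C)
    (hrel : (X * A - A * X) + (Y * B - B * Y) + (T * C - C * T) = 0) :
    ((N * A + τ • A) * (X * A - A * X)ᴴ).trace.re + ((N * B + τ • B) * (Y * B - B * Y)ᴴ).trace.re +
      ((N * C + τ • C) * (T * C - C * T)ᴴ).trace.re ≤ 0 := by
  have hsub : ∀ {A : Matrix (Fin k) (Fin k) ℂ}, A * P = A → (A - C) * P = A - C := by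
    intro A hA
    rw [Matrix.sub_mul, hA, hC]
  have hCN : C * N = -τ • C := by rw [← hC, Matrix.mul_assoc, hPN, Matrix.mul_smul]
  have h := hpair (hsub hA) (hsub hB)
  have hlin : (X * (A - C) - (A - C) * X) + (Y * (B - C) - (B - C) * Y) =
      (-2 : ℂ) • (N * C + τ • C) := by
    have e1 : (X + Y + T) * C - C * (X + Y + T) = (2 : ℂ) • (N * C + τ • C) := by
      rw [hsum, Matrix.smul_mul, Matrix.mul_smul, hCN]
      module
    have e2 : (X * (A - C) - (A - C) * X) + (Y * (B - C) - (B - C) * Y) =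
        (X * A - A * X) + (Y * B - B * Y) + (T * C - C * T) -
          ((X + Y + T) * C - C * (X + Y + T)) := by
      simp only [Matrix.mul_sub, Matrix.sub_mul, Matrix.add_mul, Matrix.mul_add]
      abel
    rw [e2, hrel, e1]
    module
  have hadjX := trace_mul_commutator_conjTranspose hN hX hτ hXN A C
  have hadjY := trace_mul_commutator_conjTranspose hN hY hτ hYN B C
  have hlinC : (X * C - C * X) + (Y * C - C * Y) =
      (2 : ℂ) • (N * C + τ • C) - (T * C - C * T) := by
    have e1 : (X + Y + T) * C - C * (X + Y + T) = (2 : ℂ) • (N * C + τ • C) := by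
      rw [hsum, Matrix.smul_mul, Matrix.mul_smul, hCN]
      module
    rw [← e1, Matrix.add_mul, Matrix.mul_add, Matrix.add_mul, Matrix.mul_add]
    abel
  have hd : ∀ M D : Matrix (Fin k) (Fin k) ℂ,
      M * (D - C) - (D - C) * M = (M * D - D * M) - (M * C - C * M) := by
    intro M D
    rw [Matrix.mul_sub, Matrix.sub_mul]
    abel
  have hw : ∀ D : Matrix (Fin k) (Fin k) ℂ,
      N * (D - C) + τ • (D - C) = (N * D + τ • D) - (N * C + τ • C) := by
    intro D
    rw [Matrix.mul_sub]
    module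
  rw [hlin, hd, hd, hw, hw] at h
  generalize N * A + τ • A = wA at *
  generalize N * B + τ • B = wB at *
  generalize N * C + τ • C = wC at *
  generalize X * A - A * X = α at *
  generalize Y * B - B * Y = β at *
  generalize T * C - C * T = γ at *
  generalize X * C - C * X = cX at *
  generalize Y * C - C * Y = cY at *
  have hf : 1 / 2 * frob ((-2 : ℂ) • wC) = 2 * (wC * wCᴴ).trace.re := by
    rw [frob, conjTranspose_smul, Matrix.smul_mul, Matrix.mul_smul, smul_smul, trace_smul]
    have : (-2 : ℂ) * star (-2 : ℂ) = ((4 : ℝ) : ℂ) := by simp; norm_num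
    rw [this, smul_eq_mul, Complex.re_ofReal_mul]
    ring
  have h3 := congrArg (fun M => (wC * Mᴴ).trace.re) hlinC
  have h4 := congrArg (fun M => (wC * Mᴴ).trace.re) hrel
  simp only [conjTranspose_add, conjTranspose_sub, conjTranspose_smul, Matrix.mul_add,
    Matrix.mul_sub, Matrix.sub_mul, trace_add, trace_sub, Complex.add_re, Complex.sub_re,
    Matrix.mul_smul, trace_smul, conjTranspose_zero, Matrix.mul_zero, trace_zero,
    Complex.zero_re] at h h3 h4
  have h5 : (star (2 : ℂ) • (wC * wCᴴ).trace).re = 2 * (wC * wCᴴ).trace.re := by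
    simp
  rw [h5] at h3
  rw [hf] at h
  linarith

end offDiagonal

section isometryPair

variable {n r m : ℕ} {S : Matrix (Fin n) (Fin r) ℂ} {R : Matrix (Fin n) (Fin m) ℂ}

lemma re_trace_mul_conjTranspose {α β : Type*} [Fintype α] [Fintype β] (G H : Matrix α β ℂ)
    {t : α → β → ℝ} (h : ∀ b a, (G b a * star (H b a)).re = t b a) :
    (G * Hᴴ).trace.re = ∑ b, ∑ a, t b a := by
  rw [Matrix.trace, Complex.re_sum]
  refine Finset.sum_congr rfl fun b _ => ?_
  rw [Matrix.diag_apply, Matrix.mul_apply, Complex.re_sum]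
  exact Finset.sum_congr rfl fun a _ => h b a

lemma trace_isometry_conj (hS : Sᴴ * S = 1) (hR : Rᴴ * R = 1) (G H : Matrix (Fin m) (Fin r) ℂ) :
    ((R * G * Sᴴ) * (R * H * Sᴴ)ᴴ).trace = (G * Hᴴ).trace := by
  have h : (R * G * Sᴴ) * (R * H * Sᴴ)ᴴ = R * (G * Hᴴ * Rᴴ) := by
    rw [conjTranspose_mul, conjTranspose_conjTranspose, conjTranspose_mul]
    calc R * G * Sᴴ * (S * (Hᴴ * Rᴴ)) = R * G * (Sᴴ * S) * (Hᴴ * Rᴴ) := by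
          simp only [Matrix.mul_assoc]
      _ = _ := by rw [hS, Matrix.mul_one]; simp only [Matrix.mul_assoc]
  rw [h, trace_mul_comm, Matrix.mul_assoc, hR, Matrix.mul_one]

lemma commutator_isometry_conj {X : Matrix (Fin n) (Fin n) ℂ} (hX : Xᴴ = X) {xs : Fin r → ℝ}
    {xr : Fin m → ℝ} (hXS : X * S = S * diagonal (fun a => (xs a : ℂ)))
    (hXR : X * R = R * diagonal (fun b => (xr b : ℂ))) (F : Matrix (Fin m) (Fin r) ℂ) :
    X * (R * F * Sᴴ) - (R * F * Sᴴ) * X =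
      R * (of fun b a => ((xr b - xs a : ℝ) : ℂ) * F b a) * Sᴴ := by
  have h1 : Sᴴ * X = diagonal (fun a => (xs a : ℂ)) * Sᴴ := by
    have := congrArg conjTranspose hXS
    rw [conjTranspose_mul, conjTranspose_mul, hX, diagonal_conjTranspose] at this
    rw [this]
    congr 2
    ext a; simp
  have h2 : (of fun b a => ((xr b - xs a : ℝ) : ℂ) * F b a) =
      diagonal (fun b => (xr b : ℂ)) * F - F * diagonal (fun a => (xs a : ℂ)) := by
    ext b a
    rw [of_apply, Matrix.sub_apply, Matrix.diagonal_mul, Matrix.mul_diagonal]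
    push_cast; ring
  rw [h2, Matrix.mul_sub, Matrix.sub_mul, ← Matrix.mul_assoc X, ← Matrix.mul_assoc X, hXR,
    Matrix.mul_assoc (R * F), h1]
  simp only [Matrix.mul_assoc]

lemma mul_add_smul_isometry_conj {N : Matrix (Fin n) (Fin n) ℂ} {ρ : Fin m → ℝ}
    (hNR : N * R = R * diagonal (fun b => (ρ b : ℂ))) (τ : ℝ) (F : Matrix (Fin m) (Fin r) ℂ) :
    N * (R * F * Sᴴ) + (τ : ℂ) • (R * F * Sᴴ) =
      R * (of fun b a => ((ρ b + τ : ℝ) : ℂ) * F b a) * Sᴴ := by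
  have h2 : (of fun b a => ((ρ b + τ : ℝ) : ℂ) * F b a) =
      diagonal (fun b => (ρ b : ℂ)) * F + (τ : ℂ) • F := by
    ext b a
    rw [of_apply, Matrix.add_apply, Matrix.diagonal_mul, Matrix.smul_apply, smul_eq_mul]
    push_cast; ring
  rw [h2, Matrix.mul_add, Matrix.add_mul, ← Matrix.mul_assoc N, ← Matrix.mul_assoc N, hNR,
    Matrix.mul_smul, Matrix.smul_mul]
  simp only [Matrix.mul_assoc]

end isometryPair

lemma card_eq_of_linearIndepOn {ι κ : Type*} [Fintype ι] [Fintype κ] {v : ι → κ → ℂ} {s : Set ι}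
    (hli : LinearIndepOn ℂ v s)
    (hspan : ∀ z : κ → ℂ, (∀ t ∈ s, ∑ x, z x * v t x = 0) → z = 0) :
    Nat.card s = Fintype.card κ := by
  classical
  refine le_antisymm ?_ ?_
  · have := LinearIndependent.fintype_card_le_finrank (R := ℂ) hli
    rwa [Module.finrank_fintype_fun_eq_card, ← Nat.card_eq_fintype_card] at this
  · let L : (κ → ℂ) →ₗ[ℂ] (s → ℂ) := LinearMap.pi fun t =>
      ∑ x, (v t x) • LinearMap.proj x
    have hL : ∀ z t, L z t = ∑ x, z x * v t x := by
      intro z t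
      simp [L, mul_comm]
    have hinj : Function.Injective L := by
      rw [injective_iff_map_eq_zero]
      intro z hz
      exact hspan z fun t ht => by rw [← hL z ⟨t, ht⟩, hz]; rfl
    have := LinearMap.finrank_le_finrank_of_injective hinj
    rwa [Module.finrank_fintype_fun_eq_card, Module.finrank_fintype_fun_eq_card,
      ← Nat.card_eq_fintype_card (α := s)] at this

theorem scalarSum_of_frames {n r m : ℕ} {c : Fin 3 → Fin r → ℕ} (hcm : ∀ l a, c l a ≤ m)
    {X : Fin 3 → Matrix (Fin n) (Fin n) ℂ} {N P : Matrix (Fin n) (Fin n) ℂ} {τ : ℝ}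
    {S : Fin 3 → Matrix (Fin n) (Fin r) ℂ} {R : Fin 3 → Matrix (Fin n) (Fin m) ℂ}
    {xs : Fin 3 → Fin r → ℝ} {xr ρ : Fin 3 → Fin m → ℝ}
    (hS : ∀ l, (S l)ᴴ * S l = 1) (hR : ∀ l, (R l)ᴴ * R l = 1) (hSP : ∀ l, S l * (S l)ᴴ = P)
    (hRP : ∀ l, R l * (R l)ᴴ = 1 - P) (hX : ∀ l, (X l)ᴴ = X l)
    (hXS : ∀ l, X l * S l = S l * diagonal (fun a => (xs l a : ℂ)))
    (hXR : ∀ l, X l * R l = R l * diagonal (fun b => (xr l b : ℂ)))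
    (hNR : ∀ l, N * R l = R l * diagonal (fun b => (ρ l b : ℂ)))
    (hρ : ∀ l b, 0 < ρ l b + τ)
    (hlt : ∀ l a (b : Fin m), (b : ℕ) < c l a → xs l a < xr l b)
    (hge : ∀ l a (b : Fin m), ¬ (b : ℕ) < c l a → xr l b ≤ xs l a)
    (hsum : ∑ l, X l = (2 : ℂ) • N) (hPN : P * N = -(τ : ℂ) • P)
    (hsec : ∀ Φ : Fin 3 → Matrix (Fin n) (Fin n) ℂ, (∀ l, Φ l * P = Φ l) →
      ∑ l, (X l * Φ l - Φ l * X l) = 0 →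
      ∑ l, ((N * Φ l + (τ : ℂ) • Φ l) * (X l * Φ l - Φ l * X l)ᴴ).trace.re ≤ 0) :
    ScalarSum r m c := by
  have hPS : ∀ l, (S l)ᴴ * P = (S l)ᴴ := by
    intro l
    rw [← hSP l, ← Matrix.mul_assoc, hS, Matrix.one_mul]
  have hRR : ∀ l, (1 - P) * R l = R l := by
    intro l
    rw [← hRP l, Matrix.mul_assoc, hR, Matrix.mul_one]
  let A : Fin 3 → Matrix (Fin r) (Fin r) ℂ := fun l => (S l)ᴴ * S 0
  let B : Fin 3 → Matrix (Fin m) (Fin m) ℂ := fun l => (R 0)ᴴ * R l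
  have hft : ∀ l a b x y, frameTensor (fun i a x => (A i)ᵀ x a) (fun i b y => B i y b)
      (l, a, b) (x, y) = A l a x * B l y b := fun _ _ _ _ _ => rfl
  have hli : LinearIndepOn ℂ (frameTensor (fun i a x => (A i)ᵀ x a) (fun i b y => B i y b))
      (diagram m c) := by
    rw [linearIndepOn_iff_forall_sum]
    intro z hz hz0
    let F : Fin 3 → Matrix (Fin m) (Fin r) ℂ := fun l b a => z (l, a, b)
    let G : Fin 3 → Matrix (Fin m) (Fin r) ℂ := fun l b a =>
      F l b a / ((xr l b - xs l a : ℝ) : ℂ)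
    have hFG : ∀ l, (of fun b a => ((xr l b - xs l a : ℝ) : ℂ) * G l b a) = F l := by
      intro l
      ext b a
      rw [of_apply]
      by_cases hba : (b : ℕ) < c l a
      · refine mul_div_cancel₀ _ ?_
        exact_mod_cast (sub_pos.mpr (hlt l a b hba)).ne'
      · have : F l b a = 0 := hz (l, a, b) hba
        simp [G, this]
    have hbr : ∀ l, X l * (R l * G l * (S l)ᴴ) - (R l * G l * (S l)ᴴ) * X l =
        R l * F l * (S l)ᴴ := by
      intro l
      rw [commutator_isometry_conj (hX l) (hXS l) (hXR l), hFG]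
    have hM : ∑ l, B l * F l * A l = 0 := by
      ext y x
      have h1 := congrFun hz0 (x, y)
      rw [Fintype.sum_prod_type] at h1
      rw [Matrix.sum_apply, Matrix.zero_apply, ← Pi.zero_apply (M := fun _ => ℂ) (x, y), ← h1,
        Finset.sum_apply]
      refine Finset.sum_congr rfl fun l _ => ?_
      rw [Fintype.sum_prod_type, Finset.sum_apply, Matrix.mul_apply]
      refine Finset.sum_congr rfl fun a _ => ?_
      rw [Matrix.mul_apply, Finset.sum_mul, Finset.sum_apply]
      refine Finset.sum_congr rfl fun b _ => ?_
      rw [Pi.smul_apply, hft, smul_eq_mul]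
      simp only [F]
      ring
    have hrel : ∑ l, R l * F l * (S l)ᴴ = 0 := by
      have h1 : ∀ l, R l * F l * (S l)ᴴ = R 0 * (B l * F l * A l) * (S 0)ᴴ := by
        intro l
        calc R l * F l * (S l)ᴴ = (R 0 * (R 0)ᴴ * R l) * F l * ((S l)ᴴ * (S 0 * (S 0)ᴴ)) := by
              rw [hRP, hRR, hSP, hPS]
          _ = _ := by simp only [A, B, Matrix.mul_assoc]
      rw [Finset.sum_congr rfl fun l _ => h1 l, ← Matrix.sum_mul, ← Matrix.mul_sum, hM,
        Matrix.mul_zero, Matrix.zero_mul]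
    have h := hsec (fun l => R l * G l * (S l)ᴴ)
      (fun l => by rw [Matrix.mul_assoc, hPS]) (by
        rw [← hrel]; exact Finset.sum_congr rfl fun l _ => hbr l)
    have hterm : ∀ l, ((N * (R l * G l * (S l)ᴴ) + (τ : ℂ) • (R l * G l * (S l)ᴴ)) *
        (X l * (R l * G l * (S l)ᴴ) - (R l * G l * (S l)ᴴ) * X l)ᴴ).trace.re =
        ∑ b, ∑ a, (ρ l b + τ) * ((xr l b - xs l a) * Complex.normSq (G l b a)) := by
      intro l
      rw [mul_add_smul_isometry_conj (hNR l), commutator_isometry_conj (hX l) (hXS l) (hXR l),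
        trace_isometry_conj (hS l) (hR l)]
      refine re_trace_mul_conjTranspose _ _ fun b a => ?_
      rw [of_apply, of_apply, star_mul', Complex.star_def, Complex.conj_ofReal,
        mul_mul_mul_comm, Complex.mul_conj]
      norm_cast
      ring
    rw [Finset.sum_congr rfl fun l _ => hterm l] at h
    have hnn : ∀ l b a, 0 ≤ (ρ l b + τ) * ((xr l b - xs l a) * Complex.normSq (G l b a)) := by
      intro l b a
      by_cases hba : (b : ℕ) < c l a
      · exact mul_nonneg (hρ l b).le (mul_nonneg (sub_pos.mpr (hlt l a b hba)).le
          (Complex.normSq_nonneg _))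
      · have : G l b a = 0 := by
          have : F l b a = 0 := hz (l, a, b) hba
          simp [G, this]
        rw [this]; simp
    have hzero := le_antisymm h (Finset.sum_nonneg fun l _ => Finset.sum_nonneg fun b _ =>
      Finset.sum_nonneg fun a _ => hnn l b a)
    rintro ⟨l, a, b⟩
    by_cases hba : (b : ℕ) < c l a
    · rw [Finset.sum_eq_zero_iff_of_nonneg fun l _ => Finset.sum_nonneg fun b _ =>
        Finset.sum_nonneg fun a _ => hnn l b a] at hzero
      have h1 := hzero l (Finset.mem_univ _)
      rw [Finset.sum_eq_zero_iff_of_nonneg fun b _ => Finset.sum_nonneg fun a _ => hnn l b a] at h1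
      have h2 := h1 b (Finset.mem_univ _)
      rw [Finset.sum_eq_zero_iff_of_nonneg fun a _ => hnn l b a] at h2
      have h3 := h2 a (Finset.mem_univ _)
      have hx := (sub_pos.mpr (hlt l a b hba)).ne'
      have h4 : G l b a = 0 := Complex.normSq_eq_zero.mp
        ((mul_eq_zero.mp ((mul_eq_zero.mp h3).resolve_left (hρ l b).ne')).resolve_left hx)
      have h5 : F l b a = 0 := by
        rw [← hFG l, of_apply, h4, mul_zero]
      exact h5
    · exact hz (l, a, b) hba
  refine scalarSum_of_linearIndepOn hcm (fun l => ?_) hli ?_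
  · have h1 : A l * (A l)ᴴ = 1 := by
      calc A l * (A l)ᴴ = (S l)ᴴ * (S 0 * (S 0)ᴴ) * S l := by
            simp only [A, conjTranspose_mul, conjTranspose_conjTranspose, Matrix.mul_assoc]
        _ = 1 := by rw [hSP, hPS, hS]
    have h2 := congrArg transpose h1
    rw [transpose_mul, transpose_one] at h2
    exact h2
  · rw [card_eq_of_linearIndepOn hli, Fintype.card_prod, Fintype.card_fin, Fintype.card_fin]
    intro z hz
    let Z : Matrix (Fin m) (Fin r) ℂ := fun y x => star (z (x, y))
    let F : Fin 3 → Matrix (Fin m) (Fin r) ℂ := fun l => (B l)ᴴ * Z * (A l)ᴴ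
    let φ := R 0 * Z * (S 0)ᴴ
    have hφ : ∀ l, φ = R l * F l * (S l)ᴴ := by
      intro l
      calc φ = ((1 - P) * R 0) * Z * ((S 0)ᴴ * P) := by rw [hRR, hPS]
        _ = (R l * (R l)ᴴ * R 0) * Z * ((S 0)ᴴ * (S l * (S l)ᴴ)) := by rw [hRP, hSP]
        _ = _ := by
          simp only [F, A, B, conjTranspose_mul, conjTranspose_conjTranspose, Matrix.mul_assoc]
    have hF : ∀ l a (b : Fin m), (b : ℕ) < c l a → F l b a = 0 := by
      intro l a b hba
      have h1 := congrArg star (hz (l, a, b) hba)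
      rw [star_zero, star_sum, Fintype.sum_prod_type] at h1
      refine Eq.trans ?_ h1
      refine (Matrix.mul_apply (M := (B l)ᴴ * Z) (N := (A l)ᴴ)).trans ?_
      refine Finset.sum_congr rfl fun x _ => ?_
      rw [Matrix.mul_apply, Finset.sum_mul]
      refine Finset.sum_congr rfl fun y _ => ?_
      rw [hft, conjTranspose_apply, conjTranspose_apply, star_mul', star_mul']
      simp only [Z]
      ring
    have hterm : ∀ l, (φ * (X l * φ - φ * X l)ᴴ).trace.re =
        ∑ b, ∑ a, (xr l b - xs l a) * Complex.normSq (F l b a) := by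
      intro l
      rw [hφ l, commutator_isometry_conj (hX l) (hXS l) (hXR l), trace_isometry_conj (hS l) (hR l)]
      refine re_trace_mul_conjTranspose _ _ fun b a => ?_
      rw [of_apply, star_mul', Complex.star_def, Complex.conj_ofReal, mul_left_comm,
        Complex.mul_conj]
      norm_cast
    have hle : ∀ l, (φ * (X l * φ - φ * X l)ᴴ).trace.re ≤ 0 := by
      intro l
      rw [hterm]
      refine Finset.sum_nonpos fun b _ => Finset.sum_nonpos fun a _ => ?_
      by_cases hba : (b : ℕ) < c l a
      · rw [hF l a b hba]; simp
      · exact mul_nonpos_of_nonpos_of_nonneg (sub_nonpos.mpr (hge l a b hba))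
          (Complex.normSq_nonneg _)
    have hφP : φ * P = φ := by simp only [φ]; rw [Matrix.mul_assoc, hPS]
    have hφN : φ * N = -(τ : ℂ) • φ := by
      rw [← hφP, Matrix.mul_assoc, hPN, Matrix.mul_smul]
    have htot : ∑ l, (X l * φ - φ * X l) = (2 : ℂ) • (N * φ + (τ : ℂ) • φ) := by
      rw [Finset.sum_sub_distrib, ← Matrix.sum_mul, ← Matrix.mul_sum, hsum, Matrix.smul_mul,
        Matrix.mul_smul, hφN]
      module
    have hpos : (φ * (∑ l, (X l * φ - φ * X l))ᴴ).trace.re =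
        2 * ∑ b, ∑ a, (ρ 0 b + τ) * Complex.normSq (Z b a) := by
      rw [htot, mul_add_smul_isometry_conj (hNR 0), conjTranspose_smul, Matrix.mul_smul,
        trace_smul, trace_isometry_conj (hS 0) (hR 0), star_ofNat, ← re_trace_mul_conjTranspose
        Z (of fun b a => ((ρ 0 b + τ : ℝ) : ℂ) * Z b a) (t := fun b a =>
          (ρ 0 b + τ) * Complex.normSq (Z b a))]
      · simp
      · intro b a
        rw [of_apply, star_mul', Complex.star_def, Complex.conj_ofReal, mul_left_comm,
          Complex.mul_conj]
        norm_cast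
    rw [conjTranspose_sum, Matrix.mul_sum, trace_sum, Complex.re_sum] at hpos
    have hnn : ∀ b a, 0 ≤ (ρ 0 b + τ) * Complex.normSq (Z b a) := fun b a =>
      mul_nonneg (hρ 0 b).le (Complex.normSq_nonneg _)
    have hzero : ∑ b, ∑ a, (ρ 0 b + τ) * Complex.normSq (Z b a) = 0 := by
      refine le_antisymm ?_ (Finset.sum_nonneg fun b _ => Finset.sum_nonneg fun a _ => hnn b a)
      have := Finset.sum_nonpos fun l (_ : l ∈ Finset.univ) => hle l
      rw [hpos] at this
      linarith
    rw [Finset.sum_eq_zero_iff_of_nonneg fun b _ => Finset.sum_nonneg fun a _ => hnn b a] at hzero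
    ext ⟨x, y⟩
    have h1 := hzero y (Finset.mem_univ _)
    rw [Finset.sum_eq_zero_iff_of_nonneg fun a _ => hnn y a] at h1
    have h2 := (mul_eq_zero.mp (h1 x (Finset.mem_univ _))).resolve_left (hρ 0 y).ne'
    exact star_eq_zero.mp (Complex.normSq_eq_zero.mp h2)

lemma submatrix_mul_conjTranspose_orderEmbOfFin {n r : ℕ} (U : Matrix (Fin n) (Fin n) ℂ)
    (I : Finset (Fin n)) (h : I.card = r) :
    U.submatrix id (I.orderEmbOfFin h) * (U.submatrix id (I.orderEmbOfFin h))ᴴ =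
      U * diagonal (fun i => if i ∈ I then (1 : ℂ) else 0) * Uᴴ := by
  ext x y
  have h1 : ∀ f : Fin n → ℂ, ∑ a, f (I.orderEmbOfFin h a) = ∑ i ∈ I, f i := by
    intro f
    conv_rhs => rw [← Finset.map_orderEmbOfFin_univ I h, Finset.sum_map]
    rfl
  rw [Matrix.mul_apply, Matrix.mul_apply]
  simp only [submatrix_apply, id, conjTranspose_apply, Matrix.mul_diagonal]
  rw [h1 fun i => U x i * star (U y i)]
  simp

lemma exists_adapted_frames {n r : ℕ} {X N V : Matrix (Fin n) (Fin n) ℂ} {μ : Fin n → ℝ} {τ : ℝ}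
    (hX : X.IsHermitian) (hN : N.IsHermitian) (hXN : X * N = N * X) (hV : Vᴴ * V = 1)
    (hNV : N = V * diagonal (fun i => (μ i : ℂ)) * Vᴴ) (hμ : ∀ i, -τ ≤ μ i)
    (hr : (Finset.univ.filter fun i => μ i = -τ).card = r) :
    ∃ (I : Finset (Fin n)) (hI : I.card = r) (S : Matrix (Fin n) (Fin r) ℂ)
      (R : Matrix (Fin n) (Fin (n - r)) ℂ) (xs : Fin r → ℝ) (xr ρ : Fin (n - r) → ℝ),
      Sᴴ * S = 1 ∧ Rᴴ * R = 1 ∧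
      S * Sᴴ = V * diagonal (fun i => if μ i = -τ then (1 : ℂ) else 0) * Vᴴ ∧
      R * Rᴴ = 1 - V * diagonal (fun i => if μ i = -τ then (1 : ℂ) else 0) * Vᴴ ∧
      X * S = S * diagonal (fun a => (xs a : ℂ)) ∧ X * R = R * diagonal (fun b => (xr b : ℂ)) ∧
      N * R = R * diagonal (fun b => (ρ b : ℂ)) ∧ (∀ b, 0 < ρ b + τ) ∧
      (∀ a (b : Fin (n - r)), (b : ℕ) < level I hI a → xs a < xr b) ∧
      (∀ a (b : Fin (n - r)), ¬ (b : ℕ) < level I hI a → xr b ≤ xs a) ∧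
      ∑ a, xs a = ∑ i ∈ I, eigVec X hX i := by
  obtain ⟨U, x, ν, hU, hx, hν, hUX, hUN⟩ := exists_unitary_of_commute hX hN hXN
  have hU' : U * Uᴴ = 1 := mul_eq_one_comm.mp hU
  have hconj := conj_diagonal_comp_eq hU hV (hUN.symm.trans hNV)
  have hνle : ∀ i, -τ ≤ ν i := by
    intro i
    have h := hconj fun t => if t < -τ then 1 else 0
    have h0 : diagonal (fun i => (((if μ i < -τ then 1 else 0 : ℝ)) : ℂ)) = 0 := by
      ext a b
      simp [diagonal_apply, not_lt.mpr (hμ a)]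
    rw [h0, Matrix.mul_zero, Matrix.zero_mul] at h
    have h1 := congrArg (fun M => Uᴴ * M * U) h
    simp only [Matrix.mul_zero, Matrix.zero_mul, Matrix.mul_assoc, hU, Matrix.mul_one] at h1
    rw [← Matrix.mul_assoc, hU, Matrix.one_mul] at h1
    have h2 := congrFun (congrFun h1 i) i
    rw [diagonal_apply_eq] at h2
    by_contra hlt
    simp [not_le.mp hlt] at h2
  have hind := hconj fun t => if t = -τ then 1 else 0
  have hcast : ∀ y : Fin n → ℝ, (fun i => (((if y i = -τ then 1 else 0 : ℝ)) : ℂ)) =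
      fun i => if y i = -τ then (1 : ℂ) else 0 := by
    intro y; ext i; split_ifs <;> simp
  simp only [hcast] at hind
  let I : Finset (Fin n) := Finset.univ.filter fun i => ν i = -τ
  have hmem : ∀ i, i ∈ I ↔ ν i = -τ := fun i => by simp [I]
  have hI : I.card = r := by
    have h := congrArg trace hind
    rw [trace_mul_comm, ← Matrix.mul_assoc, hU, trace_mul_comm _ Vᴴ, ← Matrix.mul_assoc, hV,
      Matrix.one_mul, Matrix.one_mul, trace_diagonal, trace_diagonal, Finset.sum_boole,
      Finset.sum_boole] at h
    rw [← hr]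
    exact_mod_cast h
  have hIc : Iᶜ.card = n - r := by rw [Finset.card_compl, hI, Fintype.card_fin]
  have hiso : ∀ {k : ℕ} (e : Fin k ↪o Fin n), (U.submatrix id e)ᴴ * U.submatrix id e = 1 := by
    intro k e
    rw [conjTranspose_submatrix, ← submatrix_mul _ _ e id e Function.bijective_id, hU,
      submatrix_one _ e.injective]
  have hcol : ∀ {k : ℕ} (e : Fin k ↪o Fin n) {M : Matrix (Fin n) (Fin n) ℂ} {d : Fin n → ℝ},
      M = U * diagonal (fun i => (d i : ℂ)) * Uᴴ →
      M * U.submatrix id e = U.submatrix id e * diagonal (fun a => ((d (e a) : ℝ) : ℂ)) := by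
    intro k e M d hM
    have h1 : M * U = U * diagonal (fun i => (d i : ℂ)) := by
      rw [hM, Matrix.mul_assoc, hU, Matrix.mul_one]
    ext a b
    have h2 := congrFun (congrFun h1 a) (e b)
    rw [Matrix.mul_diagonal] at h2 ⊢
    exact h2
  have hνI : ∀ a, ν (I.orderEmbOfFin hI a) = -τ := fun a =>
    (hmem _).mp (Finset.orderEmbOfFin_mem _ _ _)
  have hνIc : ∀ b, -τ < ν (Iᶜ.orderEmbOfFin hIc b) := fun b =>
    lt_of_le_of_ne (hνle _) fun h => Finset.mem_compl.mp (Finset.orderEmbOfFin_mem Iᶜ hIc b)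
      ((hmem _).mpr h.symm)
  have hSS := submatrix_mul_conjTranspose_orderEmbOfFin U I hI
  simp only [hmem] at hSS
  refine ⟨I, hI, U.submatrix id (I.orderEmbOfFin hI), U.submatrix id (Iᶜ.orderEmbOfFin hIc),
    fun a => x (I.orderEmbOfFin hI a), fun b => x (Iᶜ.orderEmbOfFin hIc b),
    fun b => ν (Iᶜ.orderEmbOfFin hIc b), hiso _, hiso _, ?_, ?_, hcol _ hUX, hcol _ hUX,
    hcol _ hUN, ?_, ?_, ?_, ?_⟩
  · rw [hSS, hind]
  · have h1 : diagonal (fun i => if i ∈ Iᶜ then (1 : ℂ) else 0) =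
        1 - diagonal (fun i => if ν i = -τ then (1 : ℂ) else 0) := by
      rw [← diagonal_one, diagonal_sub]
      congr 1; ext i
      by_cases hi : ν i = -τ <;> simp [hmem, hi]
    rw [submatrix_mul_conjTranspose_orderEmbOfFin, ← hind, h1, Matrix.mul_sub, Matrix.sub_mul,
      Matrix.mul_one, hU']
  · intro b
    linarith [hνIc b]
  · intro a b hab
    rw [← compl_orderEmbOfFin_lt_iff I hI hIc] at hab
    refine lt_of_le_of_ne (hx hab.le) fun h => ?_
    have := hν _ _ hab.le h.symm
    linarith [hνIc b, hνI a]
  · intro a b hab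
    rw [← compl_orderEmbOfFin_lt_iff I hI hIc, not_lt] at hab
    exact hx hab
  · rw [eigVec_unique hX hx hU hUX]
    conv_rhs => rw [← Finset.map_orderEmbOfFin_univ I hI, Finset.sum_map]
    rfl

theorem exists_scalarSum_of_isMin {n : ℕ} {g X Z : Matrix (Fin n) (Fin n) ℂ} (hg : gᴴ = g)
    (hgg : g * g = 1) (hX : X.IsHermitian) (hZ : Z.IsHermitian) (hgZ : g * Z * g = -Z)
    (hmin : ∀ V : Matrix (Fin n) (Fin n) ℂ, Vᴴ * V = 1 →
      frob (oddPart g X - Z) ≤ frob (oddPart g (V * X * Vᴴ) - Z))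
    (hne : oddPart g X - Z ≠ 0) (hY : (-(g * X * g)).IsHermitian)
    (hT : (-((2 : ℂ) • Z)).IsHermitian) :
    ∃ r, 1 ≤ r ∧ 2 * r ≤ n ∧ ∃ (I : Fin 3 → Finset (Fin n)) (hI : ∀ l, (I l).card = r),
      ScalarSum r (n - r) (fun l => level (I l) (hI l)) ∧
      ∑ i ∈ I 0, eigVec X hX i + ∑ i ∈ I 1, eigVec _ hY i + ∑ i ∈ I 2, eigVec _ hT i < 0 := by
  have hXN := commute_of_isMin hg hgg hX hZ hgZ hmin
  have hsec := second_order_of_isMin hg hgg hX hZ hgZ hmin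
  have hNh : (oddPart g X - Z).IsHermitian := (oddPart_isHermitian hg hX).sub hZ
  have hgN : g * (oddPart g X - Z) * g = -(oddPart g X - Z) := by
    rw [Matrix.mul_sub, Matrix.sub_mul, conj_oddPart hgg, hgZ]
    abel
  have hXYT : X + -(g * X * g) + -((2 : ℂ) • Z) = (2 : ℂ) • (oddPart g X - Z) := by
    unfold oddPart
    module
  generalize oddPart g X - Z = N at *
  set Y := -(g * X * g) with hYdef
  set T := -((2 : ℂ) • Z) with hTdef
  have hNg : N * g = -(g * N) := by
    calc N * g = g * (g * N * g) := by
          rw [Matrix.mul_assoc g N g, ← Matrix.mul_assoc g g, hgg, Matrix.one_mul]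
      _ = -(g * N) := by rw [hgN, Matrix.mul_neg]
  have hYN : Y * N = N * Y := by
    have h1 : g * N = -(N * g) := by rw [hNg, neg_neg]
    calc Y * N = -(g * X * (g * N)) := by
          rw [hYdef, Matrix.neg_mul, Matrix.mul_assoc (g * X)]
      _ = g * (X * N) * g := by
          rw [h1, Matrix.mul_neg, neg_neg]; simp only [Matrix.mul_assoc]
      _ = (g * N) * X * g := by rw [hXN]; simp only [Matrix.mul_assoc]
      _ = N * Y := by
          rw [h1, hYdef, Matrix.neg_mul, Matrix.neg_mul, Matrix.mul_neg]
          simp only [Matrix.mul_assoc]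
  have hTN : T * N = N * T := by
    have : T = (2 : ℂ) • N - X - Y := by rw [← hXYT]; abel
    rw [this, Matrix.sub_mul, Matrix.sub_mul, Matrix.mul_sub, Matrix.mul_sub, hXN, hYN,
      Matrix.smul_mul, Matrix.mul_smul]
  obtain ⟨V, hV, hNV⟩ := exists_unitary_eigVec N hNh
  have hV' : V * Vᴴ = 1 := mul_eq_one_comm.mp hV
  set μ := eigVec N hNh with hμdef
  have htr : N.trace = 0 := by
    have h1 : (g * N * g).trace = N.trace := by
      rw [trace_mul_comm, ← Matrix.mul_assoc, hgg, Matrix.one_mul]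
    rw [hgN, trace_neg] at h1
    exact self_eq_neg.mp h1.symm
  have hsumμ : ∑ i, μ i = 0 := by
    rw [hNV, trace_mul_comm, ← Matrix.mul_assoc, hV, Matrix.one_mul, trace_diagonal] at htr
    exact_mod_cast htr
  have hneg : ∃ i, μ i < 0 := by
    by_contra! h
    have h1 := (Finset.sum_eq_zero_iff_of_nonneg fun i _ => h i).mp hsumμ
    refine hne ?_
    rw [hNV]
    have : (fun i => (μ i : ℂ)) = 0 := by
      ext i; rw [h1 i (Finset.mem_univ _)]; simp
    rw [this, diagonal_zero', Matrix.mul_zero, Matrix.zero_mul]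
  obtain ⟨i₁, hi₁⟩ := hneg
  obtain ⟨i₀, -, hi₀⟩ := Finset.exists_min_image Finset.univ μ ⟨i₁, Finset.mem_univ _⟩
  obtain ⟨τ, hτ⟩ : ∃ τ, μ i₀ = -τ := ⟨-μ i₀, (neg_neg _).symm⟩
  have hτpos : 0 < τ := by
    have := hi₀ i₁ (Finset.mem_univ _)
    linarith
  have hμle : ∀ i, -τ ≤ μ i := fun i => hτ ▸ hi₀ i (Finset.mem_univ _)
  obtain ⟨r, hr⟩ : ∃ r, (Finset.univ.filter fun i => μ i = -τ).card = r := ⟨_, rfl⟩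
  have hr1 : 1 ≤ r := by
    rw [← hr]
    exact Finset.card_pos.mpr ⟨i₀, by simp [hτ]⟩
  have hM : ∀ l, ((![X, Y, T] : Fin 3 → Matrix (Fin n) (Fin n) ℂ) l).IsHermitian := by
    intro l; fin_cases l; exacts [hX, hY, hT]
  have hMN : ∀ l, ((![X, Y, T] : Fin 3 → Matrix (Fin n) (Fin n) ℂ) l) * N = N * ![X, Y, T] l := by
    intro l; fin_cases l; exacts [hXN, hYN, hTN]
  choose I hI S R xs xr ρ hS hR hSP hRP hXS hXR hNR hρ hlt hge hxs using fun l =>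
    exists_adapted_frames (hM l) hNh (hMN l) hV hNV hμle hr
  have hPN : V * diagonal (fun i => if μ i = -τ then (1 : ℂ) else 0) * Vᴴ * N =
      -(τ : ℂ) • (V * diagonal (fun i => if μ i = -τ then (1 : ℂ) else 0) * Vᴴ) := by
    have h1 : diagonal (fun i => if μ i = -τ then (1 : ℂ) else 0) *
        diagonal (fun i => (μ i : ℂ)) =
        -(τ : ℂ) • diagonal (fun i => if μ i = -τ then (1 : ℂ) else 0) := by
      rw [diagonal_mul_diagonal, ← diagonal_smul]
      congr 1; ext i
      by_cases h : μ i = -τ <;> simp [h]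
    rw [← Matrix.smul_mul, ← Matrix.mul_smul, ← h1]
    conv_lhs => rw [hNV]
    calc _ = V * diagonal (fun i => if μ i = -τ then (1 : ℂ) else 0) * (Vᴴ * V) *
          diagonal (fun i => (μ i : ℂ)) * Vᴴ := by simp only [Matrix.mul_assoc]
      _ = _ := by rw [hV, Matrix.mul_one]; simp only [Matrix.mul_assoc]
  generalize V * diagonal (fun i => if μ i = -τ then (1 : ℂ) else 0) * Vᴴ = P at *
  have hP : Pᴴ = P := by
    rw [← hSP 0, conjTranspose_mul, conjTranspose_conjTranspose]
  have hPP : P * P = P := by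
    conv_lhs => rw [← hSP 0]
    rw [Matrix.mul_assoc, ← Matrix.mul_assoc _ (S 0), hS, Matrix.one_mul, hSP]
  have htrP : P.trace = r := by
    rw [← hSP 0, trace_mul_comm, hS, trace_one, Fintype.card_fin]
  have hNP : N * P = -(τ : ℂ) • P := by
    have := congrArg conjTranspose hPN
    rw [conjTranspose_mul, conjTranspose_smul, hP, hNh.eq] at this
    rw [this]; simp
  have hPM : ∀ l, P * ![X, Y, T] l = ![X, Y, T] l * P := by
    intro l
    have h1 := congrArg conjTranspose (hXS l)
    rw [conjTranspose_mul, conjTranspose_mul, (hM l).eq, diagonal_conjTranspose] at h1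
    have h2 : star (fun a => (xs l a : ℂ)) = fun a => (xs l a : ℂ) := by ext a; simp
    rw [← hSP l, Matrix.mul_assoc, h1, ← Matrix.mul_assoc (![X, Y, T] l), hXS, h2,
      Matrix.mul_assoc]
  have hPgP : P * g * P = 0 := by
    have h1 : P * N * g * P = -(P * g * (N * P)) := by
      rw [Matrix.mul_assoc P N, hNg]
      simp only [Matrix.mul_neg, Matrix.neg_mul, Matrix.mul_assoc]
    rw [hPN, hNP, Matrix.smul_mul, Matrix.smul_mul, Matrix.mul_smul] at h1
    have h2 : (2 * (τ : ℂ)) • (P * g * P) = 0 := by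
      rw [two_mul, add_smul]
      have := congrArg (fun M => -M) h1
      simp only [neg_smul, neg_neg] at this
      nth_rewrite 1 [this]
      simp
    exact (smul_eq_zero.mp h2).resolve_left
      (mul_ne_zero two_ne_zero (by exact_mod_cast hτpos.ne'))
  refine ⟨r, hr1, ?_, I, hI, ?_, ?_⟩
  · have hA : (1 - P - g * P * g) * (1 - P - g * P * g)ᴴ = 1 - P - g * P * g := by
      have e1 : P * (g * P * g) = 0 := by
        rw [← Matrix.mul_assoc, ← Matrix.mul_assoc, hPgP, Matrix.zero_mul]
      have e2 : g * P * g * P = 0 := by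
        rw [Matrix.mul_assoc g P, Matrix.mul_assoc g, hPgP, Matrix.mul_zero]
      have e3 : g * P * g * (g * P * g) = g * P * g := by
        calc g * P * g * (g * P * g) = g * P * (g * g) * P * g := by simp only [Matrix.mul_assoc]
          _ = g * (P * P) * g := by rw [hgg, Matrix.mul_one]; simp only [Matrix.mul_assoc]
          _ = _ := by rw [hPP]
      have e4 : (1 - P - g * P * g)ᴴ = 1 - P - g * P * g := by
        simp only [conjTranspose_sub, conjTranspose_mul, conjTranspose_one, hP, hg,
          Matrix.mul_assoc]
      rw [e4]
      simp only [Matrix.sub_mul, Matrix.mul_sub, Matrix.one_mul, Matrix.mul_one, e1, e2, e3, hPP]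
      abel
    have h1 := frob_nonneg (1 - P - g * P * g)
    rw [frob, hA, trace_sub, trace_sub, trace_mul_comm _ g, ← Matrix.mul_assoc, hgg,
      Matrix.one_mul, htrP, trace_one, Fintype.card_fin] at h1
    simp only [Complex.sub_re, Complex.natCast_re] at h1
    have : ((2 * r : ℕ) : ℝ) ≤ n := by push_cast; linarith
    exact_mod_cast this
  · refine scalarSum_of_frames (fun l a => level_le (I l) (hI l) a) hS hR hSP hRP
      (fun l => (hM l).eq) hXS hXR hNR hρ hlt hge ?_ hPN ?_
    · rw [Fin.sum_univ_three]; exact hXYT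
    · intro Φ hΦ hrel
      rw [Fin.sum_univ_three] at hrel ⊢
      exact second_order_triple hPN hNh.eq hX.eq hY.eq (Complex.conj_ofReal τ) hXN hYN hXYT
        (fun hA hB => second_order_pair hg hgg hgN hP hPgP hPN (hPM 0) (hPM 1) hYdef hsec hA hB)
        (hΦ 0) (hΦ 1) (hΦ 2) hrel
  · have h1 : ∀ l, (P * ![X, Y, T] l).trace = ((∑ i ∈ I l, eigVec _ (hM l) i : ℝ) : ℂ) := by
      intro l
      rw [hPM, ← hSP l, ← Matrix.mul_assoc, hXS, trace_mul_comm, ← Matrix.mul_assoc, hS,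
        Matrix.one_mul, trace_diagonal, ← hxs l]
      push_cast; rfl
    have h2 : (P * (X + Y + T)).trace = ((2 * -τ * r : ℝ) : ℂ) := by
      rw [hXYT, Matrix.mul_smul, hPN, trace_smul, trace_smul, htrP]
      push_cast
      simp only [smul_eq_mul]; ring
    rw [Matrix.mul_add, Matrix.mul_add, trace_add, trace_add] at h2
    have e0 : (P * X).trace = ((∑ i ∈ I 0, eigVec X hX i : ℝ) : ℂ) := h1 0
    have e1 : (P * Y).trace = ((∑ i ∈ I 1, eigVec Y hY i : ℝ) : ℂ) := h1 1
    have e2 : (P * T).trace = ((∑ i ∈ I 2, eigVec T hT i : ℝ) : ℂ) := h1 2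
    rw [e0, e1, e2] at h2
    have h3 : ∑ i ∈ I 0, eigVec X hX i + ∑ i ∈ I 1, eigVec Y hY i + ∑ i ∈ I 2, eigVec T hT i
        = 2 * -τ * r := by exact_mod_cast h2
    rw [h3]
    have : (1 : ℝ) ≤ r := by exact_mod_cast hr1
    nlinarith

/-- The rectangular diagonal `p × q` matrix with diagonal entries `s`. -/
def rectDiagonal (p q : ℕ) (s : Fin q → ℝ) : Matrix (Fin p) (Fin q) ℂ :=
  of fun i j => if (i : ℕ) = j then (s j : ℂ) else 0

lemma sval_rectDiagonal {p q : ℕ} (hpq : q ≤ p) {s : Fin q → ℝ} (hs : Antitone s)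
    (hs0 : ∀ i, 0 ≤ s i) (i : Fin q) : sval (rectDiagonal p q s) i = s i := by
  have hd : eigVec (rectDiagonal p q s * (rectDiagonal p q s)ᴴ)
      (isHermitian_mul_conjTranspose_self _) =
      fun i : Fin p => if h : (i : ℕ) < q then s ⟨i, h⟩ ^ 2 else 0 := by
    refine eigVec_unique (U := 1) _ ?_ (by simp) ?_
    · intro a b hab
      have hab' : (a : ℕ) ≤ b := hab
      dsimp only
      split_ifs with h1 h2
      · exact pow_le_pow_left₀ (hs0 _) (hs (by simpa using hab')) 2
      · omega
      · positivity
      · exact le_rfl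
    · rw [conjTranspose_one, Matrix.one_mul, Matrix.mul_one]
      ext a b
      simp only [Matrix.mul_apply, conjTranspose_apply, rectDiagonal, of_apply, diagonal_apply]
      split_ifs with hab h
      · subst hab
        rw [Finset.sum_eq_single (⟨a, h⟩ : Fin q)]
        · simp [sq]
        · intro c _ hc
          have : (a : ℕ) ≠ c := fun h' => hc (Fin.ext h'.symm)
          simp [this]
        · simp
      · subst hab
        rw [Finset.sum_eq_zero]
        · simp
        · intro c _
          have : (a : ℕ) ≠ c := by have := c.isLt; omega
          simp [this]
      · refine Finset.sum_eq_zero fun c _ => ?_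
        by_cases h1 : (a : ℕ) = c
        · have : (b : ℕ) ≠ c := fun h2 => hab (Fin.ext (h1.trans h2.symm))
          simp [this]
        · simp [h1]
  have hip : (i : ℕ) < p := i.isLt.trans_le hpq
  rw [sval, dif_pos hip, hd]
  simp [Real.sqrt_sq (hs0 i)]

lemma blockTR_hatM (p q : ℕ) (Y : Matrix (Fin p) (Fin q) ℂ) : blockTR p q (hatM p q Y) = Y := by
  ext i j
  simp [hatM, blockTR]

lemma signM_conj_hatM (p q : ℕ) (Y : Matrix (Fin p) (Fin q) ℂ) :
    signM p q * hatM p q Y * signM p q = -hatM p q Y := by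
  have h := sub_signM_conj p q (hatM_isHermitian p q Y)
  rw [blockTR_hatM, two_smul, sub_eq_iff_eq_add] at h
  have h2 : hatM p q Y + (signM p q * hatM p q Y * signM p q + hatM p q Y) = hatM p q Y + 0 := by
    rw [add_zero]; nth_rewrite 4 [h]; abel
  exact eq_neg_of_add_eq_zero_left (add_left_cancel h2)

lemma oddPart_signM {p q : ℕ} {X : Matrix (Fin (p + q)) (Fin (p + q)) ℂ} (hX : X.IsHermitian) :
    oddPart (signM p q) X = hatM p q (blockTR p q X) := by
  rw [oddPart, sub_signM_conj p q hX, smul_smul]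
  norm_num

theorem mem_coneA_of_inequalities {p q : ℕ} (hpq : q ≤ p) {lam : Fin (p + q) → ℝ}
    (hlam : Antitone lam) {s : Fin q → ℝ} (hs : Antitone s) (hs0 : ∀ i, 0 ≤ s i)
    (h : ∀ (r : ℕ), 1 ≤ r → 2 * r ≤ p + q →
        ∀ (I J K : Finset (Fin (p + q))) (hI : I.card = r) (hJ : J.card = r) (hK : K.card = r),
          (muVec I hI, muVec J hJ, muVec K hK) ∈ Horn r →
          (∑ i ∈ I, lam i) - (∑ i ∈ opp J, lam i) ≥
            2 * sumRestr s K - 2 * sumRestr s (opp K)) :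
    (lam, s) ∈ coneA p q := by
  have hs' : (fun i : Fin q => sval (rectDiagonal p q s) i) = s :=
    funext (sval_rectDiagonal hpq hs hs0)
  obtain ⟨U, hU, hmin⟩ := exists_isMin_frob (signM p q) (diagonal fun i => (lam i : ℂ))
    (hatM p q (rectDiagonal p q s))
  have hX := isHermitian_conj_diagonal U lam
  generalize hXdef : U * diagonal (fun i => (lam i : ℂ)) * Uᴴ = X at *
  have hXlam : eigVec X hX = lam := eigVec_unique hX hlam hU hXdef.symm
  have hZ := hatM_isHermitian p q (rectDiagonal p q s)
  by_cases hne : oddPart (signM p q) X - hatM p q (rectDiagonal p q s) = 0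
  · rw [oddPart_signM hX, sub_eq_zero] at hne
    have h1 := congrArg (blockTR p q) hne
    rw [blockTR_hatM, blockTR_hatM] at h1
    refine ⟨X, hX, hXlam.symm, fun i => ?_⟩
    rw [h1, sval_rectDiagonal hpq hs hs0]
  exfalso
  have hgg := signM_mul_self p q
  have hgs := signM_conjTranspose p q
  have hg : (signM p q)ᴴ * signM p q = 1 := by rw [hgs, hgg]
  have hgX : (signM p q * X * (signM p q)ᴴ).IsHermitian :=
    isHermitian_mul_mul_conjTranspose _ hX
  have hY : eigVec _ hgX.neg = starVec lam := by
    rw [eigVec_neg hgX, eigVec_conj hX hg, hXlam]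
  have h2Z : (((2 : ℝ) : ℂ) • hatM p q (rectDiagonal p q s)).IsHermitian := by
    rw [IsHermitian, conjTranspose_smul, hZ.eq, Complex.star_def, Complex.conj_ofReal]
  have hT : eigVec _ h2Z.neg = fun i => 2 * hatPQ p q s i := by
    have : eigVec _ h2Z = fun i => 2 * hatPQ p q s i := by
      ext i
      rw [eigVec_smul hZ (by norm_num), eigVec_hatM hpq, hs']
    rw [eigVec_neg h2Z, this]
    conv_rhs => rw [← starVec_hatPQ hpq s]
    ext i; simp [starVec]
  have hgX' := hgX.neg
  have h2Z' := h2Z.neg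
  simp only [hgs] at hgX'
  replace hY : eigVec _ hgX' = starVec lam := by
    rw [← hY]; congr; exact hgs.symm
  simp only [Complex.ofReal_ofNat] at h2Z' hT
  obtain ⟨r, hr1, hrn, I, hI, hS, hlt⟩ := exists_scalarSum_of_isMin hgs hgg hX hZ
    (signM_conj_hatM p q _) hmin hne hgX' h2Z'
  rw [hXlam, hY, hT] at hlt
  have hK : (opp (I 2)).card = r := (opp_card _).trans (hI 2)
  have hopp : opp (opp (I 2)) = I 2 := opp_opp _
  have hL : I = ![I 0, I 1, opp (opp (I 2))] := by
    rw [hopp]; ext i; fin_cases i <;> rfl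
  have h1 := h r hr1 hrn (I 0) (I 1) (opp (I 2)) (hI 0) (hI 1) hK (by
    rw [mem_Horn_iff_scalarSum,
      ← scalarSum_of_mem_Horn (I 0) (I 1) (opp (I 2)) (hI 0) (hI 1)
        ((opp_card _).trans hK) I hL hI]
    exact hS)
  rw [inequality_iff hpq, hopp] at h1
  exact absurd hlt (not_lt.mpr h1)

theorem stmt_2 (p q : ℕ) (hq : 1 ≤ q) (hpq : q ≤ p)
    (lam : Fin (p + q) → ℝ) (hlam : Antitone lam)
    (s : Fin q → ℝ) (hs : Antitone s) (hs0 : ∀ i, 0 ≤ s i) :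
    (lam, s) ∈ coneA p q ↔
      ∀ (r : ℕ), 1 ≤ r → 2 * r ≤ p + q →
        ∀ (I J K : Finset (Fin (p + q))) (hI : I.card = r) (hJ : J.card = r) (hK : K.card = r),
          (muVec I hI, muVec J hJ, muVec K hK) ∈ Horn r →
          (∑ i ∈ I, lam i) - (∑ i ∈ opp J, lam i) ≥
            2 * sumRestr s K - 2 * sumRestr s (opp K) := by
  refine ⟨fun h r _ hr I J K hI hJ hK hH => ?_, mem_coneA_of_inequalities hpq hlam hs hs0⟩
  exact inequality_of_mem_coneA hpq h (by omega) I J K hI hJ hK hH
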